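/- arXiv:2412.09290 — 5 statements merged into one kernel-verified Lean document; each statement's English description precedes it below -/
import Mathlib

section
/- Let Ψ be a function smooth in a neighborhood of 0, and define the sequence c_n := Ψ^{(n)}(0)/(n-1)! for n ≥ 1. Define, for every n ≥ 1, μ_n := Σ_{m=0}^{n-1} [n!/(m!·(m+1)!·(n-m)!)] · d^m/dx^m ((Ψ'(x))^{n-m}) evaluated at x = 0. Then the sequence (μ_n) satisfies the free moment-cumulant relations μ_n = Σ_{π ∈ NC(n)} ∏_{V ∈ π} c_{|V|}, where NC(n) denotes the set of non-crossing partitions of {1,...,n}. -/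
open scoped Classical

/-- `P` is a (set) partition of `{0, ..., n-1}`: blocks are nonempty and every element
lies in exactly one block. -/
def IsPartitionOf (n : ℕ) (P : Finset (Finset (Fin n))) : Prop :=
  (∅ ∉ P) ∧ ∀ i : Fin n, ∃! V, V ∈ P ∧ i ∈ V

/-- `P` is non-crossing: there are no distinct blocks `V, W` and elements
`v₁ < w₁ < v₂ < w₂` with `v₁, v₂ ∈ V`, `w₁, w₂ ∈ W`. -/
def IsNonCrossing {n : ℕ} (P : Finset (Finset (Fin n))) : Prop :=
  ∀ V ∈ P, ∀ W ∈ P, V ≠ W →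
    ∀ v₁ ∈ V, ∀ w₁ ∈ W, ∀ v₂ ∈ V, ∀ w₂ ∈ W, ¬(v₁ < w₁ ∧ w₁ < v₂ ∧ v₂ < w₂)

/-- The finite set of non-crossing partitions of `{0, ..., n-1}`. -/
noncomputable def NC (n : ℕ) : Finset (Finset (Finset (Fin n))) :=
  Finset.univ.filter (fun P => IsPartitionOf n P ∧ IsNonCrossing P)

theorem iteratedDeriv_pow_eq_coeff {f : ℝ → ℝ} {x : ℝ} (hf : ∀ n : ℕ, ContDiffAt ℝ n f x)
    (R : PowerSeries ℝ) (hR : ∀ m, iteratedDeriv m f x = m.factorial * PowerSeries.coeff m R)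
    (k m : ℕ) :
    iteratedDeriv m (fun y => f y ^ k) x = m.factorial * PowerSeries.coeff m (R ^ k) := by
  induction k generalizing m with
  | zero => cases m <;> simp [iteratedDeriv_const, PowerSeries.coeff_one]
  | succ k ih =>
    simp only [pow_succ]
    rw [iteratedDeriv_fun_mul ((hf m).pow k) (hf m), PowerSeries.coeff_mul,
      Finset.Nat.sum_antidiagonal_eq_sum_range_succ_mk, Finset.mul_sum]
    refine Finset.sum_congr rfl fun i hi => ?_
    have hi' : i ≤ m := Nat.lt_succ_iff.mp (Finset.mem_range.mp hi)
    rw [ih, hR, ← Nat.choose_mul_factorial_mul_factorial hi']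
    push_cast
    ring

theorem PowerSeries.sum_coeff_mul_coeff_X_pow_mul (S Q : PowerSeries ℝ) (n : ℕ) :
    ∑ k ∈ Finset.range (n + 1), coeff k S * coeff n (X ^ k * Q) = coeff n (S * Q) := by
  rw [coeff_mul, Finset.Nat.sum_antidiagonal_eq_sum_range_succ_mk]
  refine Finset.sum_congr rfl fun k hk => ?_
  rw [coeff_X_pow_mul', if_pos (Nat.lt_succ_iff.mp (Finset.mem_range.mp hk))]

theorem PowerSeries.coeff_natCast_mul (f : PowerSeries ℝ) (k n : ℕ) :
    coeff n ((k : PowerSeries ℝ) * f) = k * coeff n f := by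
  rw [← map_natCast PowerSeries.C k, coeff_C_mul]

theorem PowerSeries.coeff_X_mul_derivative (f : PowerSeries ℝ) (n : ℕ) :
    coeff n (X * derivative ℝ f) = n * coeff n f := by
  cases n with
  | zero => simp
  | succ n => rw [coeff_succ_X_mul, coeff_derivative]; push_cast; ring

/-- The ballot-type recurrence satisfied by the coefficients of `X ^ h * (1 + X * R) ^ (n + 1)`. -/
theorem PowerSeries.ballot_recurrence (R : PowerSeries ℝ) (n h : ℕ) :
    ((n : ℝ) + 1) * (h + 1) * coeff (n + 1) (X ^ h * (1 + X * R) ^ (n + 2)) =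
      (n + 2) * (h * coeff (n + 1) (X ^ h * (1 + X * R) ^ (n + 1)) +
        ∑ k ∈ Finset.range (n + 1),
          coeff k R * ((h + k + 1) * coeff n (X ^ (h + k) * (1 + X * R) ^ (n + 1)))) := by
  set C : PowerSeries ℝ := 1 + X * R with hC
  have hC' : derivative ℝ C = R + X * derivative ℝ R := by
    simp [hC, Derivation.leibniz, derivative_X]; ring
  set S : PowerSeries ℝ := ((h : PowerSeries ℝ) + 1) * R + X * derivative ℝ R with hS
  have hSc : ∀ k, coeff k S = (h + k + 1) * coeff k R := by
    intro k
    rw [hS, map_add, coeff_X_mul_derivative, add_mul, one_mul, map_add, coeff_natCast_mul]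
    ring
  have hsum : ∑ k ∈ Finset.range (n + 1),
      coeff k R * ((h + k + 1) * coeff n (X ^ (h + k) * C ^ (n + 1))) =
      coeff (n + 1) (X * (S * (X ^ h * C ^ (n + 1)))) := by
    rw [coeff_succ_X_mul, ← sum_coeff_mul_coeff_X_pow_mul]
    refine Finset.sum_congr rfl fun k _ => ?_
    rw [hSc, pow_add, mul_comm (X ^ h), mul_assoc (X ^ k)]
    ring
  set G : PowerSeries ℝ := X ^ h * C ^ (n + 2) with hG
  have key : ((n : PowerSeries ℝ) + 2) * ((h : PowerSeries ℝ) * (X ^ h * C ^ (n + 1)) +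
      X * (S * (X ^ h * C ^ (n + 1)))) =
      ((n : PowerSeries ℝ) + 1) * (h : PowerSeries ℝ) * G + X * derivative ℝ G := by
    have hXR : X * R = C - 1 := by rw [hC]; ring
    have hXS : X * S = (h : PowerSeries ℝ) * (C - 1) + X * derivative ℝ C := by
      rw [hC', hS, ← hXR]; ring
    have hXh : X * derivative ℝ (X ^ h : PowerSeries ℝ) = (h : PowerSeries ℝ) * X ^ h := by
      cases h with
      | zero => simp
      | succ h => rw [Derivation.leibniz_pow]; simp [derivative_X]; ring
    have hGd : X * derivative ℝ G = (h : PowerSeries ℝ) * G +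
        ((n : PowerSeries ℝ) + 2) * X ^ h * C ^ (n + 1) * (X * derivative ℝ C) := by
      rw [hG, Derivation.leibniz, Derivation.leibniz_pow]
      simp only [smul_eq_mul, nsmul_eq_mul]
      rw [mul_add, show X * (C ^ (n + 2) * derivative ℝ (X ^ h : PowerSeries ℝ))
        = C ^ (n + 2) * (X * derivative ℝ (X ^ h : PowerSeries ℝ)) by ring, hXh]
      push_cast
      ring
    rw [hGd, ← mul_assoc X S, hXS, hG]
    ring
  rw [hsum]
  have := congrArg (coeff (n + 1)) key
  rw [show (n : PowerSeries ℝ) + 2 = ((n + 2 : ℕ) : PowerSeries ℝ) by push_cast; ring,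
    show (n : PowerSeries ℝ) + 1 = ((n + 1 : ℕ) : PowerSeries ℝ) by push_cast; ring,
    coeff_natCast_mul, map_add, map_add, mul_assoc, coeff_natCast_mul, coeff_natCast_mul,
    coeff_natCast_mul, coeff_X_mul_derivative] at this
  push_cast at this
  linear_combination -this

theorem coeff_one_add_X_mul_pow (R : PowerSeries ℝ) {n : ℕ} (hn : 1 ≤ n) :
    PowerSeries.coeff n ((1 + PowerSeries.X * R) ^ (n + 1)) =
      ∑ m ∈ Finset.range n, ((n + 1).choose (n - m) : ℝ) * PowerSeries.coeff m (R ^ (n - m)) := by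
  have hcoeff : ∀ k ≤ n, PowerSeries.coeff n ((PowerSeries.X * R) ^ k) =
      PowerSeries.coeff (n - k) (R ^ k) := by
    intro k hk
    rw [mul_pow, PowerSeries.coeff_X_pow_mul', if_pos hk]
  rw [add_comm, add_pow, map_sum]
  simp only [one_pow, mul_one, mul_comm _ (((n + 1).choose _ : ℕ) : PowerSeries ℝ),
    PowerSeries.coeff_natCast_mul]
  rw [Finset.sum_range_succ, Finset.sum_range_succ', mul_pow (PowerSeries.X) R (n + 1),
    PowerSeries.coeff_X_pow_mul', if_neg (by omega), pow_zero, PowerSeries.coeff_one,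
    if_neg (by omega), mul_zero, mul_zero, add_zero, add_zero, ← Finset.sum_range_reflect]
  refine Finset.sum_congr rfl fun m hm => ?_
  have hm' := Finset.mem_range.mp hm
  rw [show n - 1 - m + 1 = n - m by omega, hcoeff _ (by omega), show n - (n - m) = m by omega]

section Combinatorics

variable {α : Type*} [LinearOrder α]

/-- `P` is a non-crossing partition of `S \ A` none of whose blocks encloses an element of `A`. -/
structure IsOpenNonCrossing (S A : Finset α) (P : Finset (Finset α)) : Prop where
  empty_notMem : ∅ ∉ P
  mem_of_mem : ∀ V ∈ P, ∀ i ∈ V, i ∈ S ∧ i ∉ A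
  exists_mem : ∀ i ∈ S, i ∉ A → ∃ V ∈ P, i ∈ V
  eq_of_mem : ∀ V ∈ P, ∀ W ∈ P, ∀ i ∈ V, i ∈ W → V = W
  nonCrossing : ∀ V ∈ P, ∀ W ∈ P, V ≠ W →
    ∀ v₁ ∈ V, ∀ w₁ ∈ W, ∀ v₂ ∈ V, ∀ w₂ ∈ W, ¬(v₁ < w₁ ∧ w₁ < v₂ ∧ v₂ < w₂)
  not_enclosed : ∀ V ∈ P, ∀ v₁ ∈ V, ∀ v₂ ∈ V, ∀ x ∈ A, ¬(v₁ < x ∧ x < v₂)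

theorem isOpenNonCrossing_insert_insert {S A : Finset α} {a : α} {P : Finset (Finset α)}
    (ha : ∀ x ∈ S, a < x) :
    IsOpenNonCrossing (insert a S) (insert a A) P ↔ IsOpenNonCrossing S A P := by
  have haS : a ∉ S := fun h => lt_irrefl a (ha a h)
  constructor
  · rintro ⟨h1, h2, h3, h4, h5, h6⟩
    refine ⟨h1, ?_, ?_, h4, h5, ?_⟩
    · intro V hV i hi; have := h2 V hV i hi; simp only [Finset.mem_insert] at this; grind
    · intro i hi hA; exact h3 i (by simp [hi]) (by simp only [Finset.mem_insert]; grind)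
    · intro V hV v hv w hw x hx; exact h6 V hV v hv w hw x (by simp [hx])
  · rintro ⟨h1, h2, h3, h4, h5, h6⟩
    refine ⟨h1, ?_, ?_, h4, h5, ?_⟩
    · intro V hV i hi; have := h2 V hV i hi; simp only [Finset.mem_insert]; grind
    · intro i hi hA; simp only [Finset.mem_insert] at hi hA; exact h3 i (by grind) (by grind)
    · intro V hV v hv w hw x hx
      rcases Finset.mem_insert.mp hx with rfl | hx
      · exact fun h => absurd h.1 (not_lt.mpr (ha v (h2 V hV v hv).1).le)
      · exact h6 V hV v hv w hw x hx

theorem IsOpenNonCrossing.insert_block {S A B : Finset α} {a : α} {P : Finset (Finset α)}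
    (ha : ∀ x ∈ S, a < x) (hA : A ⊆ S) (hB : B ⊆ S \ A) (hBA : ∀ b ∈ B, ∀ x ∈ A, b < x)
    (hP : IsOpenNonCrossing S (A ∪ B) P) :
    IsOpenNonCrossing (insert a S) A (insert (insert a B) P) := by
  have haS : a ∉ S := fun h => lt_irrefl a (ha a h)
  obtain ⟨h1, h2, h3, h4, h5, h6⟩ := hP
  have hB' : ∀ b ∈ B, b ∈ S ∧ b ∉ A := fun b hb => Finset.mem_sdiff.mp (hB hb)
  simp only [Finset.mem_union] at h2 h3 h6
  refine ⟨?_, ?_, ?_, ?_, ?_, ?_⟩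
  · simp only [Finset.mem_insert, not_or]
    exact ⟨(Finset.insert_ne_empty _ _).symm, h1⟩
  · simp only [Finset.mem_insert]
    rintro V (rfl | hV) i hi
    · simp only [Finset.mem_insert] at hi
      rcases hi with rfl | hi
      · exact ⟨Or.inl rfl, fun h => haS (hA h)⟩
      · exact ⟨Or.inr (hB' i hi).1, (hB' i hi).2⟩
    · have := h2 V hV i hi
      grind
  · simp only [Finset.mem_insert]
    intro i hi hiA
    by_cases hib : i = a ∨ i ∈ B
    · exact ⟨insert a B, Or.inl rfl, Finset.mem_insert.mpr hib⟩
    · obtain ⟨V, hV, hiV⟩ := h3 i (by grind) (by grind)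
      exact ⟨V, Or.inr hV, hiV⟩
  · have key : ∀ W ∈ P, ∀ i ∈ insert a B, i ∉ W := by
      intro W hW i hi hiW
      have := h2 W hW i hiW
      simp only [Finset.mem_insert] at hi
      grind
    simp only [Finset.mem_insert (s := P)]
    rintro V (rfl | hV) W (rfl | hW) i hi hiW
    · rfl
    · exact absurd hiW (key W hW i hi)
    · exact absurd hi (key V hV i hiW)
    · exact h4 V hV W hW i hi hiW
  · simp only [Finset.mem_insert (s := P)]
    rintro V (rfl | hV) W (rfl | hW) hVW v₁ hv₁ w₁ hw₁ v₂ hv₂ w₂ hw₂ ⟨l1, l2, l3⟩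
    · exact hVW rfl
    · rcases Finset.mem_insert.mp hv₂ with rfl | hv₂
      · exact absurd (ha w₁ (h2 W hW w₁ hw₁).1) (not_lt.mpr l2.le)
      · exact h6 W hW w₁ hw₁ w₂ hw₂ v₂ (Or.inr hv₂) ⟨l2, l3⟩
    · rcases Finset.mem_insert.mp hw₁ with rfl | hw₁
      · exact absurd (ha v₁ (h2 V hV v₁ hv₁).1) (not_lt.mpr l1.le)
      · exact h6 V hV v₁ hv₁ v₂ hv₂ w₁ (Or.inr hw₁) ⟨l1, l2⟩
    · exact h5 V hV W hW hVW v₁ hv₁ w₁ hw₁ v₂ hv₂ w₂ hw₂ ⟨l1, l2, l3⟩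
  · simp only [Finset.mem_insert (s := P)]
    rintro V (rfl | hV) v₁ hv₁ v₂ hv₂ x hx ⟨l1, l2⟩
    · rcases Finset.mem_insert.mp hv₂ with rfl | hv₂
      · exact absurd (ha x (hA hx)) (not_lt.mpr l2.le)
      · exact absurd (hBA v₂ hv₂ x hx) (not_lt.mpr l2.le)
    · exact h6 V hV v₁ hv₁ v₂ hv₂ x (Or.inl hx) ⟨l1, l2⟩

theorem IsOpenNonCrossing.exists_eq_insert {S A : Finset α} {a : α} {P : Finset (Finset α)}
    (ha : ∀ x ∈ S, a < x) (hA : A ⊆ S) (hP : IsOpenNonCrossing (insert a S) A P) :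
    ∃ B Q, B ⊆ S \ A ∧ (∀ b ∈ B, ∀ x ∈ A, b < x) ∧ IsOpenNonCrossing S (A ∪ B) Q ∧
      insert (insert a B) Q = P := by
  have haS : a ∉ S := fun h => lt_irrefl a (ha a h)
  obtain ⟨h1, h2, h3, h4, h5, h6⟩ := hP
  obtain ⟨V, hV, haV⟩ := h3 a (Finset.mem_insert_self a S) (fun h => haS (hA h))
  have hVa : insert a (V.erase a) = V := Finset.insert_erase haV
  have hV2 : ∀ i ∈ V, i ≠ a → i ∈ S ∧ i ∉ A := by
    intro i hi hia
    have := h2 V hV i hi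
    simp only [Finset.mem_insert] at this
    grind
  have hQ2 : ∀ W ∈ P.erase V, ∀ i ∈ W, i ∈ S ∧ i ∉ A ∧ i ∉ V := by
    intro W hW i hi
    have hWV := Finset.ne_of_mem_erase hW
    have hiV : i ∉ V := fun h => hWV (h4 W (Finset.mem_of_mem_erase hW) V hV i hi h)
    have := h2 W (Finset.mem_of_mem_erase hW) i hi
    simp only [Finset.mem_insert] at this
    grind
  refine ⟨V.erase a, P.erase V, ?_, ?_, ⟨?_, ?_, ?_, ?_, ?_, ?_⟩, ?_⟩
  · intro i hi
    rw [Finset.mem_erase] at hi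
    exact Finset.mem_sdiff.mpr (hV2 i hi.2 hi.1)
  · intro b hb x hx
    rw [Finset.mem_erase] at hb
    by_contra hlt
    rcases (not_lt.mp hlt).eq_or_lt with rfl | hlt
    · exact (hV2 _ hb.2 hb.1).2 hx
    · exact h6 V hV a haV b hb.2 x hx ⟨ha x (hA hx), hlt⟩
  · exact fun h => h1 (Finset.mem_of_mem_erase h)
  · intro W hW i hi
    have := hQ2 W hW i hi
    simp only [Finset.mem_union, Finset.mem_erase]
    grind
  · intro i hi hiA
    simp only [Finset.mem_union, Finset.mem_erase, not_or] at hiA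
    obtain ⟨W, hW, hiW⟩ := h3 i (Finset.mem_insert_of_mem hi) hiA.1
    refine ⟨W, Finset.mem_erase.mpr ⟨?_, hW⟩, hiW⟩
    rintro rfl
    exact hiA.2 ⟨fun h => haS (h ▸ hi), hiW⟩
  · intro W hW W' hW'
    exact h4 W (Finset.mem_of_mem_erase hW) W' (Finset.mem_of_mem_erase hW')
  · intro W hW W' hW'
    exact h5 W (Finset.mem_of_mem_erase hW) W' (Finset.mem_of_mem_erase hW')
  · rintro W hW v₁ hv₁ v₂ hv₂ x hx ⟨l1, l2⟩
    have hWP := Finset.mem_of_mem_erase hW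
    rcases Finset.mem_union.mp hx with hx | hx
    · exact h6 W hWP v₁ hv₁ v₂ hv₂ x hx ⟨l1, l2⟩
    · exact h5 V hV W hWP (Finset.ne_of_mem_erase hW).symm a haV v₁ hv₁ x
        (Finset.mem_of_mem_erase hx) v₂ hv₂ ⟨ha v₁ (hQ2 W hW v₁ hv₁).1, l1, l2⟩
  · rw [hVa, Finset.insert_erase hV]

theorem exists_initial_segment (T : Finset α) {k : ℕ} (hk : k ≤ T.card) :
    ∃ B ⊆ T, B.card = k ∧ ∀ b ∈ B, ∀ x ∈ T \ B, b < x := by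
  induction k with
  | zero => exact ⟨∅, by simp⟩
  | succ k ih =>
    obtain ⟨B, hBT, hB, hlt⟩ := ih (by omega)
    have hne : (T \ B).Nonempty := by
      rw [← Finset.card_pos, Finset.card_sdiff_of_subset hBT]; omega
    have hmin := Finset.min'_mem _ hne
    set m := (T \ B).min' hne with hm
    have hmin' := Finset.mem_sdiff.mp hmin
    refine ⟨insert m B, ?_, ?_, ?_⟩
    · exact Finset.insert_subset hmin'.1 hBT
    · rw [Finset.card_insert_of_notMem hmin'.2, hB]
    · intro b hb x hx
      simp only [Finset.mem_sdiff, Finset.mem_insert, not_or] at hx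
      have hxT : x ∈ T \ B := Finset.mem_sdiff.mpr ⟨hx.1, hx.2.2⟩
      rcases Finset.mem_insert.mp hb with rfl | hb
      · exact lt_of_le_of_ne (Finset.min'_le _ _ hxT) (Ne.symm hx.2.1)
      · exact hlt b hb x hxT

theorem initial_segment_unique {T B B' : Finset α} (hB : B ⊆ T) (hB' : B' ⊆ T)
    (hcard : B.card = B'.card) (h : ∀ b ∈ B, ∀ x ∈ T \ B, b < x)
    (h' : ∀ b ∈ B', ∀ x ∈ T \ B', b < x) : B = B' := by
  by_contra hne
  obtain ⟨x, hx, hx'⟩ : ∃ x ∈ B, x ∉ B' := by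
    by_contra! hsub
    exact hne (Finset.eq_of_subset_of_card_le hsub hcard.ge)
  obtain ⟨y, hy, hy'⟩ : ∃ y ∈ B', y ∉ B := by
    by_contra! hsub
    exact hne (Finset.eq_of_subset_of_card_le hsub hcard.le).symm
  exact lt_asymm (h x hx y (Finset.mem_sdiff.mpr ⟨hB' hy, hy'⟩))
    (h' y hy x (Finset.mem_sdiff.mpr ⟨hB hx, hx'⟩))

theorem sum_powersetCard_initial_segment (S : Finset α) (h : ℕ) (f : ℕ → ℝ) (w : Finset α → ℝ) :
    ∑ A ∈ S.powersetCard h, ∑ B ∈ (S \ A).powerset with ∀ b ∈ B, ∀ x ∈ A, b < x,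
        f B.card * w (A ∪ B) =
      ∑ k ∈ Finset.range (S.card + 1), f k * ∑ T ∈ S.powersetCard (h + k), w T := by
  simp only [Finset.mul_sum]
  rw [Finset.sum_sigma', Finset.sum_sigma']
  have hdisj : ∀ A B : Finset α, B ⊆ S \ A → Disjoint A B := fun A B hB =>
    Finset.disjoint_left.mpr fun x hx hxB => (Finset.mem_sdiff.mp (hB hxB)).2 hx
  refine Finset.sum_bij (fun x _ => ⟨x.2.card, x.1 ∪ x.2⟩) ?_ ?_ ?_ ?_
  · rintro ⟨A, B⟩ hx
    simp only [Finset.mem_sigma, Finset.mem_filter, Finset.mem_powerset,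
      Finset.mem_powersetCard, Finset.mem_range] at hx ⊢
    obtain ⟨⟨hA, hAc⟩, hB, -⟩ := hx
    have hBS := hB.trans Finset.sdiff_subset
    refine ⟨Nat.lt_succ_of_le (Finset.card_le_card hBS), Finset.union_subset hA hBS, ?_⟩
    rw [Finset.card_union_of_disjoint (hdisj A B hB), hAc]
  · rintro ⟨A, B⟩ hx ⟨A', B'⟩ hx' heq
    simp only [Finset.mem_sigma, Finset.mem_filter, Finset.mem_powerset,
      Finset.mem_powersetCard] at hx hx'
    obtain ⟨⟨hA, hAc⟩, hB, hBA⟩ := hx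
    obtain ⟨⟨hA', hAc'⟩, hB', hBA'⟩ := hx'
    simp only [Sigma.mk.injEq, heq_eq_eq] at heq
    obtain ⟨hcard, hunion⟩ := heq
    have hsd : (A ∪ B) \ B = A := Finset.union_sdiff_cancel_right (hdisj A B hB)
    have hsd' : (A' ∪ B') \ B' = A' := Finset.union_sdiff_cancel_right (hdisj A' B' hB')
    have hBB : B = B' := by
      refine initial_segment_unique (T := A ∪ B) Finset.subset_union_right
        (hunion ▸ Finset.subset_union_right) hcard ?_ ?_
      · rwa [hsd]
      · rwa [hunion, hsd']
    subst hBB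
    have hAA : A = A' := by rw [← hsd, hunion, hsd']
    rw [hAA]
  · rintro ⟨k, T⟩ hx
    simp only [Finset.mem_sigma, Finset.mem_powersetCard, Finset.mem_range] at hx
    obtain ⟨-, hT, hTc⟩ := hx
    obtain ⟨B, hBT, rfl, hlt⟩ := exists_initial_segment T (k := k) (by omega)
    refine ⟨⟨T \ B, B⟩, ?_, ?_⟩
    · simp only [Finset.mem_sigma, Finset.mem_filter, Finset.mem_powerset,
        Finset.mem_powersetCard]
      refine ⟨⟨Finset.sdiff_subset.trans hT, ?_⟩, ?_, hlt⟩
      · rw [Finset.card_sdiff_of_subset hBT]; omega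
      · exact fun x hx => Finset.mem_sdiff.mpr
          ⟨hT (hBT hx), fun h => (Finset.mem_sdiff.mp h).2 hx⟩
    · simp only [Finset.sdiff_union_of_subset hBT]
  · rintro ⟨A, B⟩ _
    rfl

variable [Fintype α]

/-- The weighted count of the partitions `P` with `IsOpenNonCrossing S A P`. -/
noncomputable def openWeight (c : ℕ → ℝ) (S A : Finset α) : ℝ :=
  ∑ P with IsOpenNonCrossing S A P, ∏ V ∈ P, c V.card

theorem openWeight_insert_insert (c : ℕ → ℝ) {S A : Finset α} {a : α} (ha : ∀ x ∈ S, a < x) :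
    openWeight c (insert a S) (insert a A) = openWeight c S A := by
  simp only [openWeight, isOpenNonCrossing_insert_insert ha]

theorem openWeight_insert (c : ℕ → ℝ) {S A : Finset α} {a : α} (ha : ∀ x ∈ S, a < x)
    (hA : A ⊆ S) :
    openWeight c (insert a S) A =
      ∑ B ∈ (S \ A).powerset with ∀ b ∈ B, ∀ x ∈ A, b < x,
        c (B.card + 1) * openWeight c S (A ∪ B) := by
  have haS : a ∉ S := fun h => lt_irrefl a (ha a h)
  simp only [openWeight, Finset.mul_sum]
  rw [Finset.sum_sigma']
  symm
  have hnot : ∀ B B' : Finset α, ∀ P, IsOpenNonCrossing S (A ∪ B) P → insert a B' ∉ P :=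
    fun B B' P hP h => haS (hP.mem_of_mem _ h a (Finset.mem_insert_self a B')).1
  refine Finset.sum_bij (fun x _ => insert (insert a x.1) x.2) ?_ ?_ ?_ ?_
  · rintro ⟨B, P⟩ h
    simp only [Finset.mem_sigma, Finset.mem_filter, Finset.mem_powerset, Finset.mem_univ,
      true_and] at h ⊢
    exact h.2.insert_block ha hA h.1.1 h.1.2
  · rintro ⟨B, P⟩ h ⟨B', P'⟩ h' heq
    simp only [Finset.mem_sigma, Finset.mem_filter, Finset.mem_powerset, Finset.mem_univ,
      true_and] at h h' heq
    have haB : a ∉ B := fun hh => haS (Finset.mem_sdiff.mp (h.1.1 hh)).1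
    have haB' : a ∉ B' := fun hh => haS (Finset.mem_sdiff.mp (h'.1.1 hh)).1
    have hBB : B = B' := by
      have hmem : insert a B ∈ insert (insert a B') P' := heq ▸ Finset.mem_insert_self _ _
      rcases Finset.mem_insert.mp hmem with e | e
      · rw [← Finset.erase_insert haB, e, Finset.erase_insert haB']
      · exact absurd e (hnot B' B P' h'.2)
    subst hBB
    have hPP : P = P' := by
      rw [← Finset.erase_insert (hnot B B P h.2), heq, Finset.erase_insert (hnot B B P' h'.2)]
    rw [hPP]
  · intro P hP
    simp only [Finset.mem_filter, Finset.mem_univ, true_and] at hP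
    obtain ⟨B, Q, hB, hBA, hQ, rfl⟩ := hP.exists_eq_insert ha hA
    refine ⟨⟨B, Q⟩, ?_, rfl⟩
    simp only [Finset.mem_sigma, Finset.mem_filter, Finset.mem_powerset, Finset.mem_univ,
      true_and]
    exact ⟨⟨hB, hBA⟩, hQ⟩
  · rintro ⟨B, P⟩ h
    simp only [Finset.mem_sigma, Finset.mem_filter, Finset.mem_powerset, Finset.mem_univ,
      true_and] at h
    have haB : a ∉ B := fun hh => haS (Finset.mem_sdiff.mp (h.1.1 hh)).1
    rw [Finset.prod_insert (hnot B B P h.2), Finset.card_insert_of_notMem haB]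

theorem openWeight_empty (c : ℕ → ℝ) : openWeight c (∅ : Finset α) ∅ = 1 := by
  have : (Finset.univ.filter fun P : Finset (Finset α) => IsOpenNonCrossing ∅ ∅ P) = {∅} := by
    ext P
    simp only [Finset.mem_filter, Finset.mem_univ, true_and, Finset.mem_singleton]
    constructor
    · intro hP
      refine Finset.eq_empty_of_forall_notMem fun V hV => ?_
      obtain ⟨i, hi⟩ := Finset.nonempty_iff_ne_empty.mpr fun h => hP.empty_notMem (h ▸ hV)
      simpa using (hP.mem_of_mem V hV i hi).1
    · rintro rfl
      constructor <;> simp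
  rw [openWeight, this]
  simp

theorem sum_openWeight (c : ℕ → ℝ) (S : Finset α) (h : ℕ) :
    ((S.card : ℝ) + 1) * ∑ A ∈ S.powersetCard h, openWeight c S A =
      (h + 1) * PowerSeries.coeff S.card
        (PowerSeries.X ^ h *
          (1 + PowerSeries.X * PowerSeries.mk fun k => c (k + 1)) ^ (S.card + 1)) := by
  induction S using Finset.induction_on_min generalizing h with
  | empty =>
    cases h with
    | zero => simp [openWeight_empty]
    | succ h =>
      rw [Finset.powersetCard_eq_empty.mpr (by simp)]
      simp
  | insert a S ha ih =>
    have haS : a ∉ S := fun h => lt_irrefl a (ha a h)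
    rw [Finset.card_insert_of_notMem haS]
    set R := PowerSeries.mk fun k => c (k + 1) with hR
    set n := S.card with hn
    have hR' : ∀ k, PowerSeries.coeff k R = c (k + 1) := fun k => by simp [hR]
    have hstep : ∑ A ∈ S.powersetCard h, openWeight c (insert a S) A =
        ∑ k ∈ Finset.range (n + 1),
          c (k + 1) * ∑ T ∈ S.powersetCard (h + k), openWeight c S T := by
      rw [← sum_powersetCard_initial_segment S h (fun k => c (k + 1))]
      refine Finset.sum_congr rfl fun A hA => ?_
      convert openWeight_insert c ha (Finset.mem_powersetCard.mp hA).1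
    have hsum : ((n : ℝ) + 1) * ∑ A ∈ (insert a S).powersetCard h, openWeight c (insert a S) A =
        h * PowerSeries.coeff (n + 1)
          (PowerSeries.X ^ h * (1 + PowerSeries.X * R) ^ (n + 1)) +
        ∑ k ∈ Finset.range (n + 1), PowerSeries.coeff k R * ((h + k + 1) *
          PowerSeries.coeff n (PowerSeries.X ^ (h + k) * (1 + PowerSeries.X * R) ^ (n + 1))) := by
      have hrest : ((n : ℝ) + 1) * ∑ A ∈ S.powersetCard h, openWeight c (insert a S) A =
          ∑ k ∈ Finset.range (n + 1), PowerSeries.coeff k R * ((h + k + 1) *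
            PowerSeries.coeff n
              (PowerSeries.X ^ (h + k) * (1 + PowerSeries.X * R) ^ (n + 1))) := by
        rw [hstep, Finset.mul_sum]
        refine Finset.sum_congr rfl fun k _ => ?_
        rw [mul_left_comm, ih, hR']
        push_cast
        ring
      cases h with
      | zero =>
        rw [← hrest]
        simp
      | succ h =>
        rw [Finset.powersetCard_succ_insert haS, Finset.sum_union, mul_add, hrest, add_comm,
          Finset.sum_image]
        · simp only [openWeight_insert_insert c ha]
          rw [ih, pow_succ' PowerSeries.X h, mul_assoc PowerSeries.X, PowerSeries.coeff_succ_X_mul]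
          push_cast
          ring
        · intro A hA B hB hAB
          have hA' : a ∉ A := fun hh => haS ((Finset.mem_powersetCard.mp hA).1 hh)
          have hB' : a ∉ B := fun hh => haS ((Finset.mem_powersetCard.mp hB).1 hh)
          rw [← Finset.erase_insert hA', hAB, Finset.erase_insert hB']
        · refine Finset.disjoint_left.mpr fun A hA hA' => ?_
          obtain ⟨B, -, rfl⟩ := Finset.mem_image.mp hA'
          exact haS ((Finset.mem_powersetCard.mp hA).1 (Finset.mem_insert_self a B))
    have hpos : ((n : ℝ) + 1) ≠ 0 := by positivity
    apply mul_left_cancel₀ hpos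
    have := PowerSeries.ballot_recurrence R n h
    rw [← hsum] at this
    push_cast
    linear_combination -this

end Combinatorics

theorem mem_NC_iff {n : ℕ} {P : Finset (Finset (Fin n))} :
    P ∈ NC n ↔ IsOpenNonCrossing Finset.univ ∅ P := by
  simp only [NC, Finset.mem_filter, Finset.mem_univ, true_and]
  constructor
  · rintro ⟨⟨h1, h2⟩, h3⟩
    refine ⟨h1, by simp, fun i _ _ => (h2 i).exists, ?_, h3, by simp⟩
    exact fun V hV W hW i hi hi' => (h2 i).unique ⟨hV, hi⟩ ⟨hW, hi'⟩
  · intro h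
    refine ⟨⟨h.empty_notMem, fun i => ?_⟩, h.nonCrossing⟩
    obtain ⟨V, hV, hi⟩ := h.exists_mem i (Finset.mem_univ i) (by simp)
    exact ⟨V, ⟨hV, hi⟩, fun W hW => h.eq_of_mem W hW.1 V hV i hW.2 hi⟩

theorem sum_NC_eq_coeff (c : ℕ → ℝ) (n : ℕ) :
    ((n : ℝ) + 1) * ∑ P ∈ NC n, ∏ V ∈ P, c V.card =
      PowerSeries.coeff n
        ((1 + PowerSeries.X * PowerSeries.mk fun k => c (k + 1)) ^ (n + 1)) := by
  have h := sum_openWeight c (Finset.univ : Finset (Fin n)) 0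
  have hNC : NC n = Finset.univ.filter (IsOpenNonCrossing Finset.univ ∅) := by
    ext P
    simp [mem_NC_iff]
  rw [hNC]
  simpa [openWeight] using h

/-- Free moment-cumulant relations: the moment sequence `μ_n` given by the explicit
derivative formula has free cumulants `c_n = Ψ^{(n)}(0)/(n-1)!`. -/
theorem stmt4 (Ψ : ℝ → ℝ) (s : Set ℝ) (hs : s ∈ nhds (0 : ℝ)) (hΨ : ContDiffOn ℝ (⊤ : ℕ∞) Ψ s)
    (c : ℕ → ℝ) (hc : ∀ n, 1 ≤ n → c n = iteratedDeriv n Ψ 0 / (Nat.factorial (n - 1) : ℝ))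
    (μ : ℕ → ℝ)
    (hμ : ∀ n, 1 ≤ n → μ n = ∑ m ∈ Finset.range n,
        ((Nat.factorial n : ℝ) /
            ((Nat.factorial m : ℝ) * (Nat.factorial (m + 1) : ℝ) * (Nat.factorial (n - m) : ℝ))) *
          iteratedDeriv m (fun x => (deriv Ψ x) ^ (n - m)) 0)
    (n : ℕ) (hn : 1 ≤ n) :
    μ n = ∑ P ∈ NC n, ∏ V ∈ P, c V.card := by
  have hsmooth : ∀ k : ℕ, ContDiffAt ℝ k (deriv Ψ) 0 := fun k =>
    (hΨ.contDiffAt hs).derivWithin (by exact_mod_cast le_top)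
  have hR : ∀ m, iteratedDeriv m (deriv Ψ) 0 =
      m.factorial * PowerSeries.coeff m (PowerSeries.mk fun k => c (k + 1)) := by
    intro m
    rw [PowerSeries.coeff_mk, hc (m + 1) (by omega), ← iteratedDeriv_succ', Nat.add_sub_cancel]
    field_simp
  have hpos : ((n : ℝ) + 1) ≠ 0 := by positivity
  apply mul_left_cancel₀ hpos
  rw [sum_NC_eq_coeff, coeff_one_add_X_mul_pow _ hn, hμ n hn, Finset.mul_sum]
  refine Finset.sum_congr rfl fun m hm => ?_
  have hm' := Finset.mem_range.mp hm
  rw [iteratedDeriv_pow_eq_coeff hsmooth _ hR,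
    Nat.cast_choose ℝ (show n - m ≤ n + 1 by omega), show n + 1 - (n - m) = m + 1 by omega,
    Nat.factorial_succ n]
  push_cast
  field_simp
end

section
/- The number of non-crossing partitions of {1,...,n} having exactly r_1 blocks of size ν_1+1, r_2 blocks of size ν_2+1, ..., r_a blocks of size ν_a+1 (where ν_1,...,ν_a are distinct and r_1ν_1 + ... + r_aν_a = m, r_1 + ... + r_a = n - m) equals n!/((m+1)! · r_1! · ... · r_a!). -/
open scoped Classical

/-- `P` is a non-crossing family of disjoint nonempty subsets of `S` such that no element of `S`
left uncovered by `P` lies strictly between two elements of a block. -/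
def IsOpenNonCrossing_s5 {α : Type*} [LinearOrder α] (S : Finset α) (P : Finset (Finset α)) : Prop :=
  (∀ V ∈ P, V.Nonempty ∧ V ⊆ S) ∧
  (∀ V ∈ P, ∀ W ∈ P, ∀ x ∈ V, x ∈ W → V = W) ∧
  (∀ V ∈ P, ∀ W ∈ P, V ≠ W →
    ∀ v₁ ∈ V, ∀ w₁ ∈ W, ∀ v₂ ∈ V, ∀ w₂ ∈ W, ¬(v₁ < w₁ ∧ w₁ < v₂ ∧ v₂ < w₂)) ∧
  (∀ u ∈ S, (∀ V ∈ P, u ∉ V) → ∀ V ∈ P, ∀ v₁ ∈ V, ∀ v₂ ∈ V, ¬(v₁ < u ∧ u < v₂))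

/-- The families satisfying `IsOpenNonCrossing S` whose multiset of block sizes is `μ`. -/
noncomputable def openNC {α : Type*} [LinearOrder α] [Fintype α] (S : Finset α) (μ : Multiset ℕ) :
    Finset (Finset (Finset α)) :=
  Finset.univ.filter fun P => IsOpenNonCrossing_s5 S P ∧ P.val.map Finset.card = μ

section OpenNC

variable {α : Type*} [LinearOrder α]

theorem IsOpenNonCrossing_s5.card_biUnion {S : Finset α} {P : Finset (Finset α)}
    (h : IsOpenNonCrossing_s5 S P) : (P.biUnion id).card = (P.val.map Finset.card).sum := by
  rw [Finset.card_biUnion]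
  · rfl
  · intro V hV W hW hne
    exact Finset.disjoint_left.2 fun x hx hx' => hne (h.2.1 V hV W hW x hx hx')

theorem IsOpenNonCrossing_s5.biUnion_subset {S : Finset α} {P : Finset (Finset α)}
    (h : IsOpenNonCrossing_s5 S P) : P.biUnion id ⊆ S :=
  Finset.biUnion_subset.2 fun V hV => (h.1 V hV).2

theorem IsOpenNonCrossing_s5.insert_min_iff {S : Finset α} {s : α} (hs : ∀ x ∈ S, s < x)
    {P : Finset (Finset α)} :
    (IsOpenNonCrossing_s5 (insert s S) P ∧ ∀ V ∈ P, s ∉ V) ↔ IsOpenNonCrossing_s5 S P := by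
  constructor
  · rintro ⟨⟨h1, h2, h3, h4⟩, h5⟩
    refine ⟨fun V hV => ⟨(h1 V hV).1, fun x hx => ?_⟩, h2, h3, fun u hu =>
      h4 u (Finset.mem_insert_of_mem hu)⟩
    rcases Finset.mem_insert.1 ((h1 V hV).2 hx) with rfl | h
    · exact absurd hx (h5 V hV)
    · exact h
  · rintro ⟨h1, h2, h3, h4⟩
    refine ⟨⟨fun V hV => ⟨(h1 V hV).1, (h1 V hV).2.trans (Finset.subset_insert _ _)⟩, h2, h3, ?_⟩,
      fun V hV hsV => lt_irrefl s (hs s ((h1 V hV).2 hsV))⟩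
    intro u hu hun V hV v₁ hv₁ v₂ hv₂ hlt
    rcases Finset.mem_insert.1 hu with rfl | h
    · exact lt_asymm hlt.1 (hs v₁ ((h1 V hV).2 hv₁))
    · exact h4 u h hun V hV v₁ hv₁ v₂ hv₂ hlt

theorem IsOpenNonCrossing_s5.erase_min_block {S : Finset α} {s : α} (hs : ∀ x ∈ S, s < x)
    {P : Finset (Finset α)} (h : IsOpenNonCrossing_s5 (insert s S) P) {W : Finset α}
    (hW : W ∈ P) (hsW : s ∈ W) : IsOpenNonCrossing_s5 S (P.erase W) := by
  obtain ⟨h1, h2, h3, h4⟩ := h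
  refine ⟨fun V hV => ?_, fun V hV V' hV' =>
    h2 V (Finset.mem_of_mem_erase hV) V' (Finset.mem_of_mem_erase hV'),
    fun V hV V' hV' => h3 V (Finset.mem_of_mem_erase hV) V' (Finset.mem_of_mem_erase hV'), ?_⟩
  · obtain ⟨hVW, hV⟩ := Finset.mem_erase.1 hV
    refine ⟨(h1 V hV).1, fun x hx => ?_⟩
    rcases Finset.mem_insert.1 ((h1 V hV).2 hx) with rfl | hx'
    · exact absurd (h2 V hV W hW x hx hsW) hVW
    · exact hx'
  · intro u hu hun V hV v₁ hv₁ v₂ hv₂ hlt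
    obtain ⟨hVW, hV⟩ := Finset.mem_erase.1 hV
    by_cases huW : u ∈ W
    · have hsv : s < v₁ := by
        rcases Finset.mem_insert.1 ((h1 V hV).2 hv₁) with rfl | hx'
        · exact absurd (h2 V hV W hW v₁ hv₁ hsW) hVW
        · exact hs _ hx'
      exact h3 W hW V hV (Ne.symm hVW) s hsW v₁ hv₁ u huW v₂ hv₂ ⟨hsv, hlt⟩
    · refine h4 u (Finset.mem_insert_of_mem hu) (fun V' hV' => ?_) V hV v₁ hv₁ v₂ hv₂ hlt
      by_cases hV'W : V' = W
      · rwa [hV'W]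
      · exact hun V' (Finset.mem_erase.2 ⟨hV'W, hV'⟩)

theorem IsOpenNonCrossing_s5.insert_min_block {S : Finset α} {s : α} (hs : ∀ x ∈ S, s < x)
    {P : Finset (Finset α)} (h : IsOpenNonCrossing_s5 S P) {A : Finset α}
    (hA : A ⊆ S \ P.biUnion id)
    (hA' : ∀ x ∈ A, ∀ y ∈ S \ P.biUnion id, y ∉ A → x < y) :
    IsOpenNonCrossing_s5 (insert s S) (insert (insert s A) P) := by
  obtain ⟨h1, h2, h3, h4⟩ := h
  have hAS : ∀ x ∈ A, x ∈ S ∧ ∀ V ∈ P, x ∉ V := fun x hx => by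
    have := hA hx
    simp only [Finset.mem_sdiff, Finset.mem_biUnion, id, not_exists, not_and] at this
    exact this
  have hdis : ∀ V ∈ P, ∀ x ∈ insert s A, x ∉ V := by
    intro V hV x hx hxV
    rcases Finset.mem_insert.1 hx with rfl | hx
    · exact lt_irrefl x (hs x ((h1 V hV).2 hxV))
    · exact (hAS x hx).2 V hV hxV
  have hnest : ∀ V ∈ P, ∀ v₁ ∈ V, ∀ v₂ ∈ V, ∀ x ∈ insert s A, ¬(v₁ < x ∧ x < v₂) := by
    intro V hV v₁ hv₁ v₂ hv₂ x hx hlt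
    rcases Finset.mem_insert.1 hx with rfl | hx
    · exact lt_asymm hlt.1 (hs v₁ ((h1 V hV).2 hv₁))
    · exact h4 x (hAS x hx).1 (hAS x hx).2 V hV v₁ hv₁ v₂ hv₂ hlt
  refine ⟨?_, ?_, ?_, ?_⟩
  · intro V hV
    rcases Finset.mem_insert.1 hV with rfl | hV
    · exact ⟨Finset.insert_nonempty _ _, Finset.insert_subset_insert _ fun x hx => (hAS x hx).1⟩
    · exact ⟨(h1 V hV).1, (h1 V hV).2.trans (Finset.subset_insert _ _)⟩
  · intro V hV W hW x hxV hxW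
    rcases Finset.mem_insert.1 hV with rfl | hV <;> rcases Finset.mem_insert.1 hW with rfl | hW
    · rfl
    · exact absurd hxW (hdis W hW x hxV)
    · exact absurd hxV (hdis V hV x hxW)
    · exact h2 V hV W hW x hxV hxW
  · intro V hV W hW hne v₁ hv₁ w₁ hw₁ v₂ hv₂ w₂ hw₂ hlt
    rcases Finset.mem_insert.1 hV with rfl | hV <;> rcases Finset.mem_insert.1 hW with rfl | hW
    · exact hne rfl
    · exact hnest W hW w₁ hw₁ w₂ hw₂ v₂ hv₂ hlt.2
    · exact hnest V hV v₁ hv₁ v₂ hv₂ w₁ hw₁ ⟨hlt.1, hlt.2.1⟩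
    · exact h3 V hV W hW hne v₁ hv₁ w₁ hw₁ v₂ hv₂ w₂ hw₂ hlt
  · intro u hu hun V hV v₁ hv₁ v₂ hv₂ hlt
    have huA := hun _ (Finset.mem_insert_self _ _)
    have huP : ∀ V ∈ P, u ∉ V := fun V hV => hun V (Finset.mem_insert_of_mem hV)
    have huS : u ∈ S := by
      rcases Finset.mem_insert.1 hu with rfl | hu
      · exact absurd (Finset.mem_insert_self _ _) huA
      · exact hu
    rcases Finset.mem_insert.1 hV with rfl | hV
    · rcases Finset.mem_insert.1 hv₂ with rfl | hv₂
      · exact lt_asymm hlt.2 (hs u huS)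
      · refine lt_asymm hlt.2 (hA' v₂ hv₂ u ?_ fun hu => huA (Finset.mem_insert_of_mem hu))
        simpa [huS] using huP
    · exact h4 u huS huP V hV v₁ hv₁ v₂ hv₂ hlt

theorem exists_initial_subset_card (U : Finset α) (k : ℕ) (hk : k ≤ U.card) :
    ∃ A ⊆ U, A.card = k ∧ ∀ x ∈ A, ∀ y ∈ U, y ∉ A → x < y := by
  induction k with
  | zero => exact ⟨∅, by simp⟩
  | succ k ih =>
    obtain ⟨A, hAU, hAc, hA⟩ := ih (by omega)
    have hne : (U \ A).Nonempty := by
      rw [← Finset.card_pos, Finset.card_sdiff_of_subset hAU]; omega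
    have hm := Finset.mem_sdiff.1 ((U \ A).min'_mem hne)
    refine ⟨insert ((U \ A).min' hne) A, Finset.insert_subset hm.1 hAU, ?_, ?_⟩
    · rw [Finset.card_insert_of_notMem hm.2, hAc]
    · intro x hx y hy hyA
      rw [Finset.mem_insert, not_or] at hyA
      rcases Finset.mem_insert.1 hx with rfl | hx
      · exact lt_of_le_of_ne (Finset.min'_le _ _ (Finset.mem_sdiff.2 ⟨hy, hyA.2⟩)) (Ne.symm hyA.1)
      · exact hA x hx y hy hyA.2

theorem initial_subset_unique {U A B : Finset α} (hAU : A ⊆ U) (hBU : B ⊆ U)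
    (hc : A.card = B.card) (hA : ∀ x ∈ A, ∀ y ∈ U, y ∉ A → x < y)
    (hB : ∀ x ∈ B, ∀ y ∈ U, y ∉ B → x < y) : A = B := by
  by_contra hne
  have h1 : ¬ A ⊆ B := fun h => hne (Finset.eq_of_subset_of_card_le h hc.ge)
  have h2 : ¬ B ⊆ A := fun h => hne (Finset.eq_of_subset_of_card_le h hc.le).symm
  obtain ⟨x, hxA, hxB⟩ := Finset.not_subset.1 h1
  obtain ⟨y, hyB, hyA⟩ := Finset.not_subset.1 h2
  exact lt_asymm (hA x hxA y (hBU hyB) hyA) (hB y hyB x (hAU hxA) hxB)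

variable [Fintype α]

theorem mem_openNC {S : Finset α} {μ : Multiset ℕ} {P : Finset (Finset α)} :
    P ∈ openNC S μ ↔ IsOpenNonCrossing_s5 S P ∧ P.val.map Finset.card = μ := by
  simp [openNC]

theorem openNC_eq_empty {S : Finset α} {μ : Multiset ℕ} (h : S.card < μ.sum) :
    openNC S μ = ∅ := by
  refine Finset.eq_empty_of_forall_notMem fun P hP => ?_
  obtain ⟨hP', rfl⟩ := mem_openNC.1 hP
  rw [← hP'.card_biUnion] at h
  exact absurd (Finset.card_le_card hP'.biUnion_subset) (by omega)

theorem card_openNC_min_block {S : Finset α} {s : α} (hs : ∀ x ∈ S, s < x) {μ : Multiset ℕ}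
    (hμ : ∀ d ∈ μ, 0 < d) (hsum : μ.sum ≤ S.card + 1) {d : ℕ} (hd : d ∈ μ) :
    ((openNC (insert s S) μ).filter fun P => ∃ W ∈ P, s ∈ W ∧ W.card = d).card
      = (openNC S (μ.erase d)).card := by
  have hsS : s ∉ S := fun h => lt_irrefl s (hs s h)
  have hdpos := hμ d hd
  obtain ⟨A, hA⟩ : ∃ A : Finset α → Finset α, ∀ U : Finset α, d - 1 ≤ U.card →
      A U ⊆ U ∧ (A U).card = d - 1 ∧ ∀ x ∈ A U, ∀ y ∈ U, y ∉ A U → x < y := by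
    refine ⟨fun U => if h : d - 1 ≤ U.card then (exists_initial_subset_card U _ h).choose else ∅,
      fun U h => ?_⟩
    simpa only [dif_pos h] using (exists_initial_subset_card U _ h).choose_spec
  have hsum' : (μ.erase d).sum + d = μ.sum := by
    rw [add_comm, ← Multiset.sum_cons, Multiset.cons_erase hd]
  have hU : ∀ P ∈ openNC S (μ.erase d), d - 1 ≤ (S \ P.biUnion id).card := by
    intro P hP
    obtain ⟨hP, hPc⟩ := mem_openNC.1 hP
    rw [Finset.card_sdiff_of_subset hP.biUnion_subset, hP.card_biUnion, hPc]
    omega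
  have hsP : ∀ P ∈ openNC S (μ.erase d), ∀ V ∈ P, s ∉ V := fun P hP V hV h =>
    hsS (((mem_openNC.1 hP).1.1 V hV).2 h)
  symm
  refine Finset.card_bij (fun P _ => insert (insert s (A (S \ P.biUnion id))) P) ?_ ?_ ?_
  · intro P hP
    obtain ⟨hA1, hA2, hA3⟩ := hA _ (hU P hP)
    have hsA : s ∉ A (S \ P.biUnion id) := fun h => hsS (Finset.mem_sdiff.1 (hA1 h)).1
    have hcard : (insert s (A (S \ P.biUnion id))).card = d := by
      rw [Finset.card_insert_of_notMem hsA]; omega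
    have hnot : insert s (A (S \ P.biUnion id)) ∉ P := fun h =>
      hsP P hP _ h (Finset.mem_insert_self _ _)
    refine Finset.mem_filter.2 ⟨mem_openNC.2 ⟨(mem_openNC.1 hP).1.insert_min_block hs hA1 hA3, ?_⟩,
      _, Finset.mem_insert_self _ _, Finset.mem_insert_self _ _, hcard⟩
    rw [Finset.insert_val_of_notMem hnot, Multiset.map_cons, hcard, (mem_openNC.1 hP).2,
      Multiset.cons_erase hd]
  · intro P hP Q hQ h
    have key : ∀ P ∈ openNC S (μ.erase d), ∀ W : Finset α, s ∈ W →
        (insert W P).filter (fun V => s ∉ V) = P := by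
      intro P hP W hW
      rw [Finset.filter_insert, if_neg (not_not.2 hW), Finset.filter_true_of_mem (hsP P hP)]
    rw [← key P hP _ (Finset.mem_insert_self s (A (S \ P.biUnion id))),
      ← key Q hQ _ (Finset.mem_insert_self s (A (S \ Q.biUnion id)))]
    exact congrArg _ h
  · intro P hP
    obtain ⟨hP, W, hW, hsW, hWd⟩ := Finset.mem_filter.1 hP
    obtain ⟨hP, hPc⟩ := mem_openNC.1 hP
    have hmem : P.erase W ∈ openNC S (μ.erase d) := by
      refine mem_openNC.2 ⟨hP.erase_min_block hs hW hsW, ?_⟩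
      rw [Finset.erase_val, Multiset.map_erase_of_mem _ _ hW, hWd, hPc]
    refine ⟨P.erase W, hmem, ?_⟩
    obtain ⟨hA1, hA2, hA3⟩ := hA _ (hU _ hmem)
    have hWU : W.erase s ⊆ S \ (P.erase W).biUnion id := by
      intro x hx
      obtain ⟨hxs, hxW⟩ := Finset.mem_erase.1 hx
      simp only [Finset.mem_sdiff, Finset.mem_biUnion, id, not_exists, not_and]
      exact ⟨(Finset.mem_insert.1 ((hP.1 W hW).2 hxW)).resolve_left hxs, fun V hV hxV =>
        (Finset.mem_erase.1 hV).1 (hP.2.1 V (Finset.mem_of_mem_erase hV) W hW x hxV hxW)⟩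
    have heq : A (S \ (P.erase W).biUnion id) = W.erase s := by
      refine initial_subset_unique hA1 hWU (by rw [hA2, Finset.card_erase_of_mem hsW, hWd]) hA3 ?_
      intro x hx y hy hyW
      simp only [Finset.mem_sdiff, Finset.mem_biUnion, id, not_exists, not_and] at hy
      obtain ⟨hxs, hxW⟩ := Finset.mem_erase.1 hx
      have hys := hs y hy.1
      have hyW : y ∉ W := fun h => hyW (Finset.mem_erase.2 ⟨hys.ne', h⟩)
      have hyP : ∀ V ∈ P, y ∉ V := fun V hV hyV =>
        hy.2 V (Finset.mem_erase.2 ⟨fun h => hyW (h ▸ hyV), hV⟩) hyV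
      refine lt_of_le_of_ne (not_lt.1 fun hlt => ?_) fun h => hyW (h ▸ hxW)
      exact hP.2.2.2 y (Finset.mem_insert_of_mem hy.1) hyP W hW s hsW x hxW ⟨hys, hlt⟩
    rw [heq, Finset.insert_erase hsW, Finset.insert_erase hW]

theorem card_openNC_insert_min {S : Finset α} {s : α} (hs : ∀ x ∈ S, s < x) {μ : Multiset ℕ}
    (hμ : ∀ d ∈ μ, 0 < d) (hsum : μ.sum ≤ S.card + 1) :
    (openNC (insert s S) μ).card
      = (openNC S μ).card + ∑ d ∈ μ.toFinset, (openNC S (μ.erase d)).card := by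
  have h0 : (openNC (insert s S) μ).filter (fun P => ¬ ∃ W ∈ P, s ∈ W) = openNC S μ := by
    ext P
    simp only [Finset.mem_filter, mem_openNC, ← IsOpenNonCrossing_s5.insert_min_iff hs, not_exists,
      not_and]
    tauto
  have h1 : (openNC (insert s S) μ).filter (fun P => ∃ W ∈ P, s ∈ W) =
      μ.toFinset.biUnion fun d =>
        (openNC (insert s S) μ).filter fun P => ∃ W ∈ P, s ∈ W ∧ W.card = d := by
    ext P
    simp only [Finset.mem_filter, Finset.mem_biUnion, Multiset.mem_toFinset]
    constructor
    · rintro ⟨hP, W, hW, hsW⟩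
      refine ⟨W.card, ?_, hP, W, hW, hsW, rfl⟩
      rw [← (mem_openNC.1 hP).2]
      exact Multiset.mem_map_of_mem _ hW
    · rintro ⟨d, -, hP, W, hW, hsW, -⟩
      exact ⟨hP, W, hW, hsW⟩
  rw [← Finset.card_filter_add_card_filter_not (fun P => ∃ W ∈ P, s ∈ W), h0, h1,
    Finset.card_biUnion, add_comm]
  · congr 1
    exact Finset.sum_congr rfl fun d hd =>
      card_openNC_min_block hs hμ hsum (Multiset.mem_toFinset.1 hd)
  · intro d _ e _ hde
    refine Finset.disjoint_left.2 fun P hP hP' => hde ?_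
    simp only [Finset.mem_filter, mem_openNC] at hP hP'
    obtain ⟨⟨hP, -⟩, W, hW, hsW, hWd⟩ := hP
    obtain ⟨-, V, hV, hsV, hVe⟩ := hP'
    rw [← hWd, ← hVe, hP.2.1 W hW V hV s hsW hsV]

theorem prod_factorial_count_erase {μ : Multiset ℕ} {d : ℕ} (hd : d ∈ μ) :
    ∏ e ∈ μ.toFinset, (μ.count e).factorial =
      μ.count d * ∏ e ∈ (μ.erase d).toFinset, ((μ.erase d).count e).factorial := by
  have hsub : (μ.erase d).toFinset ⊆ μ.toFinset :=
    Multiset.toFinset_subset.2 (Multiset.erase_subset d μ)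
  have hext : ∏ e ∈ (μ.erase d).toFinset, ((μ.erase d).count e).factorial =
      ∏ e ∈ μ.toFinset, ((μ.erase d).count e).factorial := by
    refine Finset.prod_subset hsub fun e _ he => ?_
    rw [Multiset.count_eq_zero.2 fun h => he (Multiset.mem_toFinset.2 h), Nat.factorial_zero]
  have hd' := Multiset.mem_toFinset.2 hd
  rw [hext, ← Finset.mul_prod_erase _ _ hd', ← Finset.mul_prod_erase _ _ hd', ← mul_assoc,
    Multiset.count_erase_self, Nat.mul_factorial_pred (Multiset.count_pos.2 hd).ne']
  congr 1
  exact Finset.prod_congr rfl fun e he => by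
    rw [Multiset.count_erase_of_ne (Finset.ne_of_mem_erase he)]

theorem card_openNC (S : Finset α) : ∀ μ : Multiset ℕ, (∀ d ∈ μ, 0 < d) → μ.sum ≤ S.card →
    (((openNC S μ).card : ℚ)) = ((S.card : ℚ) - μ.sum + 1) * S.card.factorial /
      ((S.card + 1 - μ.card).factorial * ∏ d ∈ μ.toFinset, ((μ.count d).factorial : ℚ)) := by
  induction S using Finset.induction_on_min with
  | empty =>
    intro μ hμ hsum
    have : μ = 0 := Multiset.eq_zero_of_forall_notMem fun d hd => by
      have := Multiset.le_sum_of_mem hd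
      have := hμ d hd
      simp at hsum
      omega
    subst this
    have : openNC (∅ : Finset α) 0 = {∅} := by
      ext P
      rw [mem_openNC, Multiset.map_eq_zero, Finset.val_eq_zero, Finset.mem_singleton]
      refine ⟨fun h => h.2, ?_⟩
      rintro rfl
      simp [IsOpenNonCrossing_s5]
    simp [this]
  | insert s S hs ih =>
    intro μ hμ hsum
    have hsS : s ∉ S := fun h => lt_irrefl s (hs s h)
    rw [Finset.card_insert_of_notMem hsS] at hsum ⊢
    have hcard : μ.card ≤ μ.sum := by
      simpa using Multiset.card_nsmul_le_sum (s := μ) (a := 1) fun d hd => hμ d hd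
    set p : ℚ := ∏ d ∈ μ.toFinset, ((μ.count d).factorial : ℚ) with hp
    have hp0 : p ≠ 0 := Finset.prod_ne_zero_iff.2 fun d _ => by positivity
    obtain ⟨q, hq⟩ : ∃ q, S.card + 1 = μ.card + q := ⟨_, (Nat.add_sub_of_le (by omega)).symm⟩
    have hq' : (S.card : ℚ) + 1 = μ.card + q := by exact_mod_cast hq
    have hfac : ((q + 1).factorial : ℚ) = (q + 1) * q.factorial := by
      rw [Nat.factorial_succ]; push_cast; ring
    have hq0 : (q.factorial : ℚ) ≠ 0 := by positivity
    have hq1 : (q : ℚ) + 1 ≠ 0 := by positivity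
    have h0 : ((openNC S μ).card : ℚ) =
        (S.card - μ.sum + 1) * S.card.factorial / (q.factorial * p) := by
      rcases Nat.lt_or_ge S.card μ.sum with h | h
      · have : μ.sum = S.card + 1 := by omega
        simp [openNC_eq_empty h, this]
      · rw [ih μ hμ h, show S.card + 1 - μ.card = q by omega]
    have h1 : ∀ d ∈ μ.toFinset, ((openNC S (μ.erase d)).card : ℚ) =
        (S.card - μ.sum + d + 1) * μ.count d * (S.card.factorial / ((q + 1).factorial * p)) := by
      intro d hd
      have hd := Multiset.mem_toFinset.1 hd
      have hsum' : (μ.erase d).sum + d = μ.sum := by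
        rw [add_comm, ← Multiset.sum_cons, Multiset.cons_erase hd]
      have hsum'' : ((μ.erase d).sum : ℚ) + d = μ.sum := by exact_mod_cast hsum'
      have hdpos := hμ d hd
      have hcpos := Multiset.card_pos_iff_exists_mem.2 ⟨d, hd⟩
      have hpd : p = μ.count d *
          ∏ e ∈ (μ.erase d).toFinset, (((μ.erase d).count e).factorial : ℚ) := by
        rw [hp]; exact_mod_cast prod_factorial_count_erase hd
      have hc0 : (μ.count d : ℚ) ≠ 0 := by
        exact_mod_cast (Multiset.count_pos.2 hd).ne'
      rw [ih _ (fun e he => hμ e (Multiset.mem_of_mem_erase he)) (by omega),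
        Multiset.card_erase_of_mem hd, show S.card + 1 - (μ.card).pred = q + 1 by
          rw [Nat.pred_eq_sub_one]; omega, ← hsum'']
      rw [hpd] at hp0 ⊢
      have := right_ne_zero_of_mul hp0
      have : ((q + 1).factorial : ℚ) ≠ 0 := by positivity
      field_simp
      ring
    have hsc : ∑ d ∈ μ.toFinset, (μ.count d : ℚ) = μ.card := by
      exact_mod_cast Multiset.toFinset_sum_count_eq μ
    have hsd : ∑ d ∈ μ.toFinset, (d : ℚ) * μ.count d = μ.sum := by
      have := Finset.sum_multiset_count μ
      simp only [smul_eq_mul, mul_comm] at this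
      exact_mod_cast this.symm
    have hS : ∑ d ∈ μ.toFinset, ((S.card : ℚ) - μ.sum + d + 1) * μ.count d =
        (S.card - μ.sum + 1) * μ.card + μ.sum := by
      rw [← hsc, ← hsd, Finset.mul_sum, ← Finset.sum_add_distrib]
      exact Finset.sum_congr rfl fun d _ => by rw [hsd]; ring
    rw [card_openNC_insert_min hs hμ hsum, show S.card + 1 + 1 - μ.card = q + 1 by omega,
      Nat.factorial_succ S.card]
    simp only [Nat.cast_add, Nat.cast_mul, Nat.cast_one, Nat.cast_sum]
    rw [h0, Finset.sum_congr rfl h1, ← Finset.sum_mul, hS, hfac]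
    have hμq : (μ.card : ℚ) = S.card + 1 - q := by linarith
    rw [hμq]
    field_simp
    ring

end OpenNC

theorem mem_NC_iff_isOpenNonCrossing {n : ℕ} {P : Finset (Finset (Fin n))} :
    P ∈ NC n ↔ IsOpenNonCrossing_s5 Finset.univ P ∧ (P.val.map Finset.card).sum = n := by
  simp only [NC, Finset.mem_filter, Finset.mem_univ, true_and]
  constructor
  · rintro ⟨⟨hemp, hex⟩, hnc⟩
    have hP : IsOpenNonCrossing_s5 Finset.univ P := by
      refine ⟨fun V hV => ⟨?_, Finset.subset_univ V⟩,
        fun V hV W hW x hxV hxW => (hex x).unique ⟨hV, hxV⟩ ⟨hW, hxW⟩, hnc, fun u _ hu => ?_⟩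
      · rw [Finset.nonempty_iff_ne_empty]
        rintro rfl
        exact hemp hV
      · obtain ⟨V, ⟨hV, huV⟩, -⟩ := hex u
        exact absurd huV (hu V hV)
    refine ⟨hP, ?_⟩
    have huniv : P.biUnion id = Finset.univ := Finset.eq_univ_iff_forall.2 fun i => by
      obtain ⟨V, ⟨hV, hiV⟩, -⟩ := hex i
      exact Finset.mem_biUnion.2 ⟨V, hV, hiV⟩
    rw [← hP.card_biUnion, huniv, Finset.card_univ, Fintype.card_fin]
  · rintro ⟨hP, hsum⟩
    rw [← hP.card_biUnion] at hsum
    have huniv : P.biUnion id = Finset.univ :=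
      (Finset.card_eq_iff_eq_univ _).1 (by rw [hsum, Fintype.card_fin])
    refine ⟨⟨fun h => Finset.not_nonempty_empty (hP.1 _ h).1, fun i => ?_⟩, hP.2.2.1⟩
    obtain ⟨V, hV, hiV⟩ := Finset.mem_biUnion.1 (huniv ▸ Finset.mem_univ i)
    exact ⟨V, ⟨hV, hiV⟩, fun W hW => hP.2.1 W hW.1 V hV i hW.2 hiV⟩

theorem Multiset.eq_of_le_of_sum_eq {s t : Multiset ℕ} (hle : s ≤ t) (ht : ∀ d ∈ t, 0 < d)
    (hsum : s.sum = t.sum) : s = t := by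
  obtain ⟨u, rfl⟩ := Multiset.le_iff_exists_add.1 hle
  have hu : u.sum = 0 := by
    rw [Multiset.sum_add] at hsum
    omega
  have : u = 0 := Multiset.eq_zero_of_forall_notMem fun d hd =>
    (ht d (Multiset.mem_add.2 (Or.inr hd))).ne' (Multiset.sum_eq_zero_iff.1 hu d hd)
  rw [this, add_zero]

/-- Kreweras-type enumeration: the number of non-crossing partitions of `{1,...,n}` with
exactly `r i` blocks of size `ν i + 1` (the `ν i` distinct, `∑ r i * ν i = m`,
`∑ r i = n - m`) equals `n! / ((m+1)! ∏ r i !)`. -/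
theorem stmt5 (n m a : ℕ) (ν r : Fin a → ℕ) (hν : Function.Injective ν)
    (h1 : ∑ i, r i * ν i = m) (h2 : (∑ i, r i) + m = n) :
    ((((NC n).filter
        (fun P => ∀ i, (P.filter (fun V => V.card = ν i + 1)).card = r i)).card : ℚ))
      = (Nat.factorial n : ℚ) /
          ((Nat.factorial (m + 1) : ℚ) * ∏ i, (Nat.factorial (r i) : ℚ)) := by
  set μ : Multiset ℕ := ∑ i, Multiset.replicate (r i) (ν i + 1) with hμ
  have hcount : ∀ i, μ.count (ν i + 1) = r i := fun i => by
    simp [hμ, Multiset.count_sum', Multiset.count_replicate, hν.eq_iff]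
  have hmem : ∀ d ∈ μ, ∃ i, ν i + 1 = d := fun d hd => by
    obtain ⟨i, -, hi⟩ := Multiset.mem_sum.1 hd
    exact ⟨i, (Multiset.eq_of_mem_replicate hi).symm⟩
  have hpos : ∀ d ∈ μ, 0 < d := fun d hd => by
    obtain ⟨i, rfl⟩ := hmem d hd
    exact Nat.succ_pos _
  have hcard : μ.card = ∑ i, r i := by simp [hμ]
  have hsum : μ.sum = n := by
    rw [hμ, Multiset.sum_sum]
    simp [mul_add, Finset.sum_add_distrib, h1, ← h2, add_comm]
  have hblocks : ∀ (P : Finset (Finset (Fin n))) d,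
      (P.val.map Finset.card).count d = (P.filter fun V => V.card = d).card := fun P d => by
    rw [Multiset.count_map, Finset.card_def, Finset.filter_val]
    simp only [eq_comm]
  have hset : (NC n).filter (fun P => ∀ i, (P.filter (fun V => V.card = ν i + 1)).card = r i) =
      openNC Finset.univ μ := by
    ext P
    rw [Finset.mem_filter, mem_NC_iff_isOpenNonCrossing, mem_openNC]
    constructor
    · rintro ⟨⟨hP, hPn⟩, hr⟩
      refine ⟨hP, (Multiset.eq_of_le_of_sum_eq (Multiset.le_iff_count.2 fun d => ?_) ?_
        (hsum.trans hPn.symm)).symm⟩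
      · by_cases hd : d ∈ μ
        · obtain ⟨i, rfl⟩ := hmem d hd
          rw [hcount, hblocks, hr]
        · rw [Multiset.count_eq_zero.2 hd]
          exact Nat.zero_le _
      · intro d hd
        obtain ⟨V, hV, rfl⟩ := Multiset.mem_map.1 hd
        exact Finset.card_pos.2 (hP.1 V hV).1
    · rintro ⟨hP, hPμ⟩
      exact ⟨⟨hP, hPμ ▸ hsum⟩, fun i => by rw [← hblocks, hPμ, hcount]⟩
  have hprod : ∏ d ∈ μ.toFinset, ((μ.count d).factorial : ℚ) = ∏ i, ((r i).factorial : ℚ) := by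
    have hinj : Function.Injective fun i => ν i + 1 := fun i j h => hν (Nat.succ_injective h)
    rw [Finset.prod_subset (s₂ := Finset.univ.image fun i => ν i + 1),
      Finset.prod_image hinj.injOn]
    · simp only [hcount]
    · intro d hd
      obtain ⟨i, rfl⟩ := hmem d (Multiset.mem_toFinset.1 hd)
      exact Finset.mem_image_of_mem _ (Finset.mem_univ i)
    · intro d _ hd
      rw [Multiset.count_eq_zero.2 fun h => hd (Multiset.mem_toFinset.2 h), Nat.factorial_zero,
        Nat.cast_one]
  rw [hset, card_openNC Finset.univ μ hpos (by rw [hsum, Finset.card_univ, Fintype.card_fin]),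
    hprod, hsum, hcard, Finset.card_univ, Fintype.card_fin,
    show n + 1 - ∑ i, r i = m + 1 by omega, sub_self, zero_add, one_mul]
end

section
/- Let Ψ and Φ be functions smooth in a neighborhood of 0, and set c_n := Ψ^{(n)}(0)/(n-1)! and c'_n := Φ^{(n)}(0)/(n-1)! for n ≥ 1. Then for every k ≥ 1: Σ_{m=0}^{k-1} [k!/(m!(m+1)!(k-m-1)!)] · d^m/dx^m ((Ψ'(x))^{k-m-1} Φ'(x))|_{x=0} = Σ_{π ∈ NC(k)} Σ_{V ∈ π} c'_{|V|} · ∏_{W ∈ π, W ≠ V} c_{|W|}. -/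
open scoped Classical

/-- `P` is a non-crossing partition of the interval `[a, b)`. -/
structure IsNCPartition (a b : ℕ) (P : Finset (Finset ℕ)) : Prop where
  nonempty : ∀ V ∈ P, ∃ x, x ∈ V
  bounds : ∀ V ∈ P, ∀ x ∈ V, a ≤ x ∧ x < b
  cover : ∀ x, a ≤ x → x < b → ∃ V ∈ P, x ∈ V
  disjoint : ∀ V ∈ P, ∀ W ∈ P, ∀ x ∈ V, x ∈ W → V = W
  noncrossing : ∀ V ∈ P, ∀ W ∈ P, V ≠ W → ∀ v₁ ∈ V, ∀ w₁ ∈ W, ∀ v₂ ∈ V, ∀ w₂ ∈ W,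
    v₁ < w₁ → w₁ < v₂ → v₂ < w₂ → False

/-- `V` and the members of `Q` are the blocks of a non-crossing partition of `[a, b)`, and `V` is
the block of `a`. -/
structure IsRootedNC (a b : ℕ) (V : Finset ℕ) (Q : Finset (Finset ℕ)) : Prop where
  root_mem : a ∈ V
  root_bounds : ∀ x ∈ V, a ≤ x ∧ x < b
  root_disjoint : ∀ W ∈ Q, ∀ x ∈ V, x ∉ W
  root_outer : ∀ W ∈ Q, ∀ v ∈ V, ∀ w₁ ∈ W, ∀ w₂ ∈ W, w₁ < v → v < w₂ → False
  nonempty : ∀ W ∈ Q, ∃ x, x ∈ W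
  bounds : ∀ W ∈ Q, ∀ x ∈ W, a ≤ x ∧ x < b
  cover : ∀ x, a ≤ x → x < b → x ∉ V → ∃ W ∈ Q, x ∈ W
  disjoint : ∀ W ∈ Q, ∀ W' ∈ Q, ∀ x ∈ W, x ∈ W' → W = W'
  noncrossing : ∀ V ∈ Q, ∀ W ∈ Q, V ≠ W → ∀ v₁ ∈ V, ∀ w₁ ∈ W, ∀ v₂ ∈ V, ∀ w₂ ∈ W,
    v₁ < w₁ → w₁ < v₂ → v₂ < w₂ → False

theorem IsRootedNC.root_notMem {a b : ℕ} {V : Finset ℕ} {Q : Finset (Finset ℕ)}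
    (h : IsRootedNC a b V Q) : V ∉ Q :=
  fun hV => h.root_disjoint V hV a h.root_mem h.root_mem

theorem IsRootedNC.lt_of_mem {a b : ℕ} {V : Finset ℕ} {Q : Finset (Finset ℕ)}
    (h : IsRootedNC a b V Q) {W : Finset ℕ} (hW : W ∈ Q) {x : ℕ} (hx : x ∈ W) : a < x :=
  lt_of_le_of_ne (h.bounds W hW x hx).1 fun e =>
    h.root_disjoint W hW a h.root_mem (e ▸ hx)

theorem IsRootedNC.insert {a b : ℕ} {V : Finset ℕ} {Q : Finset (Finset ℕ)}
    (h : IsRootedNC a b V Q) : IsNCPartition a b (insert V Q) := by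
  constructor
  · intro W hW
    rcases Finset.mem_insert.1 hW with rfl | hW
    exacts [⟨a, h.root_mem⟩, h.nonempty W hW]
  · intro W hW
    rcases Finset.mem_insert.1 hW with rfl | hW
    exacts [h.root_bounds, h.bounds W hW]
  · intro x hax hxb
    by_cases hx : x ∈ V
    · exact ⟨V, Finset.mem_insert_self _ _, hx⟩
    · obtain ⟨W, hW, hxW⟩ := h.cover x hax hxb hx
      exact ⟨W, Finset.mem_insert_of_mem hW, hxW⟩
  · intro W hW W' hW' x hx hx'
    rcases Finset.mem_insert.1 hW with rfl | hWQ <;>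
      rcases Finset.mem_insert.1 hW' with rfl | hWQ'
    · rfl
    · exact absurd hx' (h.root_disjoint _ hWQ' x hx)
    · exact absurd hx (h.root_disjoint _ hWQ x hx')
    · exact h.disjoint W hWQ W' hWQ' x hx hx'
  · intro W hW W' hW' hne v₁ hv₁ w₁ hw₁ v₂ hv₂ w₂ hw₂ h1 h2 h3
    rcases Finset.mem_insert.1 hW with rfl | hWQ <;>
      rcases Finset.mem_insert.1 hW' with rfl | hWQ'
    · exact hne rfl
    · exact h.root_outer W' hWQ' v₂ hv₂ w₁ hw₁ w₂ hw₂ h2 h3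
    · exact h.root_outer W hWQ w₁ hw₁ v₁ hv₁ v₂ hv₂ h1 h2
    · exact h.noncrossing W hWQ W' hWQ' hne v₁ hv₁ w₁ hw₁ v₂ hv₂ w₂ hw₂ h1 h2 h3

theorem IsNCPartition.isRootedNC_erase {a b : ℕ} {V : Finset ℕ} {P : Finset (Finset ℕ)}
    (h : IsNCPartition a b P) (hV : V ∈ P) (ha : a ∈ V) : IsRootedNC a b V (P.erase V) := by
  have hmem : ∀ W ∈ P.erase V, W ∈ P := fun W hW => Finset.mem_of_mem_erase hW
  have hdisj : ∀ W ∈ P.erase V, ∀ x ∈ V, x ∉ W := fun W hW x hx hx' =>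
    Finset.ne_of_mem_erase hW (h.disjoint W (hmem W hW) V hV x hx' hx)
  refine ⟨ha, h.bounds V hV, hdisj, ?_, fun W hW => h.nonempty W (hmem W hW),
    fun W hW => h.bounds W (hmem W hW), ?_,
    fun W hW W' hW' => h.disjoint W (hmem W hW) W' (hmem W' hW'),
    fun W hW W' hW' => h.noncrossing W (hmem W hW) W' (hmem W' hW')⟩
  · intro W hW v hv w₁ hw₁ w₂ hw₂ h1 h2
    refine h.noncrossing V hV W (hmem W hW) (Finset.ne_of_mem_erase hW).symm
      a ha w₁ hw₁ v hv w₂ hw₂ ?_ h1 h2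
    refine lt_of_le_of_ne (h.bounds W (hmem W hW) w₁ hw₁).1 fun e => ?_
    exact hdisj W hW a ha (e ▸ hw₁)
  · intro x hax hxb hx
    obtain ⟨W, hW, hxW⟩ := h.cover x hax hxb
    exact ⟨W, Finset.mem_erase.2 ⟨fun e => hx (e ▸ hxW), hW⟩, hxW⟩

/-- The non-crossing partitions of the interval `[a, b)`. -/
noncomputable def ncIco (a b : ℕ) : Finset (Finset (Finset ℕ)) :=
  (Finset.Ico a b).powerset.powerset.filter (IsNCPartition a b)

theorem mem_ncIco {a b : ℕ} {P : Finset (Finset ℕ)} :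
    P ∈ ncIco a b ↔ IsNCPartition a b P := by
  simp only [ncIco, Finset.mem_filter, Finset.mem_powerset, and_iff_right_iff_imp]
  intro h V hV
  exact Finset.mem_powerset.2 fun x hx => Finset.mem_Ico.2 (h.bounds V hV x hx)

/-- The non-crossing partitions of `[a, b)`, with the block containing `a` split off. -/
noncomputable def rootedNC (a b : ℕ) : Finset (Finset ℕ × Finset (Finset ℕ)) :=
  ((Finset.Ico a b).powerset ×ˢ (Finset.Ico a b).powerset.powerset).filter
    fun p => IsRootedNC a b p.1 p.2

theorem mem_rootedNC {a b : ℕ} {p : Finset ℕ × Finset (Finset ℕ)} :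
    p ∈ rootedNC a b ↔ IsRootedNC a b p.1 p.2 := by
  simp only [rootedNC, Finset.mem_filter, Finset.mem_product, Finset.mem_powerset,
    and_iff_right_iff_imp]
  intro h
  exact ⟨fun x hx => Finset.mem_Ico.2 (h.root_bounds x hx), fun V hV =>
    Finset.mem_powerset.2 fun x hx => Finset.mem_Ico.2 (h.bounds V hV x hx)⟩

/-- The total weight of the non-crossing partitions of `[a, b)`. -/
noncomputable def ncSum {R : Type*} [CommRing R] (c : ℕ → R) (a b : ℕ) : R :=
  ∑ P ∈ ncIco a b, ∏ V ∈ P, c V.card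

/-- The total weight of the non-crossing partitions of `[a, b)`, where the block of `a` is
weighted as if it had `j` additional elements. -/
noncomputable def rootedSum {R : Type*} [CommRing R] (c : ℕ → R) (j a b : ℕ) : R :=
  ∑ p ∈ rootedNC a b, c (p.1.card + j) * ∏ V ∈ p.2, c V.card

theorem ncSum_self {R : Type*} [CommRing R] (c : ℕ → R) (a : ℕ) : ncSum c a a = 1 := by
  have : ncIco a a = {∅} := by
    ext P
    rw [mem_ncIco, Finset.mem_singleton]
    constructor
    · intro h
      refine Finset.eq_empty_of_forall_notMem fun V hV => ?_
      obtain ⟨x, hx⟩ := h.nonempty V hV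
      have := h.bounds V hV x hx
      omega
    · rintro rfl
      constructor <;> simp +contextual
  simp [ncSum, this]

theorem rootedSum_self {R : Type*} [CommRing R] (c : ℕ → R) (j a : ℕ) :
    rootedSum c j a a = 0 := by
  refine Finset.sum_eq_zero fun p hp => ?_
  rw [mem_rootedNC] at hp
  exact absurd (hp.root_bounds a hp.root_mem).2 (lt_irrefl a)

theorem ncSum_eq_rootedSum {R : Type*} [CommRing R] (c : ℕ → R) {a b : ℕ} (h : a < b) :
    ncSum c a b = rootedSum c 0 a b := by
  symm
  refine Finset.sum_bij (fun p _ => insert p.1 p.2) ?_ ?_ ?_ ?_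
  · intro p hp
    exact mem_ncIco.2 (mem_rootedNC.1 hp).insert
  · rintro ⟨V, Q⟩ hp ⟨V', Q'⟩ hp' heq
    rw [mem_rootedNC] at hp hp'
    simp only at hp hp' heq
    have hV : V = V' :=
      hp.insert.disjoint V (by simp) V' (by simp [heq]) a hp.root_mem hp'.root_mem
    subst hV
    rw [Prod.mk.injEq]
    refine ⟨rfl, ?_⟩
    rw [← Finset.erase_insert hp.root_notMem, heq, Finset.erase_insert hp'.root_notMem]
  · intro P hP
    rw [mem_ncIco] at hP
    obtain ⟨V, hV, ha⟩ := hP.cover a le_rfl h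
    exact ⟨(V, P.erase V), mem_rootedNC.2 (hP.isRootedNC_erase hV ha), Finset.insert_erase hV⟩
  · intro p hp
    rw [Finset.prod_insert (mem_rootedNC.1 hp).root_notMem, add_zero]

/-- The element following `a` in `V`, or `b` if there is none. -/
noncomputable def nextElem (a b : ℕ) (V : Finset ℕ) : ℕ := sInf {x | x ∈ V ∧ a < x ∨ x = b}

theorem nextElem_eq_iff {a b i : ℕ} {V : Finset ℕ} (hV : ∀ x ∈ V, x < b) :
    nextElem a b V = i ↔
      (i ∈ V ∧ a < i ∨ i = b) ∧ ∀ x ∈ V, a < x → i ≤ x := by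
  have hne : {x | x ∈ V ∧ a < x ∨ x = b}.Nonempty := ⟨b, Or.inr rfl⟩
  constructor
  · rintro rfl
    exact ⟨Nat.sInf_mem hne, fun x hx hax => Nat.sInf_le (Or.inl ⟨hx, hax⟩)⟩
  · rintro ⟨h1, h2⟩
    refine le_antisymm (Nat.sInf_le h1) (le_csInf hne ?_)
    rintro x (⟨hx, hax⟩ | rfl)
    · exact h2 x hx hax
    · rcases h1 with ⟨h1, -⟩ | rfl
      · exact (hV _ h1).le
      · exact le_rfl

theorem sum_nextElem_eq_right {R : Type*} [CommRing R] (c : ℕ → R) (j : ℕ) {a b : ℕ}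
    (h : a < b) :
    ∑ p ∈ rootedNC a b with nextElem a b p.1 = b, c (p.1.card + j) * ∏ V ∈ p.2, c V.card
      = c (j + 1) * ncSum c (a + 1) b := by
  rw [ncSum, Finset.mul_sum]
  symm
  refine Finset.sum_bij (fun Q _ => ({a}, Q)) ?_ ?_ ?_ ?_
  · intro Q hQ
    rw [mem_ncIco] at hQ
    rw [Finset.mem_filter, mem_rootedNC, nextElem_eq_iff (by simpa using h)]
    refine ⟨⟨by simp, by simpa using h, ?_, ?_, hQ.nonempty, ?_, ?_, hQ.disjoint,
      hQ.noncrossing⟩, by simp⟩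
    · intro W hW x hx hx'
      have := hQ.bounds W hW x hx'
      rw [Finset.mem_singleton] at hx
      omega
    · intro W hW v hv w₁ hw₁ w₂ hw₂ h1 h2
      have := hQ.bounds W hW w₁ hw₁
      rw [Finset.mem_singleton] at hv
      omega
    · intro W hW x hx
      have := hQ.bounds W hW x hx
      omega
    · intro x h1 h2 h3
      rw [Finset.mem_singleton] at h3
      exact hQ.cover x (by omega) h2
  · intro Q _ Q' _ heq
    exact (Prod.mk.inj heq).2
  · rintro ⟨V, Q⟩ hp
    rw [Finset.mem_filter, mem_rootedNC] at hp
    obtain ⟨hp, hn⟩ := hp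
    simp only at hp hn
    rw [nextElem_eq_iff fun x hx => (hp.root_bounds x hx).2] at hn
    have hV : V = {a} := by
      refine Finset.eq_singleton_iff_unique_mem.2 ⟨hp.root_mem, fun x hx => ?_⟩
      have h1 := hp.root_bounds x hx
      have h2 := hn.2 x hx
      omega
    subst hV
    refine ⟨Q, mem_ncIco.2 ⟨hp.nonempty, ?_, ?_, hp.disjoint, hp.noncrossing⟩, rfl⟩
    · exact fun W hW x hx => ⟨hp.lt_of_mem hW hx, (hp.bounds W hW x hx).2⟩
    · intro x h1 h2
      refine hp.cover x (by omega) h2 ?_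
      rw [Finset.mem_singleton]
      omega
  · intro Q _
    simp [add_comm]

theorem IsRootedNC.insert_union {a b i : ℕ} {V : Finset ℕ} {P Q : Finset (Finset ℕ)}
    (hai : a < i) (hib : i < b) (hP : IsNCPartition (a + 1) i P) (hQ : IsRootedNC i b V Q) :
    IsRootedNC a b (Insert.insert a V) (P ∪ Q) := by
  refine ⟨Finset.mem_insert_self _ _, ?_, ?_, ?_, ?_, ?_, ?_, ?_, ?_⟩
  · intro x hx
    rcases Finset.mem_insert.1 hx with rfl | hx
    · omega
    · have := hQ.root_bounds x hx
      omega
  · intro W hW x hx hxW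
    rcases Finset.mem_union.1 hW with hW | hW <;> rcases Finset.mem_insert.1 hx with rfl | hx
    · have := hP.bounds W hW x hxW
      omega
    · have := hP.bounds W hW x hxW
      have := hQ.root_bounds x hx
      omega
    · have := hQ.bounds W hW x hxW
      omega
    · exact hQ.root_disjoint W hW x hx hxW
  · intro W hW v hv w₁ hw₁ w₂ hw₂ h1 h2
    rcases Finset.mem_union.1 hW with hW | hW <;> rcases Finset.mem_insert.1 hv with rfl | hv
    · have := hP.bounds W hW w₁ hw₁
      omega
    · have := hP.bounds W hW w₂ hw₂
      have := hQ.root_bounds v hv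
      omega
    · have := hQ.bounds W hW w₁ hw₁
      omega
    · exact hQ.root_outer W hW v hv w₁ hw₁ w₂ hw₂ h1 h2
  · intro W hW
    rcases Finset.mem_union.1 hW with hW | hW
    exacts [hP.nonempty W hW, hQ.nonempty W hW]
  · intro W hW x hx
    rcases Finset.mem_union.1 hW with hW | hW
    · have := hP.bounds W hW x hx
      omega
    · have := hQ.bounds W hW x hx
      omega
  · intro x hax hxb hx
    rw [Finset.mem_insert, not_or] at hx
    rcases lt_or_ge x i with hxi | hxi
    · obtain ⟨W, hW, hxW⟩ := hP.cover x (by omega) hxi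
      exact ⟨W, Finset.mem_union_left _ hW, hxW⟩
    · obtain ⟨W, hW, hxW⟩ := hQ.cover x hxi hxb hx.2
      exact ⟨W, Finset.mem_union_right _ hW, hxW⟩
  · intro W hW W' hW' x hx hx'
    rcases Finset.mem_union.1 hW with hW | hW <;> rcases Finset.mem_union.1 hW' with hW' | hW'
    · exact hP.disjoint W hW W' hW' x hx hx'
    · have := hP.bounds W hW x hx
      have := hQ.bounds W' hW' x hx'
      omega
    · have := hP.bounds W' hW' x hx'
      have := hQ.bounds W hW x hx
      omega
    · exact hQ.disjoint W hW W' hW' x hx hx'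
  · intro W hW W' hW' hne v₁ hv₁ w₁ hw₁ v₂ hv₂ w₂ hw₂ h1 h2 h3
    rcases Finset.mem_union.1 hW with hW | hW <;> rcases Finset.mem_union.1 hW' with hW' | hW'
    · exact hP.noncrossing W hW W' hW' hne v₁ hv₁ w₁ hw₁ v₂ hv₂ w₂ hw₂ h1 h2 h3
    · have := hP.bounds W hW v₂ hv₂
      have := hQ.bounds W' hW' w₁ hw₁
      omega
    · have := hP.bounds W' hW' w₂ hw₂
      have := hQ.bounds W hW v₁ hv₁
      omega
    · exact hQ.noncrossing W hW W' hW' hne v₁ hv₁ w₁ hw₁ v₂ hv₂ w₂ hw₂ h1 h2 h3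

/-- A block other than the root lies on one side of each element `i` of the root. -/
theorem IsRootedNC.lt_or_gt {a b i : ℕ} {V : Finset ℕ} {Q : Finset (Finset ℕ)}
    (h : IsRootedNC a b V Q) (hi : i ∈ V) {W : Finset ℕ} (hW : W ∈ Q) :
    (∀ x ∈ W, x < i) ∨ ∀ x ∈ W, i < x := by
  have hne : ∀ x ∈ W, x ≠ i := fun x hx e => h.root_disjoint W hW i hi (e ▸ hx)
  by_contra! hcon
  obtain ⟨⟨x, hx, hxi⟩, y, hy, hyi⟩ := hcon
  have := hne x hx
  have := hne y hy
  exact h.root_outer W hW i hi y hy x hx (by omega) (by omega)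

theorem IsRootedNC.isNCPartition_filter {a b i : ℕ} {V : Finset ℕ} {Q : Finset (Finset ℕ)}
    (h : IsRootedNC a b V Q) (hi : i ∈ V) (hnext : ∀ x ∈ V, a < x → i ≤ x) :
    IsNCPartition (a + 1) i (Q.filter fun W => ∀ x ∈ W, x < i) := by
  have hib := (h.root_bounds i hi).2
  have hmem : ∀ W ∈ Q.filter (fun W => ∀ x ∈ W, x < i), W ∈ Q :=
    fun W hW => (Finset.mem_filter.1 hW).1
  refine ⟨fun W hW => h.nonempty W (hmem W hW), ?_, ?_,
    fun W hW W' hW' => h.disjoint W (hmem W hW) W' (hmem W' hW'),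
    fun W hW W' hW' => h.noncrossing W (hmem W hW) W' (hmem W' hW')⟩
  · exact fun W hW x hx => ⟨h.lt_of_mem (hmem W hW) hx, (Finset.mem_filter.1 hW).2 x hx⟩
  · intro x hax hxi
    obtain ⟨W, hW, hxW⟩ := h.cover x (by omega) (by omega) fun hx => by
      have := hnext x hx (by omega)
      omega
    refine ⟨W, Finset.mem_filter.2 ⟨hW, ?_⟩, hxW⟩
    rcases h.lt_or_gt hi hW with h' | h'
    · exact h'
    · have := h' x hxW
      omega

theorem IsRootedNC.isRootedNC_filter {a b i : ℕ} {V : Finset ℕ} {Q : Finset (Finset ℕ)}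
    (h : IsRootedNC a b V Q) (hai : a < i) (hi : i ∈ V) (hnext : ∀ x ∈ V, a < x → i ≤ x) :
    IsRootedNC i b (V.erase a) (Q.filter fun W => ¬ ∀ x ∈ W, x < i) := by
  have hib := (h.root_bounds i hi).2
  have hmem : ∀ W ∈ Q.filter (fun W => ¬ ∀ x ∈ W, x < i), W ∈ Q :=
    fun W hW => (Finset.mem_filter.1 hW).1
  refine ⟨Finset.mem_erase.2 ⟨by omega, hi⟩, ?_,
    fun W hW x hx => h.root_disjoint W (hmem W hW) x (Finset.mem_of_mem_erase hx),
    fun W hW x hx => h.root_outer W (hmem W hW) x (Finset.mem_of_mem_erase hx),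
    fun W hW => h.nonempty W (hmem W hW), ?_, ?_,
    fun W hW W' hW' => h.disjoint W (hmem W hW) W' (hmem W' hW'),
    fun W hW W' hW' => h.noncrossing W (hmem W hW) W' (hmem W' hW')⟩
  · intro x hx
    obtain ⟨hne, hx⟩ := Finset.mem_erase.1 hx
    have := h.root_bounds x hx
    exact ⟨hnext x hx (by omega), this.2⟩
  · intro W hW x hx
    refine ⟨?_, (h.bounds W (hmem W hW) x hx).2⟩
    rcases h.lt_or_gt hi (hmem W hW) with h' | h'
    · exact absurd h' (Finset.mem_filter.1 hW).2
    · exact (h' x hx).le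
  · intro x hix hxb hx
    obtain ⟨W, hW, hxW⟩ := h.cover x (by omega) hxb fun hx' =>
      hx (Finset.mem_erase.2 ⟨by omega, hx'⟩)
    refine ⟨W, Finset.mem_filter.2 ⟨hW, fun h' => ?_⟩, hxW⟩
    have := h' x hxW
    omega

theorem sum_nextElem_eq_of_lt {R : Type*} [CommRing R] (c : ℕ → R) (j : ℕ) {a b i : ℕ}
    (hai : a < i) (hib : i < b) :
    ∑ p ∈ rootedNC a b with nextElem a b p.1 = i, c (p.1.card + j) * ∏ V ∈ p.2, c V.card
      = ncSum c (a + 1) i * rootedSum c (j + 1) i b := by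
  have hlow : ∀ {P : Finset (Finset ℕ)}, IsNCPartition (a + 1) i P →
      ∀ W ∈ P, ∀ x ∈ W, x < i := fun hP W hW x hx => (hP.bounds W hW x hx).2
  have hhigh : ∀ {V : Finset ℕ} {Q : Finset (Finset ℕ)}, IsRootedNC i b V Q →
      ∀ W ∈ Q, ¬ ∀ x ∈ W, x < i := by
    intro V Q hQ W hW hlt
    obtain ⟨x, hx⟩ := hQ.nonempty W hW
    have := hlt x hx
    have := hQ.lt_of_mem hW hx
    omega
  rw [ncSum, rootedSum, Finset.sum_mul_sum, ← Finset.sum_product']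
  symm
  refine Finset.sum_bij' (fun q _ => (insert a q.2.1, q.1 ∪ q.2.2))
    (fun p _ => (p.2.filter (fun W => ∀ x ∈ W, x < i), p.1.erase a,
      p.2.filter (fun W => ¬ ∀ x ∈ W, x < i))) ?_ ?_ ?_ ?_ ?_
  · rintro ⟨P, V, Q⟩ hq
    rw [Finset.mem_product, mem_ncIco, mem_rootedNC] at hq
    obtain ⟨hP, hQ⟩ := hq
    simp only at hP hQ
    have h := IsRootedNC.insert_union hai hib hP hQ
    rw [Finset.mem_filter, mem_rootedNC, nextElem_eq_iff fun x hx => (h.root_bounds x hx).2]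
    refine ⟨h, Or.inl ⟨Finset.mem_insert_of_mem hQ.root_mem, hai⟩, fun x hx hax => ?_⟩
    rcases Finset.mem_insert.1 hx with rfl | hx
    · omega
    · exact (hQ.root_bounds x hx).1
  · rintro ⟨V, Q⟩ hp
    rw [Finset.mem_filter, mem_rootedNC] at hp
    obtain ⟨hp, hn⟩ := hp
    simp only at hp hn
    rw [nextElem_eq_iff fun x hx => (hp.root_bounds x hx).2] at hn
    obtain ⟨⟨hi, -⟩ | hi, hn⟩ := hn
    · rw [Finset.mem_product, mem_ncIco, mem_rootedNC]
      exact ⟨hp.isNCPartition_filter hi hn, hp.isRootedNC_filter hai hi hn⟩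
    · omega
  · rintro ⟨P, V, Q⟩ hq
    rw [Finset.mem_product, mem_ncIco, mem_rootedNC] at hq
    obtain ⟨hP, hQ⟩ := hq
    simp only at hP hQ
    have haV : a ∉ V := fun ha => by
      have := hQ.root_bounds a ha
      omega
    simp only [Finset.filter_union, Finset.erase_insert haV]
    rw [Finset.filter_true_of_mem (hlow hP), Finset.filter_false_of_mem (hhigh hQ),
      Finset.filter_true_of_mem (hhigh hQ),
      Finset.filter_false_of_mem fun W hW => not_not.2 (hlow hP W hW),
      Finset.union_empty, Finset.empty_union]
  · rintro ⟨V, Q⟩ hp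
    rw [Finset.mem_filter, mem_rootedNC] at hp
    simp only [Finset.filter_union_filter_not_eq, Finset.insert_erase hp.1.root_mem]
  · rintro ⟨P, V, Q⟩ hq
    rw [Finset.mem_product, mem_ncIco, mem_rootedNC] at hq
    obtain ⟨hP, hQ⟩ := hq
    simp only at hP hQ
    have haV : a ∉ V := fun ha => by
      have := hQ.root_bounds a ha
      omega
    have hd : Disjoint P Q :=
      Finset.disjoint_left.2 fun W hW hW' => hhigh hQ W hW' (hlow hP W hW)
    rw [Finset.card_insert_of_notMem haV, Finset.prod_union hd, add_right_comm, ← add_assoc]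
    ring

theorem rootedSum_eq {R : Type*} [CommRing R] (c : ℕ → R) (j : ℕ) {a b : ℕ} (h : a < b) :
    rootedSum c j a b = c (j + 1) * ncSum c (a + 1) b +
      ∑ i ∈ Finset.Ioo a b, ncSum c (a + 1) i * rootedSum c (j + 1) i b := by
  have hmaps : ∀ p ∈ rootedNC a b, nextElem a b p.1 ∈ Finset.Ioc a b := by
    intro p hp
    rw [mem_rootedNC] at hp
    have := ((nextElem_eq_iff fun x hx => (hp.root_bounds x hx).2).1
      (rfl : nextElem a b p.1 = _)).1
    rw [Finset.mem_Ioc]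
    rcases this with ⟨h1, h2⟩ | h1
    · exact ⟨h2, (hp.root_bounds _ h1).2.le⟩
    · omega
  rw [rootedSum, ← Finset.sum_fiberwise_of_maps_to hmaps, ← Finset.Ioo_insert_right h,
    Finset.sum_insert Finset.right_notMem_Ioo, sum_nextElem_eq_right c j h]
  congr 1
  refine Finset.sum_congr rfl fun i hi => ?_
  rw [Finset.mem_Ioo] at hi
  exact sum_nextElem_eq_of_lt c j hi.1 hi.2

theorem ncSum_rootedSum_translate {R : Type*} [CommRing R] (c : ℕ → R) (n : ℕ) :
    ∀ a, ncSum c a (a + n) = ncSum c 0 n ∧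
      ∀ j, rootedSum c j a (a + n) = rootedSum c j 0 n := by
  induction n using Nat.strong_induction_on with
  | _ n ih =>
    intro a
    suffices h : ∀ j, rootedSum c j a (a + n) = rootedSum c j 0 n by
      refine ⟨?_, h⟩
      rcases Nat.eq_zero_or_pos n with rfl | hn
      · rw [add_zero, ncSum_self, ncSum_self]
      · rw [ncSum_eq_rootedSum c (by omega), ncSum_eq_rootedSum c hn, h]
    intro j
    rcases Nat.eq_zero_or_pos n with rfl | hn
    · rw [add_zero, rootedSum_self, rootedSum_self]
    have hM : ∀ x y, x ≤ y → y < x + n → ncSum c x y = ncSum c 0 (y - x) := by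
      intro x y hxy hy
      rw [← (ih (y - x) (by omega) x).1, Nat.add_sub_cancel' hxy]
    have hA : ∀ x y, x ≤ y → y < x + n → ∀ j, rootedSum c j x y = rootedSum c j 0 (y - x) := by
      intro x y hxy hy j
      rw [← (ih (y - x) (by omega) x).2, Nat.add_sub_cancel' hxy]
    rw [rootedSum_eq c j (by omega : a < a + n), rootedSum_eq c j hn,
      hM (a + 1) (a + n) (by omega) (by omega), hM (0 + 1) n (by omega) (by omega)]
    congr 1
    · congr 2
      omega
    · refine Finset.sum_nbij' (fun i => i - a) (fun i => i + a) ?_ ?_ ?_ ?_ ?_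
      · intro i hi
        simp only [Finset.mem_Ioo] at hi ⊢
        omega
      · intro i hi
        simp only [Finset.mem_Ioo] at hi ⊢
        omega
      · intro i hi
        simp only [Finset.mem_Ioo] at hi
        omega
      · intro i _
        omega
      · intro i hi
        rw [Finset.mem_Ioo] at hi
        rw [hM (a + 1) i (by omega) (by omega), hA i (a + n) (by omega) (by omega),
          hM (0 + 1) (i - a) (by omega) (by omega), hA (i - a) n (by omega) (by omega)]
        congr 2
        omega

theorem rootedSum_succ {R : Type*} [CommRing R] (c : ℕ → R) (j n : ℕ) :
    rootedSum c j 0 (n + 1) = c (j + 1) * ncSum c 0 n +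
      ∑ q ∈ Finset.HasAntidiagonal.antidiagonal n, ncSum c 0 q.1 * rootedSum c (j + 1) 0 q.2 := by
  have hM : ∀ x y, x ≤ y → ncSum c x y = ncSum c 0 (y - x) := by
    intro x y hxy
    rw [← (ncSum_rootedSum_translate c (y - x) x).1, Nat.add_sub_cancel' hxy]
  have hA : ∀ x y, x ≤ y → rootedSum c (j + 1) x y = rootedSum c (j + 1) 0 (y - x) := by
    intro x y hxy
    rw [← (ncSum_rootedSum_translate c (y - x) x).2, Nat.add_sub_cancel' hxy]
  rw [rootedSum_eq c j n.succ_pos, hM (0 + 1) (n + 1) (by omega),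
    Finset.Nat.sum_antidiagonal_eq_sum_range_succ
      (fun p q => ncSum c 0 p * rootedSum c (j + 1) 0 q), Finset.sum_range_succ,
    Nat.sub_self, rootedSum_self, mul_zero, add_zero]
  congr 1
  refine Finset.sum_nbij' (fun i => i - 1) (fun i => i + 1) ?_ ?_ ?_ ?_ ?_
  · intro i hi
    simp only [Finset.mem_Ioo, Finset.mem_range] at hi ⊢
    omega
  · intro i hi
    simp only [Finset.mem_Ioo, Finset.mem_range] at hi ⊢
    omega
  · intro i hi
    simp only [Finset.mem_Ioo] at hi
    omega
  · intro i _
    omega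
  · intro i hi
    rw [Finset.mem_Ioo] at hi
    rw [hM (0 + 1) i (by omega), hA i (n + 1) (by omega)]
    congr 2
    omega

open PowerSeries in
/-- Coefficient form of the functional equation for the generating function `M` of `ncSum c`:
with `U = X M` and `φ = 1 + ∑ c s X ^ s` one has `U = X φ(U)`. -/
theorem coeff_succ_ncSeries_pow {R : Type*} [CommRing R] (c : ℕ → R) (n h : ℕ) :
    coeff (n + 1) ((X * mk (ncSum c 0)) ^ (h + 1)) =
      ∑ s ∈ Finset.range (n + 1),
        (if s = 0 then 1 else c s) * coeff n ((X * mk (ncSum c 0)) ^ (h + s)) := by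
  set U : R⟦X⟧ := X * mk (ncSum c 0) with hU
  set A : ℕ → R⟦X⟧ := fun j => mk (rootedSum c j 0) with hA
  have hM : mk (ncSum c 0) = 1 + A 0 := by
    ext k
    rcases k with - | k
    · simp [hA, ncSum_self, rootedSum_self]
    · simp [hA, coeff_one, ncSum_eq_rootedSum c k.succ_pos]
  have hrec : ∀ j, A j = C (c (j + 1)) * U + U * A (j + 1) := by
    intro j
    ext k
    rcases k with - | k
    · simp [hA, hU, rootedSum_self]
    · rw [hU, mul_assoc, mul_left_comm, map_add, coeff_succ_X_mul, coeff_succ_X_mul,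
        coeff_C_mul, coeff_mul]
      simp only [hA, coeff_mk]
      exact rootedSum_succ c j k
  have hsum : ∀ N, 1 + A 0 =
      ∑ s ∈ Finset.range (N + 1), C (if s = 0 then 1 else c s) * U ^ s + U ^ N * A N := by
    intro N
    induction N with
    | zero => simp
    | succ N ih =>
      rw [ih, Finset.sum_range_succ _ (N + 1), hrec N, if_neg N.succ_ne_zero]
      ring
  have hvanish : coeff n (U ^ h * (U ^ n * A n)) = 0 := by
    have h0 : A n = X * mk (fun k => rootedSum c n 0 (k + 1)) := by
      ext k
      rcases k with - | k
      · simp [hA, rootedSum_self]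
      · simp [hA, coeff_succ_X_mul]
    have hcomm : ∀ a b d : R⟦X⟧, a * (X ^ n * b * (X * d)) = X ^ (n + 1) * (a * b * d) := by
      intros
      ring
    rw [h0, hU, mul_pow X _ n, hcomm, coeff_X_pow_mul', if_neg (by omega)]
  rw [show U ^ (h + 1) = X * (U ^ h * mk (ncSum c 0)) by rw [pow_succ]; nth_rw 2 [hU]; ring,
    coeff_succ_X_mul, hM, hsum n, mul_add, map_add, hvanish, add_zero, Finset.mul_sum, map_sum]
  refine Finset.sum_congr rfl fun s _ => ?_
  rw [mul_left_comm, coeff_C_mul, pow_add]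

open PowerSeries in
/-- Lagrange inversion for the generating function of `ncSum c`. -/
theorem natCast_mul_coeff_ncSeries_pow {R : Type*} [CommRing R] [IsAddTorsionFree R]
    (c : ℕ → R) (n : ℕ) : ∀ h : ℕ,
    (n : R) * coeff n ((X * mk (ncSum c 0)) ^ h) =
      h * coeff n (X ^ h * (mk fun s => if s = 0 then 1 else c s) ^ n) := by
  set φ : R⟦X⟧ := mk fun s => if s = 0 then 1 else c s with hφ
  induction n with
  | zero =>
    intro h
    rcases h with - | h <;> simp
  | succ n ih =>
    intro h
    rcases h with - | h
    · simp [coeff_one]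
    rw [coeff_succ_ncSeries_pow]
    rcases Nat.eq_zero_or_pos n with rfl | hn
    · rcases h with - | h
      · simp [hφ, coeff_succ_X_mul]
      · rw [coeff_X_pow_mul', if_neg (by omega)]
        simp
    have key : (n : R) * ∑ s ∈ Finset.range (n + 1),
        (if s = 0 then 1 else c s) * coeff n ((X * mk (ncSum c 0)) ^ (h + s)) =
        coeff n ((C (h : R) * φ + X * derivative R φ) * (X ^ h * φ ^ n)) := by
      rw [coeff_mul, Finset.Nat.sum_antidiagonal_eq_sum_range_succ (fun p q =>
        coeff p (C (h : R) * φ + X * derivative R φ) * coeff q (X ^ h * φ ^ n)),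
        Finset.mul_sum]
      refine Finset.sum_congr rfl fun s hs => ?_
      have hD : coeff s (C (h : R) * φ + X * derivative R φ) =
          (h + s : ℕ) * (if s = 0 then 1 else c s) := by
        rw [map_add, coeff_C_mul, hφ, coeff_mk]
        rcases s with - | s
        · simp
        · rw [coeff_succ_X_mul, coeff_derivative, coeff_mk]
          push_cast
          ring
      rw [Finset.mem_range] at hs
      rw [hD, mul_left_comm, ih, pow_add, mul_comm (X ^ h) (X ^ s), mul_assoc,
        coeff_X_pow_mul', if_pos (Nat.le_of_lt_succ hs)]
      ring
    have hder : X * derivative R (X ^ h * φ ^ (n + 1)) =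
        C (h : R) * (X ^ h * φ ^ (n + 1)) +
          C ((n + 1 : ℕ) : R) * (X * derivative R φ * (X ^ h * φ ^ n)) := by
      rcases h with - | h
      · simp [Derivation.leibniz_pow]
        ring
      · simp [Derivation.leibniz, Derivation.leibniz_pow]
        ring
    have hcoeff : coeff n ((X : R⟦X⟧) * derivative R (X ^ h * φ ^ (n + 1))) =
        (n : R) * coeff n (X ^ h * φ ^ (n + 1)) := by
      obtain ⟨m, rfl⟩ : ∃ m, n = m + 1 := ⟨n - 1, by omega⟩
      rw [coeff_succ_X_mul, coeff_derivative]
      push_cast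
      ring
    rw [hder, map_add, coeff_C_mul, coeff_C_mul] at hcoeff
    refine nsmul_right_injective hn.ne' ?_
    simp only [nsmul_eq_mul]
    rw [mul_left_comm, key, show (X : R⟦X⟧) ^ (h + 1) * φ ^ (n + 1) = X * (X ^ h * φ ^ (n + 1)) by ring,
      coeff_succ_X_mul, add_mul, map_add,
      show C (h : R) * φ * (X ^ h * φ ^ n) = C (h : R) * (X ^ h * φ ^ (n + 1)) by ring,
      coeff_C_mul]
    push_cast at hcoeff ⊢
    linear_combination hcoeff

open PowerSeries in
theorem succ_mul_ncSum {R : Type*} [CommRing R] [IsAddTorsionFree R] (c : ℕ → R) (k : ℕ) :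
    ((k + 1 : ℕ) : R) * ncSum c 0 k =
      coeff k ((mk fun s => if s = 0 then 1 else c s) ^ (k + 1)) := by
  have h := natCast_mul_coeff_ncSeries_pow c (k + 1) 1
  rwa [pow_one, pow_one, coeff_succ_X_mul, coeff_succ_X_mul, coeff_mk, Nat.cast_one,
    one_mul] at h

theorem DualNumber.snd_finsetProd {R ι : Type*} [CommRing R] [DecidableEq ι] (s : Finset ι)
    (f : ι → DualNumber R) :
    (∏ i ∈ s, f i).snd = ∑ i ∈ s, (f i).snd * ∏ j ∈ s.erase i, (f j).fst := by
  have hfst : ∀ t : Finset ι, (∏ i ∈ t, f i).fst = ∏ i ∈ t, (f i).fst := fun t =>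
    map_prod (TrivSqZeroExt.fstHom R R R) f t
  induction s using Finset.induction_on with
  | empty => simp
  | insert a s ha ih =>
    rw [Finset.prod_insert ha, DualNumber.snd_mul, ih, hfst, Finset.sum_insert ha,
      Finset.erase_insert ha, add_comm, Finset.mul_sum]
    congr 1
    refine Finset.sum_congr rfl fun i hi => ?_
    have hai : a ≠ i := fun e => ha (e ▸ hi)
    rw [Finset.erase_insert_of_ne hai, Finset.prod_insert fun h => ha (Finset.mem_of_mem_erase h)]
    ring

open PowerSeries in
theorem mk_snd_coeff_pow {R : Type*} [CommRing R] (p : (DualNumber R)⟦X⟧) (n : ℕ) :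
    mk (fun k => (coeff k (p ^ (n + 1))).snd) =
      C ((n + 1 : ℕ) : R) * (mk (fun k => (coeff k p).fst) ^ n * mk fun k => (coeff k p).snd) := by
  have hsnd : ∀ q r : (DualNumber R)⟦X⟧, mk (fun k => (coeff k (q * r)).snd) =
      mk (fun k => (coeff k q).fst) * mk (fun k => (coeff k r).snd) +
        mk (fun k => (coeff k q).snd) * mk (fun k => (coeff k r).fst) := by
    intro q r
    ext k
    simp only [coeff_mk, map_add, coeff_mul, TrivSqZeroExt.snd_sum, DualNumber.snd_mul,
      Finset.sum_add_distrib]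
  have hmap : ∀ q : (DualNumber R)⟦X⟧, mk (fun k => (coeff k q).fst) =
      PowerSeries.map (TrivSqZeroExt.fstHom R R R).toRingHom q := by
    intro q
    ext k
    simp
  have hfst : ∀ m, mk (fun k => (coeff k (p ^ m)).fst) = mk (fun k => (coeff k p).fst) ^ m :=
    fun m => by rw [hmap, hmap, map_pow]
  induction n with
  | zero => simp
  | succ n ih =>
    rw [pow_succ p (n + 1), hsnd, ih, hfst]
    push_cast
    rw [map_add, map_one, map_add, map_add, map_one]
    ring

open PowerSeries in
theorem sum_ncIco_infinitesimal {R : Type*} [CommRing R] [IsAddTorsionFree R]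
    (c c' : ℕ → R) (k : ℕ) :
    ∑ P ∈ ncIco 0 (k + 1), ∑ V ∈ P, c' V.card * ∏ W ∈ P.erase V, c W.card =
      coeff k ((1 + X * mk fun s => c (s + 1)) ^ (k + 1) * mk fun s => c' (s + 1)) := by
  set d : ℕ → DualNumber R := fun n => TrivSqZeroExt.inl (c n) + TrivSqZeroExt.inr (c' n) with hd
  have h0 : (ncSum d 0 (k + 1)).snd =
      ∑ P ∈ ncIco 0 (k + 1), ∑ V ∈ P, c' V.card * ∏ W ∈ P.erase V, c W.card := by
    simp [ncSum, TrivSqZeroExt.snd_sum, DualNumber.snd_finsetProd, hd]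
  have : IsAddTorsionFree (DualNumber R) := inferInstanceAs (IsAddTorsionFree (R × R))
  have h1 := congrArg TrivSqZeroExt.snd (succ_mul_ncSum d (k + 1))
  have h2 := congrArg (coeff (k + 1)) (mk_snd_coeff_pow
    (mk fun s => if s = 0 then 1 else d s) (k + 1))
  rw [coeff_mk, ← h1, coeff_C_mul, ← nsmul_eq_mul, ← nsmul_eq_mul, TrivSqZeroExt.snd_smul] at h2
  rw [← h0, nsmul_right_injective (Nat.succ_ne_zero (k + 1)) h2]
  have hfst : (mk fun s => (coeff s (mk fun s => if s = 0 then 1 else d s)).fst) =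
      1 + X * mk fun s => c (s + 1) := by
    ext s
    rcases s with - | s <;> simp [hd, coeff_succ_X_mul, coeff_one]
  have hsnd : (mk fun s => (coeff s (mk fun s => if s = 0 then 1 else d s)).snd) =
      X * mk fun s => c' (s + 1) := by
    ext s
    rcases s with - | s <;> simp [hd, coeff_succ_X_mul]
  rw [hfst, hsnd, mul_left_comm, coeff_succ_X_mul]

open PowerSeries in
theorem coeff_one_add_X_mul_pow_mul {R : Type*} [CommRing R] (f g : R⟦X⟧) (k : ℕ) :
    coeff k ((1 + X * f) ^ (k + 1) * g) =
      ∑ m ∈ Finset.range (k + 1), ((k + 1).choose (m + 1) : R) * coeff m (f ^ (k - m) * g) := by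
  rw [add_comm, add_pow, Finset.sum_mul, map_sum, Finset.sum_range_succ,
    ← Finset.sum_range_reflect]
  have hlast : coeff k ((X * f) ^ (k + 1) * 1 ^ (k + 1 - (k + 1)) *
      ((k + 1).choose (k + 1) : R⟦X⟧) * g) = 0 := by
    rw [mul_pow, mul_assoc, mul_assoc, mul_assoc, coeff_X_pow_mul', if_neg (by omega)]
  rw [hlast, add_zero]
  refine Finset.sum_congr rfl fun m hm => ?_
  have hm : m ≤ k := Nat.le_of_lt_succ (Finset.mem_range.1 hm)
  have hchoose : (k + 1).choose (k - m) = (k + 1).choose (m + 1) :=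
    Nat.choose_symm_of_eq_add (by omega)
  rw [show k + 1 - 1 - m = k - m by omega, one_pow, mul_one, hchoose, mul_pow,
    show X ^ (k - m) * f ^ (k - m) * ((k + 1).choose (m + 1) : R⟦X⟧) * g =
      X ^ (k - m) * (C ((k + 1).choose (m + 1) : R) * (f ^ (k - m) * g)) by
        rw [map_natCast]
        ring,
    coeff_X_pow_mul', if_pos (by omega), coeff_C_mul, Nat.sub_sub_self hm]

theorem IsNonCrossing.isNCPartition_map {k : ℕ} {P : Finset (Finset (Fin k))}
    (hP : IsPartitionOf k P) (hP' : IsNonCrossing P) :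
    IsNCPartition 0 k (P.map (Finset.mapEmbedding Fin.valEmbedding).toEmbedding) := by
  constructor
  · intro V hV
    obtain ⟨V, hVP, rfl⟩ := Finset.mem_map.1 hV
    obtain ⟨x, hx⟩ := Finset.nonempty_iff_ne_empty.2 fun e => hP.1 (e ▸ hVP)
    exact ⟨x, Finset.mem_map_of_mem Fin.valEmbedding hx⟩
  · intro V hV x hx
    obtain ⟨V, hVP, rfl⟩ := Finset.mem_map.1 hV
    obtain ⟨x, hx, rfl⟩ := Finset.mem_map.1 hx
    exact ⟨Nat.zero_le _, x.isLt⟩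
  · intro x _ hx
    obtain ⟨V, ⟨hV, hxV⟩, -⟩ := hP.2 ⟨x, hx⟩
    exact ⟨_, Finset.mem_map_of_mem _ hV, Finset.mem_map_of_mem Fin.valEmbedding hxV⟩
  · intro V hV W hW x hxV hxW
    obtain ⟨V, hVP, rfl⟩ := Finset.mem_map.1 hV
    obtain ⟨W, hWP, rfl⟩ := Finset.mem_map.1 hW
    obtain ⟨x, hx, rfl⟩ := Finset.mem_map.1 hxV
    rw [(hP.2 x).unique ⟨hVP, hx⟩ ⟨hWP, (Finset.mem_map' Fin.valEmbedding).1 hxW⟩]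
  · intro V hV W hW hVW v₁ hv₁ w₁ hw₁ v₂ hv₂ w₂ hw₂ h₁ h₂ h₃
    obtain ⟨V, hVP, rfl⟩ := Finset.mem_map.1 hV
    obtain ⟨W, hWP, rfl⟩ := Finset.mem_map.1 hW
    obtain ⟨v₁, hv₁', rfl⟩ := Finset.mem_map.1 hv₁
    obtain ⟨v₂, hv₂', rfl⟩ := Finset.mem_map.1 hv₂
    obtain ⟨w₁, hw₁', rfl⟩ := Finset.mem_map.1 hw₁
    obtain ⟨w₂, hw₂', rfl⟩ := Finset.mem_map.1 hw₂
    exact hP' V hVP W hWP (fun e => hVW (e ▸ rfl)) v₁ hv₁' w₁ hw₁' v₂ hv₂' w₂ hw₂'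
      ⟨h₁, h₂, h₃⟩

theorem IsNCPartition.exists_map_eq {k : ℕ} {Q : Finset (Finset ℕ)} (hQ : IsNCPartition 0 k Q) :
    ∃ P ∈ NC k, P.map (Finset.mapEmbedding Fin.valEmbedding).toEmbedding = Q := by
  have hex : ∀ V ∈ Q, ∃ U : Finset (Fin k), U.map Fin.valEmbedding = V := by
    intro V hV
    refine ⟨Finset.univ.filter fun i => (i : ℕ) ∈ V, ?_⟩
    ext x
    simp only [Finset.mem_map, Finset.mem_filter, Finset.mem_univ, true_and, Fin.valEmbedding_apply]
    exact ⟨fun ⟨i, hi, e⟩ => e ▸ hi, fun hx => ⟨⟨x, (hQ.bounds V hV x hx).2⟩, hx, rfl⟩⟩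
  refine ⟨Finset.univ.filter fun V => V.map Fin.valEmbedding ∈ Q,
    Finset.mem_filter.2 ⟨Finset.mem_univ _, ⟨?_, ?_⟩, ?_⟩, ?_⟩
  · intro h
    obtain ⟨x, hx⟩ := hQ.nonempty _ (Finset.mem_filter.1 h).2
    simp at hx
  · intro i
    obtain ⟨V, hV, hi⟩ := hQ.cover i (Nat.zero_le _) i.isLt
    obtain ⟨U, rfl⟩ := hex V hV
    refine ⟨U, ⟨Finset.mem_filter.2 ⟨Finset.mem_univ _, hV⟩,
      (Finset.mem_map' Fin.valEmbedding).1 hi⟩, fun W hW => ?_⟩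
    exact Finset.map_injective Fin.valEmbedding (hQ.disjoint _ (Finset.mem_filter.1 hW.1).2 _ hV i
      (Finset.mem_map_of_mem Fin.valEmbedding hW.2) hi)
  · intro V hV W hW hVW v₁ hv₁ w₁ hw₁ v₂ hv₂ w₂ hw₂ h
    exact hQ.noncrossing _ (Finset.mem_filter.1 hV).2 _ (Finset.mem_filter.1 hW).2
      (fun e => hVW (Finset.map_injective Fin.valEmbedding e)) v₁
      (Finset.mem_map_of_mem Fin.valEmbedding hv₁) w₁ (Finset.mem_map_of_mem Fin.valEmbedding hw₁)
      v₂ (Finset.mem_map_of_mem Fin.valEmbedding hv₂) w₂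
      (Finset.mem_map_of_mem Fin.valEmbedding hw₂) h.1 h.2.1 h.2.2
  · ext V
    simp only [Finset.mem_map, Finset.mem_filter, Finset.mem_univ, true_and,
      RelEmbedding.coe_toEmbedding, Finset.mapEmbedding_apply]
    refine ⟨fun ⟨U, hU, e⟩ => e ▸ hU, fun hV => ?_⟩
    obtain ⟨U, rfl⟩ := hex V hV
    exact ⟨U, hV, rfl⟩

theorem sum_NC_eq_sum_ncIco {R : Type*} [CommRing R] (c c' : ℕ → R) (k : ℕ) :
    ∑ P ∈ NC k, ∑ V ∈ P, c' V.card * ∏ W ∈ P.erase V, c W.card =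
      ∑ P ∈ ncIco 0 k, ∑ V ∈ P, c' V.card * ∏ W ∈ P.erase V, c W.card := by
  refine Finset.sum_bij
    (fun P _ => P.map (Finset.mapEmbedding Fin.valEmbedding).toEmbedding) ?_ ?_ ?_ ?_
  · intro P hP
    exact mem_ncIco.2 ((Finset.mem_filter.1 hP).2.2.isNCPartition_map (Finset.mem_filter.1 hP).2.1)
  · intro P _ Q _ h
    exact Finset.map_injective _ h
  · intro Q hQ
    obtain ⟨P, hP, rfl⟩ := (mem_ncIco.1 hQ).exists_map_eq
    exact ⟨P, hP, rfl⟩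
  · intro P _
    rw [Finset.sum_map]
    refine Finset.sum_congr rfl fun V _ => ?_
    rw [← Finset.map_erase, Finset.prod_map]
    simp

open PowerSeries in
/-- The Taylor series of `F` at `0`. -/
noncomputable def taylorAtZero (F : ℝ → ℝ) : ℝ⟦X⟧ :=
  mk fun n => iteratedDeriv n F 0 / n.factorial

theorem taylorAtZero_mul {F G : ℝ → ℝ} (hF : ContDiffAt ℝ (⊤ : ℕ∞) F 0)
    (hG : ContDiffAt ℝ (⊤ : ℕ∞) G 0) :
    taylorAtZero (F * G) = taylorAtZero F * taylorAtZero G := by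
  ext n
  rw [PowerSeries.coeff_mul, Finset.Nat.sum_antidiagonal_eq_sum_range_succ
    (fun i j => PowerSeries.coeff i (taylorAtZero F) * PowerSeries.coeff j (taylorAtZero G))]
  simp only [taylorAtZero, PowerSeries.coeff_mk]
  rw [iteratedDeriv_mul (hF.of_le (mod_cast le_top)) (hG.of_le (mod_cast le_top)),
    Finset.sum_div]
  refine Finset.sum_congr rfl fun i hi => ?_
  rw [Nat.cast_choose ℝ (Nat.le_of_lt_succ (Finset.mem_range.1 hi))]
  have := n.factorial_ne_zero
  field_simp

theorem taylorAtZero_pow {F : ℝ → ℝ} (hF : ContDiffAt ℝ (⊤ : ℕ∞) F 0) (n : ℕ) :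
    taylorAtZero (F ^ n) = taylorAtZero F ^ n := by
  induction n with
  | zero =>
    ext m
    rcases m with - | m <;>
      simp [taylorAtZero, PowerSeries.coeff_one, Pi.one_def, iteratedDeriv_const]
  | succ n ih =>
    have hFn : ContDiffAt ℝ (⊤ : ℕ∞) (F ^ n) 0 := hF.pow n
    rw [pow_succ, pow_succ, taylorAtZero_mul hFn hF, ih]

theorem taylorAtZero_deriv {F : ℝ → ℝ} {c : ℕ → ℝ}
    (hc : ∀ n, 1 ≤ n → c n = iteratedDeriv n F 0 / (Nat.factorial (n - 1) : ℝ)) :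
    taylorAtZero (deriv F) = PowerSeries.mk fun s => c (s + 1) := by
  ext s
  simp [taylorAtZero, hc, iteratedDeriv_succ']

theorem ContDiffAt.deriv_top {F : ℝ → ℝ} {x : ℝ} (hF : ContDiffAt ℝ (⊤ : ℕ∞) F x) :
    ContDiffAt ℝ (⊤ : ℕ∞) (deriv F) x :=
  (hF.fderiv_right (m := (⊤ : ℕ∞)) (by simp)).clm_apply contDiffAt_const

/-- Infinitesimal moment-cumulant formula: the explicit derivative expression equals the
sum over non-crossing partitions where exactly one block carries the infinitesimal
cumulant `c'` and the others carry `c`. -/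
theorem stmt6 (Ψ Φ : ℝ → ℝ) (s : Set ℝ) (hs : s ∈ nhds (0 : ℝ))
    (hΨ : ContDiffOn ℝ (⊤ : ℕ∞) Ψ s) (hΦ : ContDiffOn ℝ (⊤ : ℕ∞) Φ s)
    (c c' : ℕ → ℝ)
    (hc : ∀ n, 1 ≤ n → c n = iteratedDeriv n Ψ 0 / (Nat.factorial (n - 1) : ℝ))
    (hc' : ∀ n, 1 ≤ n → c' n = iteratedDeriv n Φ 0 / (Nat.factorial (n - 1) : ℝ))
    (k : ℕ) (hk : 1 ≤ k) :
    ∑ m ∈ Finset.range k,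
        ((Nat.factorial k : ℝ) /
            ((Nat.factorial m : ℝ) * (Nat.factorial (m + 1) : ℝ) *
              (Nat.factorial (k - m - 1) : ℝ))) *
          iteratedDeriv m (fun x => (deriv Ψ x) ^ (k - m - 1) * deriv Φ x) 0
      = ∑ P ∈ NC k, ∑ V ∈ P, c' V.card * ∏ W ∈ P.erase V, c W.card := by
  obtain ⟨k, rfl⟩ : ∃ l, k = l + 1 := ⟨k - 1, by omega⟩
  rw [sum_NC_eq_sum_ncIco, sum_ncIco_infinitesimal, coeff_one_add_X_mul_pow_mul]
  refine Finset.sum_congr rfl fun m hm => ?_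
  have hm : m ≤ k := Nat.le_of_lt_succ (Finset.mem_range.1 hm)
  have hΨ' := (hΨ.contDiffAt hs).deriv_top
  have hΦ' := (hΦ.contDiffAt hs).deriv_top
  have hpow : ContDiffAt ℝ (⊤ : ℕ∞) (deriv Ψ ^ (k - m)) 0 := hΨ'.pow _
  rw [← taylorAtZero_deriv hc, ← taylorAtZero_deriv hc', ← taylorAtZero_pow hΨ',
    ← taylorAtZero_mul hpow hΦ', taylorAtZero, PowerSeries.coeff_mk,
    Nat.cast_choose ℝ (Nat.succ_le_succ hm), Nat.succ_sub_succ, show k + 1 - m - 1 = k - m by omega]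
  have h : (fun x => deriv Ψ x ^ (k - m) * deriv Φ x) = deriv Ψ ^ (k - m) * deriv Φ := rfl
  rw [h]
  have h₁ := m.factorial_ne_zero
  have h₂ := (k - m).factorial_ne_zero
  field_simp
end

section
/- Let Ψ and Φ be functions smooth in a neighborhood of 0, with c_n := Ψ^{(n)}(0)/(n-1)! and c'_n := Φ^{(n)}(0)/(n-1)!. Then for every k ≥ 2: Σ_{m=0}^{k-2} [k!/(m!(m+1)!(k-m-2)!)] · d^m/dx^m ((Ψ'(x))^{k-m-2} (Φ'(x))^2)|_{x=0} = Σ_{π ∈ NC(k)} Σ_{V,W ∈ π, V ≠ W} c'_{|V|} c'_{|W|} ∏_{U ∈ π, U ≠ V, W} c_{|U|}, where the inner sum on the right is over ordered pairs of distinct blocks. -/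
open scoped Classical

section Algebra
open PowerSeries

/-- Weighted count of the ways to close `h` open elements using `r` further elements, where
closing a block of size `i` at the current element has weight `a i`
(and `a 0` is the weight of leaving the current element open). -/
def closingWeight {A : Type*} [CommRing A] (a : ℕ → A) : ℕ → ℕ → A
  | 0, h => if h = 0 then 1 else 0
  | r + 1, h => ∑ i ∈ Finset.range (h + 2), a (h + 1 - i) * closingWeight a r i

lemma sum_antidiagonal_ballot {A : Type*} [CommRing A] (a : ℕ → A) (j h N : ℕ)
    (hN : h + N = j + 1) :
    ((j : A) + 2) * ∑ q ∈ Finset.range (N + 1),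
        ((h + q : ℕ) : A) * (coeff (N - q) (mk a ^ (j + 1)) * a q)
      = ((j : A) + 1) * (((h : A) + 1) * coeff N (mk a ^ (j + 2))) := by
  have e1 : ∑ q ∈ Finset.range (N + 1), coeff (N - q) (mk a ^ (j + 1)) * a q
      = coeff N (mk a ^ (j + 2)) := by
    rw [pow_succ' (mk a) (j + 1), coeff_mul, Finset.Nat.sum_antidiagonal_eq_sum_range_succ_mk]
    simp [mul_comm]
  have e2 : ((j : A) + 2) * ∑ q ∈ Finset.range (N + 1),
      (q : A) * (coeff (N - q) (mk a ^ (j + 1)) * a q) = N * coeff N (mk a ^ (j + 2)) := by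
    have hX : ∀ (f : A⟦X⟧) (n : ℕ), coeff n (X * d⁄dX A f) = n * coeff n f := by
      intro f n
      cases n with
      | zero => simp
      | succ n => rw [coeff_succ_X_mul, coeff_derivative]; push_cast; ring
    rw [← hX, derivative_pow,
      show X * (((j + 2 : ℕ) : A⟦X⟧) * mk a ^ (j + 2 - 1) * d⁄dX A (mk a))
        = ((j + 2 : ℕ) : A⟦X⟧) * ((X * d⁄dX A (mk a)) * mk a ^ (j + 1)) by
        rw [show j + 2 - 1 = j + 1 from rfl]; ring, ← nsmul_eq_mul, map_nsmul, nsmul_eq_mul,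
      coeff_mul, Finset.Nat.sum_antidiagonal_eq_sum_range_succ_mk]
    push_cast
    congr 1
    refine Finset.sum_congr rfl fun q _ => ?_
    rw [hX, coeff_mk]; ring
  have hj : (h : A) + N = j + 1 := by exact_mod_cast congrArg (Nat.cast (R := A)) hN
  simp only [Nat.cast_add, add_mul, Finset.sum_add_distrib, ← Finset.mul_sum, e1]
  linear_combination e2 + coeff N (mk a ^ (j + 2)) * hj

lemma closingWeight_transfer {A : Type*} [CommRing A] (a : ℕ → A) (j r : ℕ) :
    ((j : A) + 2) * ∑ h ∈ Finset.range (j + 1),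
        ((h : A) + 1) * coeff (j - h) (mk a ^ (j + 1)) * closingWeight a (r + 1) h
      = ((j : A) + 1) * ∑ h ∈ Finset.range (j + 2),
        ((h : A) + 1) * coeff (j + 1 - h) (mk a ^ (j + 2)) * closingWeight a r h := by
  have e : ∑ h ∈ Finset.range (j + 1),
        ((h : A) + 1) * coeff (j - h) (mk a ^ (j + 1)) * closingWeight a (r + 1) h
      = ∑ s ∈ Finset.range (j + 2), ∑ h ∈ Finset.range (s + 1),
        (s : A) * coeff (j + 1 - s) (mk a ^ (j + 1)) * (a (s - h) * closingWeight a r h) := by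
    rw [Finset.sum_range_succ' _ (j + 1)]
    simp [closingWeight, Finset.mul_sum]
  rw [e, Finset.sum_comm' (s' := fun h => Finset.Ico h (j + 2)) (t' := Finset.range (j + 2))
    (by intro x y; simp only [Finset.mem_range, Finset.mem_Ico]; omega), Finset.mul_sum,
    Finset.mul_sum]
  refine Finset.sum_congr rfl fun h hh => ?_
  rw [Finset.mem_range] at hh
  have := sum_antidiagonal_ballot a j h (j + 1 - h) (by omega)
  rw [Finset.sum_Ico_eq_sum_range, show j + 2 - h = j + 1 - h + 1 by omega, ← mul_assoc,
    ← mul_assoc, mul_assoc (j + 1 : A), ← this, mul_assoc, Finset.sum_mul]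
  congr 1
  refine Finset.sum_congr rfl fun q _ => ?_
  rw [Nat.add_sub_cancel_left, show j + 1 - (h + q) = j + 1 - h - q by omega]
  ring

lemma closingWeight_zero_right {A : Type*} [CommRing A] [IsDomain A] [CharZero A] (a : ℕ → A)
    (ha : a 0 = 1) (k : ℕ) :
    ((k : A) + 1) * closingWeight a k 0 = coeff k (mk a ^ (k + 1)) := by
  have key : ∀ j r : ℕ, ((j : A) + 1) * closingWeight a (j + r) 0 = ∑ h ∈ Finset.range (j + 1),
        ((h : A) + 1) * coeff (j - h) (mk a ^ (j + 1)) * closingWeight a r h := by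
    intro j
    induction j with
    | zero => intro r; simp [ha]
    | succ j ih =>
      intro r
      have h1 : ((j : A) + 1) ≠ 0 := by exact_mod_cast (Nat.cast_ne_zero (R := A)).2 j.succ_ne_zero
      have h2 := closingWeight_transfer a j r
      rw [← ih, show j + (r + 1) = j + 1 + r by omega] at h2
      apply mul_left_cancel₀ h1
      rw [← h2]; push_cast; ring
  have := key k 0
  rw [add_zero, Finset.sum_range_succ'] at this
  simpa [closingWeight] using this

lemma two_mul_coeff_two_prod {ι : Type*} [DecidableEq ι] (s : Finset ι) (a b : ι → ℝ) :
    2 * (∏ i ∈ s, (Polynomial.C (a i) + Polynomial.X * Polynomial.C (b i))).coeff 2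
      = ∑ i ∈ s, ∑ j ∈ s.erase i, b i * b j * ∏ u ∈ (s.erase i).erase j, a u := by
  have h : ∀ p : Polynomial ℝ, 2 * p.coeff 2 = p.derivative.derivative.eval 0 := by
    intro p
    rw [← Polynomial.coeff_zero_eq_eval_zero, Polynomial.coeff_derivative,
      Polynomial.coeff_derivative]
    norm_num; ring
  rw [h, Polynomial.derivative_prod_finset]
  simp [Polynomial.derivative_prod_finset, Polynomial.eval_finsetSum, Polynomial.eval_prod,
    Finset.sum_mul]
  refine Finset.sum_congr rfl fun i _ => Finset.sum_congr rfl fun j _ => ?_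
  ring

lemma coeff_two_coeff_pow (R S : ℝ⟦X⟧) (k : ℕ) :
    (coeff k ((1 + X * (PowerSeries.map Polynomial.C R
        + C (Polynomial.X) * PowerSeries.map Polynomial.C S)) ^ (k + 1))).coeff 2
      = ∑ b ∈ Finset.range (k + 1), ((k + 1).choose b * b.choose 2 : ℝ) *
          coeff (k - b) (R ^ (b - 2) * S ^ 2) := by
  have hb : ∀ b n, (coeff n ((PowerSeries.map Polynomial.C R
        + C (Polynomial.X) * PowerSeries.map Polynomial.C S) ^ b)).coeff 2
      = (b.choose 2 : ℝ) * coeff n (R ^ (b - 2) * S ^ 2) := by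
    intro b n
    have hc : ∀ i, (coeff n ((C (Polynomial.X) * PowerSeries.map Polynomial.C S) ^ i *
        PowerSeries.map Polynomial.C R ^ (b - i) * (b.choose i : (Polynomial ℝ)⟦X⟧))).coeff 2
        = if i = 2 then (b.choose 2 : ℝ) * coeff n (R ^ (b - 2) * S ^ 2) else 0 := by
      intro i
      rw [show (C (Polynomial.X) * PowerSeries.map Polynomial.C S) ^ i *
          PowerSeries.map Polynomial.C R ^ (b - i) * (b.choose i : (Polynomial ℝ)⟦X⟧)
          = b.choose i • (C (Polynomial.X ^ i) *
            PowerSeries.map Polynomial.C (R ^ (b - i) * S ^ i)) by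
          simp only [map_mul, map_pow, nsmul_eq_mul]; ring,
        map_nsmul, coeff_C_mul, coeff_map, Polynomial.coeff_smul, Polynomial.coeff_mul_C,
        Polynomial.coeff_X_pow, nsmul_eq_mul]
      by_cases h : i = 2
      · subst h; simp
      · simp [h, Ne.symm h]
    rw [add_comm, add_pow, map_sum, Polynomial.finsetSum_coeff, Finset.sum_congr rfl fun i _ => hc i,
      Finset.sum_ite_eq']
    split_ifs with h
    · rfl
    · rw [Nat.choose_eq_zero_of_lt (by simpa using h)]; simp
  rw [add_comm, add_pow, map_sum, Polynomial.finsetSum_coeff, Finset.sum_range_succ]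
  have : ∀ b, (coeff k ((X * (PowerSeries.map Polynomial.C R
        + C (Polynomial.X) * PowerSeries.map Polynomial.C S)) ^ b * 1 ^ (k + 1 - b) *
        ((k + 1).choose b : (Polynomial ℝ)⟦X⟧))).coeff 2 = if b ≤ k then
        ((k + 1).choose b * b.choose 2 : ℝ) * coeff (k - b) (R ^ (b - 2) * S ^ 2) else 0 := by
    intro b
    rw [one_pow, mul_one, mul_pow, mul_comm _ (Nat.cast _), ← nsmul_eq_mul, map_nsmul,
      coeff_X_pow_mul', Polynomial.coeff_smul]
    split_ifs
    · rw [hb, nsmul_eq_mul]; ring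
    · simp
  simp only [this]
  rw [if_neg (by omega), add_zero]
  refine Finset.sum_congr rfl fun b hb => if_pos ?_
  simpa [Nat.lt_succ_iff] using hb

end Algebra

section Analysis
open PowerSeries
/-- The formal Taylor series at `0`. -/
noncomputable def taylorSeriesZero (f : ℝ → ℝ) : ℝ⟦X⟧ :=
  mk fun n => iteratedDeriv n f 0 / (n.factorial : ℝ)

lemma taylorSeriesZero_mul {f g : ℝ → ℝ} (hf : ContDiffAt ℝ (⊤ : ℕ∞) f 0)
    (hg : ContDiffAt ℝ (⊤ : ℕ∞) g 0) :
    taylorSeriesZero (f * g) = taylorSeriesZero f * taylorSeriesZero g := by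
  ext n
  rw [coeff_mul, Finset.Nat.sum_antidiagonal_eq_sum_range_succ_mk]
  simp only [taylorSeriesZero, coeff_mk]
  rw [iteratedDeriv_mul (hf.of_le (by exact_mod_cast le_top)) (hg.of_le (by exact_mod_cast le_top)),
    Finset.sum_div]
  refine Finset.sum_congr rfl fun i hi => ?_
  rw [Nat.cast_choose ℝ (by simpa [Nat.lt_succ_iff] using hi)]
  field_simp

lemma taylorSeriesZero_pow {f : ℝ → ℝ} (hf : ContDiffAt ℝ (⊤ : ℕ∞) f 0) (p : ℕ) :
    taylorSeriesZero (f ^ p) = taylorSeriesZero f ^ p := by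
  induction p with
  | zero =>
    ext n
    rw [pow_zero, pow_zero, taylorSeriesZero, coeff_mk, coeff_one]
    change iteratedDeriv n (fun _ => (1 : ℝ)) 0 / _ = _
    rw [iteratedDeriv_const]
    split_ifs with h <;> simp [h]
  | succ p ih => rw [pow_succ, taylorSeriesZero_mul (f := f ^ p) (hf.pow p) hf, ih, pow_succ]

end Analysis

section Combinatorics

/-- The upper subsets of `T`. -/
noncomputable def upperSubsets {α : Type*} [LinearOrder α] (T : Finset α) : Finset (Finset α) :=
  T.powerset.filter fun V => ∀ v ∈ V, ∀ u ∈ T, v ≤ u → u ∈ V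

lemma mem_upperSubsets {α : Type*} [LinearOrder α] {T V : Finset α} :
    V ∈ upperSubsets T ↔ V ⊆ T ∧ ∀ v ∈ V, ∀ u ∈ T, v ≤ u → u ∈ V := by
  simp [upperSubsets]

lemma sum_upperSubsets {α A : Type*} [LinearOrder α] [AddCommMonoid A] (T : Finset α)
    (g : ℕ → A) : ∑ V ∈ upperSubsets T, g V.card = ∑ i ∈ Finset.range (T.card + 1), g i := by
  induction T using Finset.induction_on_min with
  | empty => simp [upperSubsets]
  | insert m T hm ih =>
    have hmT : m ∉ T := fun h => lt_irrefl _ (hm m h)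
    have e : upperSubsets (insert m T) = insert (insert m T) (upperSubsets T) := by
      ext V
      rw [Finset.mem_insert, mem_upperSubsets, mem_upperSubsets]
      constructor
      · rintro ⟨h1, h2⟩
        by_cases hV : m ∈ V
        · left
          refine Finset.Subset.antisymm h1 fun u hu => h2 m hV u hu ?_
          rcases Finset.mem_insert.1 hu with rfl | hu
          · exact le_rfl
          · exact (hm u hu).le
        · exact Or.inr ⟨(Finset.subset_insert_iff_of_notMem hV).1 h1,
            fun v hv u hu => h2 v hv u (Finset.mem_insert_of_mem hu)⟩
      · rintro (rfl | ⟨h1, h2⟩)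
        · exact ⟨le_rfl, fun v _ u hu _ => hu⟩
        · refine ⟨h1.trans (Finset.subset_insert _ _), fun v hv u hu hvu => ?_⟩
          rcases Finset.mem_insert.1 hu with rfl | hu
          · exact absurd (hm v (h1 hv)) hvu.not_gt
          · exact h2 v hv u hu hvu
    rw [e, Finset.sum_insert fun h => hmT ((mem_upperSubsets.1 h).1 (Finset.mem_insert_self _ _)),
      ih, Finset.card_insert_of_notMem hmT, Finset.sum_range_succ _ (T.card + 1), add_comm]

/-- The non-crossing partitions of `S` all of whose blocks reach `j` or beyond. -/
noncomputable def ncReaching {n : ℕ} (S : Finset (Fin n)) (j : ℕ) :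
    Finset (Finset (Finset (Fin n))) :=
  Finset.univ.filter fun P => ∅ ∉ P ∧ (∀ V ∈ P, V ⊆ S) ∧ (∀ i ∈ S, ∃! V, V ∈ P ∧ i ∈ V) ∧
    IsNonCrossing P ∧ ∀ V ∈ P, ∃ v ∈ V, j ≤ (v : ℕ)

lemma mem_ncReaching {n : ℕ} {S : Finset (Fin n)} {j : ℕ} {P : Finset (Finset (Fin n))} :
    P ∈ ncReaching S j ↔ ∅ ∉ P ∧ (∀ V ∈ P, V ⊆ S) ∧ (∀ i ∈ S, ∃! V, V ∈ P ∧ i ∈ V) ∧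
      IsNonCrossing P ∧ ∀ V ∈ P, ∃ v ∈ V, j ≤ (v : ℕ) := by
  simp [ncReaching]

lemma NC_eq_ncReaching (n : ℕ) : NC n = ncReaching (Finset.univ : Finset (Fin n)) 0 := by
  ext P
  rw [mem_ncReaching, NC, Finset.mem_filter, IsPartitionOf]
  constructor
  · rintro ⟨-, ⟨h1, h2⟩, h3⟩
    refine ⟨h1, fun _ _ => Finset.subset_univ _, fun i _ => h2 i, h3, fun V hV => ?_⟩
    obtain ⟨v, hv⟩ := Finset.nonempty_iff_ne_empty.2 fun h => h1 (h ▸ hV)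
    exact ⟨v, hv, Nat.zero_le _⟩
  · rintro ⟨h1, -, h2, h3, -⟩
    exact ⟨Finset.mem_univ _, ⟨h1, fun i => h2 i (Finset.mem_univ i)⟩, h3⟩

lemma ncReaching_self {n : ℕ} (S : Finset (Fin n)) :
    ncReaching S n = if S = ∅ then {∅} else ∅ := by
  have h0 : ∀ P ∈ ncReaching S n, P = ∅ := by
    intro P hP
    refine Finset.eq_empty_of_forall_notMem fun V hV => ?_
    obtain ⟨v, -, hv⟩ := (mem_ncReaching.1 hP).2.2.2.2 V hV
    omega
  split_ifs with h
  · subst h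
    refine Finset.eq_singleton_iff_unique_mem.2 ⟨?_, h0⟩
    simp [mem_ncReaching, IsNonCrossing]
  · refine Finset.eq_empty_of_forall_notMem fun P hP => ?_
    obtain ⟨i, hi⟩ := Finset.nonempty_iff_ne_empty.2 h
    obtain ⟨V, ⟨hV, -⟩, -⟩ := (mem_ncReaching.1 hP).2.2.1 i hi
    rw [h0 P hP] at hV
    simp at hV

/-- Adjoin the block `V`, unless it is empty. -/
noncomputable def adjoinBlock {n : ℕ} (V : Finset (Fin n)) (Q : Finset (Finset (Fin n))) :
    Finset (Finset (Fin n)) :=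
  if V = ∅ then Q else insert V Q

lemma eq_of_mem_of_mem_ncReaching {n : ℕ} {S : Finset (Fin n)} {j : ℕ}
    {P : Finset (Finset (Fin n))} (hP : P ∈ ncReaching S j) {V W : Finset (Fin n)} {i : Fin n}
    (hV : V ∈ P) (hW : W ∈ P) (hiV : i ∈ V) (hiW : i ∈ W) : V = W :=
  ((mem_ncReaching.1 hP).2.2.1 i ((mem_ncReaching.1 hP).2.1 V hV hiV)).unique ⟨hV, hiV⟩ ⟨hW, hiW⟩

lemma adjoinBlock_mem_ncReaching {n : ℕ} {S : Finset (Fin n)} {j : Fin n} (hj : j ∈ S)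
    {V : Finset (Fin n)} {Q : Finset (Finset (Fin n))}
    (hV : V ∈ upperSubsets (S.filter (· ≤ j))) (hQ : Q ∈ ncReaching (S \ V) (j + 1)) :
    adjoinBlock V Q ∈ ncReaching S j := by
  obtain ⟨hVS, hVu⟩ := mem_upperSubsets.1 hV
  obtain ⟨h1, h2, h3, h4, h5⟩ := mem_ncReaching.1 hQ
  rw [adjoinBlock]
  split_ifs with h
  · subst h
    rw [Finset.sdiff_empty] at h2 h3
    refine mem_ncReaching.2 ⟨h1, h2, h3, h4, fun W hW => ?_⟩
    obtain ⟨w, hw, hjw⟩ := h5 W hW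
    exact ⟨w, hw, by omega⟩
  have hmem : ∀ v ∈ V, v ∈ S ∧ v ≤ j := fun v hv => Finset.mem_filter.1 (hVS hv)
  have hjV : j ∈ V := by
    obtain ⟨v, hv⟩ := Finset.nonempty_iff_ne_empty.2 h
    exact hVu v hv j (Finset.mem_filter.2 ⟨hj, le_rfl⟩) (hmem v hv).2
  have hdis : ∀ W ∈ Q, ∀ w ∈ W, w ∈ S ∧ w ∉ V := fun W hW w hw =>
    Finset.mem_sdiff.1 (h2 W hW hw)
  have hup : ∀ W ∈ Q, ∀ w ∈ W, ∀ v ∈ V, ∀ v' ∈ V, v < w → w < v' → False :=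
    fun W hW w hw v hv v' hv' hvw hwv' => (hdis W hW w hw).2 <| hVu v hv w
      (Finset.mem_filter.2 ⟨(hdis W hW w hw).1, hwv'.le.trans (hmem v' hv').2⟩) hvw.le
  refine mem_ncReaching.2 ⟨?_, ?_, ?_, ?_, ?_⟩
  · simp only [Finset.mem_insert, not_or]
    exact ⟨Ne.symm h, h1⟩
  · intro W hW
    rcases Finset.mem_insert.1 hW with rfl | hW
    · exact fun v hv => (hmem v hv).1
    · exact fun w hw => (hdis W hW w hw).1
  · intro i hi
    by_cases hiV : i ∈ V
    · refine ⟨V, ⟨Finset.mem_insert_self _ _, hiV⟩, ?_⟩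
      rintro W ⟨hW, hiW⟩
      rcases Finset.mem_insert.1 hW with rfl | hW
      · rfl
      · exact absurd hiV (hdis W hW i hiW).2
    · obtain ⟨W, ⟨hW, hiW⟩, hu⟩ := h3 i (Finset.mem_sdiff.2 ⟨hi, hiV⟩)
      refine ⟨W, ⟨Finset.mem_insert_of_mem hW, hiW⟩, ?_⟩
      rintro W' ⟨hW', hiW'⟩
      rcases Finset.mem_insert.1 hW' with rfl | hW'
      · exact absurd hiW' hiV
      · exact hu W' ⟨hW', hiW'⟩
  · intro W hW W' hW' hne w₁ hw₁ w₁' hw₁' w₂ hw₂ w₂' hw₂' hlt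
    rcases Finset.mem_insert.1 hW with rfl | hWQ
    · rcases Finset.mem_insert.1 hW' with rfl | hWQ'
      · exact hne rfl
      · exact hup W' hWQ' w₁' hw₁' w₁ hw₁ w₂ hw₂ hlt.1 hlt.2.1
    · rcases Finset.mem_insert.1 hW' with rfl | hWQ'
      · exact hup W hWQ w₂ hw₂ w₁' hw₁' w₂' hw₂' hlt.2.1 hlt.2.2
      · exact h4 W hWQ W' hWQ' hne w₁ hw₁ w₁' hw₁' w₂ hw₂ w₂' hw₂' hlt
  · intro W hW
    rcases Finset.mem_insert.1 hW with rfl | hW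
    · exact ⟨j, hjV, le_rfl⟩
    · obtain ⟨w, hw, hjw⟩ := h5 W hW
      exact ⟨w, hw, by omega⟩

lemma mem_upperSubsets_of_mem_ncReaching {n : ℕ} {S : Finset (Fin n)} {j : Fin n}
    {P : Finset (Finset (Fin n))} (hP : P ∈ ncReaching S j) {V : Finset (Fin n)} (hV : V ∈ P)
    (hVj : ∀ v ∈ V, v ≤ j) :
    V ∈ upperSubsets (S.filter (· ≤ j)) ∧ P.erase V ∈ ncReaching (S \ V) (j + 1) := by
  obtain ⟨h1, h2, h3, h4, h5⟩ := mem_ncReaching.1 hP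
  have hjV : j ∈ V := by
    obtain ⟨v, hv, hjv⟩ := h5 V hV
    rwa [← le_antisymm (hVj v hv) hjv]
  have hbeyond : ∀ W ∈ P, W ≠ V → ∃ w ∈ W, j < w := by
    intro W hW hne
    obtain ⟨w, hw, hjw⟩ := h5 W hW
    refine ⟨w, hw, lt_of_le_of_ne hjw ?_⟩
    rintro rfl
    exact hne (eq_of_mem_of_mem_ncReaching hP hW hV hw hjV)
  refine ⟨mem_upperSubsets.2 ⟨fun v hv => Finset.mem_filter.2 ⟨h2 V hV hv, hVj v hv⟩, ?_⟩,
    mem_ncReaching.2 ⟨fun h => h1 (Finset.mem_of_mem_erase h), ?_, ?_, ?_, ?_⟩⟩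
  · intro v hv u hu hvu
    obtain ⟨huS, huj⟩ := Finset.mem_filter.1 hu
    by_contra huV
    obtain ⟨W, ⟨hW, huW⟩, -⟩ := h3 u huS
    have hne : W ≠ V := by rintro rfl; exact huV huW
    obtain ⟨w, hw, hjw⟩ := hbeyond W hW hne
    exact h4 V hV W hW hne.symm v hv u huW j hjV w hw
      ⟨lt_of_le_of_ne hvu (by rintro rfl; exact huV hv),
        lt_of_le_of_ne huj (by rintro rfl; exact huV hjV), hjw⟩
  · intro W hW w hw
    obtain ⟨hne, hW⟩ := Finset.mem_erase.1 hW
    exact Finset.mem_sdiff.2 ⟨h2 W hW hw, fun hwV =>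
      hne (eq_of_mem_of_mem_ncReaching hP hW hV hw hwV)⟩
  · intro i hi
    obtain ⟨hiS, hiV⟩ := Finset.mem_sdiff.1 hi
    obtain ⟨W, ⟨hW, hiW⟩, hu⟩ := h3 i hiS
    exact ⟨W, ⟨Finset.mem_erase.2 ⟨by rintro rfl; exact hiV hiW, hW⟩, hiW⟩,
      fun W' hW' => hu W' ⟨Finset.mem_of_mem_erase hW'.1, hW'.2⟩⟩
  · exact fun W hW W' hW' => h4 W (Finset.mem_of_mem_erase hW) W' (Finset.mem_of_mem_erase hW')
  · intro W hW
    obtain ⟨w, hw, hjw⟩ := hbeyond W (Finset.mem_of_mem_erase hW) (Finset.ne_of_mem_erase hW)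
    exact ⟨w, hw, hjw⟩

lemma notMem_of_mem_upperSubsets {n : ℕ} {S S' : Finset (Fin n)} {j : Fin n}
    {V : Finset (Fin n)} {Q : Finset (Finset (Fin n))}
    (hV : V ∈ upperSubsets (S.filter (· ≤ j))) (hQ : Q ∈ ncReaching S' (j + 1)) : V ∉ Q := by
  intro h
  obtain ⟨v, hv, hjv⟩ := (mem_ncReaching.1 hQ).2.2.2.2 V h
  have : v ≤ j := (Finset.mem_filter.1 ((mem_upperSubsets.1 hV).1 hv)).2
  omega

lemma sum_ncReaching_eq {n : ℕ} {A : Type*} [CommRing A] (a : ℕ → A) (ha : a 0 = 1)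
    {S : Finset (Fin n)} {j : Fin n} (hj : j ∈ S) :
    ∑ P ∈ ncReaching S j, ∏ V ∈ P, a V.card
      = ∑ V ∈ upperSubsets (S.filter (· ≤ j)),
          a V.card * ∑ Q ∈ ncReaching (S \ V) (j + 1), ∏ W ∈ Q, a W.card := by
  simp only [Finset.mul_sum]
  rw [Finset.sum_sigma']
  symm
  refine Finset.sum_bij (fun x _ => adjoinBlock x.1 x.2) ?_ ?_ ?_ ?_
  · rintro ⟨V, Q⟩ h
    rw [Finset.mem_sigma] at h
    exact adjoinBlock_mem_ncReaching hj h.1 h.2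
  · have hle : ∀ V ∈ upperSubsets (S.filter (· ≤ j)), ∀ V' Q Q',
        Q' ∈ ncReaching (S \ V') (j + 1) → adjoinBlock V Q = adjoinBlock V' Q' → V ⊆ V' := by
      intro V hV V' Q Q' hQ' h
      rcases eq_or_ne V ∅ with rfl | hne
      · exact Finset.empty_subset _
      have h' : V ∈ adjoinBlock V' Q' := by
        rw [← h, adjoinBlock, if_neg hne]
        exact Finset.mem_insert_self _ _
      have hVQ := notMem_of_mem_upperSubsets hV hQ'
      rw [adjoinBlock] at h'
      split_ifs at h'
      · exact absurd h' hVQ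
      · exact ((Finset.mem_insert.1 h').resolve_right hVQ).subset
    have herase : ∀ V ∈ upperSubsets (S.filter (· ≤ j)), ∀ Q ∈ ncReaching (S \ V) (j + 1),
        (adjoinBlock V Q).erase V = Q := by
      intro V hV Q hQ
      have := notMem_of_mem_upperSubsets hV hQ
      rw [adjoinBlock]
      split_ifs
      · exact Finset.erase_eq_of_notMem this
      · exact Finset.erase_insert this
    rintro ⟨V, Q⟩ h ⟨V', Q'⟩ h' heq
    rw [Finset.mem_sigma] at h h'
    obtain rfl : V = V' := Finset.Subset.antisymm (hle V h.1 V' Q Q' h'.2 heq)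
      (hle V' h'.1 V Q' Q h.2 heq.symm)
    obtain rfl : Q = Q' := by
      rw [← herase V h.1 Q h.2, ← herase V h'.1 Q' h'.2]
      exact congrArg (Finset.erase · V) heq
    rfl
  · intro P hP
    by_cases h : ∃ V ∈ P, ∀ v ∈ V, v ≤ j
    · obtain ⟨V, hV, hVj⟩ := h
      refine ⟨⟨V, P.erase V⟩, Finset.mem_sigma.2 (mem_upperSubsets_of_mem_ncReaching hP hV hVj), ?_⟩
      rw [adjoinBlock, if_neg (by rintro rfl; exact (mem_ncReaching.1 hP).1 hV), Finset.insert_erase hV]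
    · push Not at h
      refine ⟨⟨∅, P⟩, Finset.mem_sigma.2 ⟨by simp [mem_upperSubsets], ?_⟩, if_pos rfl⟩
      obtain ⟨h1, h2, h3, h4, h5⟩ := mem_ncReaching.1 hP
      rw [Finset.sdiff_empty]
      exact mem_ncReaching.2 ⟨h1, h2, h3, h4, h⟩
  · rintro ⟨V, Q⟩ h
    rw [Finset.mem_sigma] at h
    simp only [adjoinBlock]
    split_ifs with h0
    · simp [h0, ha]
    · rw [Finset.prod_insert (notMem_of_mem_upperSubsets h.1 h.2)]

lemma sum_ncReaching_eq_closingWeight {n : ℕ} {A : Type*} [CommRing A] (a : ℕ → A)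
    (ha : a 0 = 1) (r j : ℕ) (hr : j + r = n) (S : Finset (Fin n))
    (hS : ∀ i : Fin n, j ≤ i → i ∈ S) :
    ∑ P ∈ ncReaching S j, ∏ V ∈ P, a V.card
      = closingWeight a r (S.filter fun i : Fin n => (i : ℕ) < j).card := by
  induction r generalizing j S with
  | zero =>
    obtain rfl : j = n := hr
    rw [ncReaching_self, Finset.filter_true_of_mem fun i _ => i.isLt, closingWeight]
    simp only [Finset.card_eq_zero]
    split_ifs <;> simp
  | succ r ih =>
    have hjn : j < n := by omega
    set J : Fin n := ⟨j, hjn⟩ with hJ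
    have hjS : J ∈ S := hS J le_rfl
    have hcard : (S.filter (· ≤ J)).card = (S.filter fun i : Fin n => (i : ℕ) < j).card + 1 := by
      have : S.filter (· ≤ J) = insert J (S.filter fun i : Fin n => (i : ℕ) < j) := by
        ext i
        simp only [Finset.mem_filter, Finset.mem_insert, Fin.le_def, Fin.ext_iff, hJ]
        constructor
        · rintro ⟨h1, h2⟩
          rcases h2.eq_or_lt with h | h
          · exact Or.inl h
          · exact Or.inr ⟨h1, h⟩
        · rintro (h | ⟨h1, h2⟩)
          · exact ⟨by rwa [show i = J from Fin.ext h], h.le⟩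
          · exact ⟨h1, h2.le⟩
      rw [this, Finset.card_insert_of_notMem (by simp [hJ])]
    set h := (S.filter fun i : Fin n => (i : ℕ) < j).card
    have step : ∀ V ∈ upperSubsets (S.filter (· ≤ J)),
        a V.card * ∑ Q ∈ ncReaching (S \ V) (j + 1), ∏ W ∈ Q, a W.card
          = a V.card * closingWeight a r (h + 1 - V.card) := by
      intro V hV
      have hVS := (mem_upperSubsets.1 hV).1
      rw [ih (j + 1) (by omega) (S \ V), ← hcard, ← Finset.card_sdiff_of_subset hVS]
      · congr 3
        ext i
        simp only [Finset.mem_filter, Finset.mem_sdiff, Fin.le_def, hJ, Nat.lt_succ_iff]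
        tauto
      · intro i hi
        refine Finset.mem_sdiff.2 ⟨hS i (by omega), fun hiV => ?_⟩
        have : i ≤ J := (Finset.mem_filter.1 (hVS hiV)).2
        rw [Fin.le_def] at this
        simp only [hJ] at this
        omega
    have key := sum_ncReaching_eq a ha hjS
    simp only [hJ] at key step ⊢
    rw [key, Finset.sum_congr rfl step,
      sum_upperSubsets _ fun i => a i * closingWeight a r (h + 1 - i), hcard,
      ← Finset.sum_range_reflect, closingWeight]
    refine Finset.sum_congr rfl fun i hi => ?_
    rw [Finset.mem_range] at hi
    congr 2
    all_goals omega

/-- Free moment-cumulant formula in coefficient form. -/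
lemma sum_NC_prod {A : Type*} [CommRing A] [IsDomain A] [CharZero A] (a : ℕ → A)
    (ha : a 0 = 1) (k : ℕ) :
    ((k : A) + 1) * ∑ P ∈ NC k, ∏ V ∈ P, a V.card
      = PowerSeries.coeff k (PowerSeries.mk a ^ (k + 1)) := by
  rw [NC_eq_ncReaching, sum_ncReaching_eq_closingWeight a ha k 0 (zero_add k) _ (by simp),
    ← closingWeight_zero_right a ha k]
  simp

end Combinatorics

lemma cast_choose_mul_choose_two (m p : ℕ) :
    (((m + p + 2 : ℕ) : ℝ) + 1) * (((m + p + 2).factorial : ℝ) /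
        ((m.factorial : ℝ) * ((m + 1).factorial : ℝ) * (p.factorial : ℝ)))
      = 2 * (((m + p + 2 + 1).choose (p + 2) * (p + 2).choose 2 : ℝ) / (m.factorial : ℝ)) := by
  rw [show m + p + 2 + 1 = (p + 2) + (m + 1) by ring, Nat.cast_add_choose, Nat.cast_choose_two,
    show p + 2 + (m + 1) = (m + p + 2) + 1 by ring, Nat.factorial_succ (m + p + 2),
    Nat.factorial_succ (p + 1), Nat.factorial_succ p]
  push_cast
  field_simp
  ring

/-- Second-order infinitesimal moment-cumulant identity: the explicit derivative
expression equals the sum over non-crossing partitions with two (ordered, distinct)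
blocks carrying the infinitesimal cumulant `c'` and the remaining blocks carrying `c`. -/
theorem stmt7 (Ψ Φ : ℝ → ℝ) (s : Set ℝ) (hs : s ∈ nhds (0 : ℝ))
    (hΨ : ContDiffOn ℝ (⊤ : ℕ∞) Ψ s) (hΦ : ContDiffOn ℝ (⊤ : ℕ∞) Φ s)
    (c c' : ℕ → ℝ)
    (hc : ∀ n, 1 ≤ n → c n = iteratedDeriv n Ψ 0 / (Nat.factorial (n - 1) : ℝ))
    (hc' : ∀ n, 1 ≤ n → c' n = iteratedDeriv n Φ 0 / (Nat.factorial (n - 1) : ℝ))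
    (k : ℕ) (hk : 2 ≤ k) :
    ∑ m ∈ Finset.range (k - 1),
        ((Nat.factorial k : ℝ) /
            ((Nat.factorial m : ℝ) * (Nat.factorial (m + 1) : ℝ) *
              (Nat.factorial (k - m - 2) : ℝ))) *
          iteratedDeriv m (fun x => (deriv Ψ x) ^ (k - m - 2) * (deriv Φ x) ^ 2) 0
      = ∑ P ∈ NC k, ∑ V ∈ P, ∑ W ∈ P.erase V,
          c' V.card * c' W.card * ∏ U ∈ (P.erase V).erase W, c U.card := by
  have hΨ' : ContDiffAt ℝ (⊤ : ℕ∞) (deriv Ψ) 0 := (hΨ.contDiffAt hs).derivWithin (by simp)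
  have hΦ' : ContDiffAt ℝ (⊤ : ℕ∞) (deriv Φ) 0 := (hΦ.contDiffAt hs).derivWithin (by simp)
  set R := taylorSeriesZero (deriv Ψ) with hR
  set S := taylorSeriesZero (deriv Φ) with hS
  have hderiv : ∀ m p, iteratedDeriv m (fun x => (deriv Ψ x) ^ p * (deriv Φ x) ^ 2) 0
      = m.factorial * PowerSeries.coeff m (R ^ p * S ^ 2) := by
    intro m p
    rw [hR, hS, ← taylorSeriesZero_pow hΨ', ← taylorSeriesZero_pow hΦ',
      ← taylorSeriesZero_mul (f := deriv Ψ ^ p) (g := deriv Φ ^ 2) (hΨ'.pow p) (hΦ'.pow 2),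
      taylorSeriesZero, PowerSeries.coeff_mk, mul_div_cancel₀ _ (by positivity)]
    rfl
  let a : ℕ → Polynomial ℝ := fun n =>
    if n = 0 then 1 else Polynomial.C (c n) + Polynomial.X * Polynomial.C (c' n)
  have ha : PowerSeries.mk a = 1 + PowerSeries.X * (PowerSeries.map Polynomial.C R
        + PowerSeries.C (Polynomial.X) * PowerSeries.map Polynomial.C S) := by
    ext1 n
    cases n with
    | zero => simp [a]
    | succ n =>
      rw [map_add, PowerSeries.coeff_succ_X_mul, PowerSeries.coeff_mk, map_add,
        PowerSeries.coeff_C_mul, PowerSeries.coeff_map, PowerSeries.coeff_map, hR, hS,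
        taylorSeriesZero, taylorSeriesZero, PowerSeries.coeff_mk, PowerSeries.coeff_mk,
        ← iteratedDeriv_succ', ← iteratedDeriv_succ', PowerSeries.coeff_one]
      simp [a, hc, hc']
  have hsum : ∑ P ∈ NC k, ∑ V ∈ P, ∑ W ∈ P.erase V,
      c' V.card * c' W.card * ∏ U ∈ (P.erase V).erase W, c U.card
      = 2 * (∑ P ∈ NC k, ∏ V ∈ P, a V.card).coeff 2 := by
    rw [Polynomial.finsetSum_coeff, Finset.mul_sum]
    refine Finset.sum_congr rfl fun P hP => ?_
    have hne : ∀ V ∈ P, V.card ≠ 0 := fun V hV h =>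
      (mem_ncReaching.1 (NC_eq_ncReaching k ▸ hP)).1 (Finset.card_eq_zero.1 h ▸ hV)
    rw [← two_mul_coeff_two_prod P (fun V => c V.card) fun V => c' V.card]
    congr 2
    exact Finset.prod_congr rfl fun V hV => (if_neg (hne V hV)).symm
  have hmain := congrArg (Polynomial.coeff · 2) (sum_NC_prod a (if_pos rfl) k)
  simp only [ha, coeff_two_coeff_pow] at hmain
  rw [← Nat.cast_succ, ← nsmul_eq_mul, Polynomial.coeff_smul, nsmul_eq_mul, Nat.cast_succ,
    ← Finset.sum_range_reflect] at hmain
  have hk1 : (k : ℝ) + 1 ≠ 0 := by positivity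
  apply mul_left_cancel₀ hk1
  rw [hsum, mul_left_comm, hmain, Finset.mul_sum, Finset.mul_sum]
  obtain ⟨l, rfl⟩ := Nat.exists_eq_add_of_le' hk
  rw [Finset.sum_range_succ _ (l + 2), show l + 2 - 1 = l + 1 from rfl,
    Finset.sum_range_succ _ (l + 1)]
  simp only [Nat.add_sub_cancel, Nat.sub_self, show l + 2 - (l + 1) = 1 by omega,
    Nat.choose_zero_succ, Nat.choose_one_right, show Nat.choose 1 2 = 0 from rfl, Nat.cast_zero,
    mul_zero, zero_mul, add_zero]
  refine Finset.sum_congr rfl fun m hm => ?_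
  obtain ⟨p, rfl⟩ := Nat.exists_eq_add_of_le (Nat.lt_succ_iff.1 (Finset.mem_range.1 hm))
  have h := cast_choose_mul_choose_two m p
  rw [show m + p + 2 - m - 2 = p by omega, show m + p + 2 - m = p + 2 by omega,
    show m + p + 2 - (p + 2) = m by omega, hderiv, ← mul_assoc, h]
  field_simp
end

section
/- For every positive integer k and real numbers γ > 1 and α > √γ, the k-th moment of the signed measure μ' defined by dμ' = δ(α+1+γ+γ/α) + [α(t-2α-γ-1)/(γ+α²+αγ+α-αt) - (t+1-γ)/(2t)] · (1/(2π√((γ+1+2√γ-t)(t-γ-1+2√γ)))) · 1_{t∈[(√γ-1)², (√γ+1)²]} dt equals Σ_{m=0}^{k-1} [k!/(m!(m+1)!(k-m-1)!)] · [d^m/du^m(u^k · (α/(1-α(u-1))) · γ^{k-m-1}) - (1/2)·d^m/du^m(u^{k-1}·γ^{k-m-1})] evaluated at u=1. -/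
open Real

theorem circleAverage_zpow {s : ℝ} (hs : 0 < s) (n : ℤ) :
    circleAverage (fun w : ℂ => w ^ n) 0 s = if n = 0 then 1 else 0 := by
  split_ifs with h
  · subst h
    simp [circleAverage_const]
  · rw [circleAverage_eq_circleIntegral hs.ne']
    have h1 : (∮ z in C(0, s), (z - 0)⁻¹ • z ^ n) = ∮ z in C(0, s), (z - 0) ^ (n - 1) := by
      apply circleIntegral.integral_congr hs.le
      intro z hz
      have hz0 : z ≠ 0 := by
        rintro rfl
        simp at hz
        exact hs.ne hz
      simp [zpow_sub_one₀ hz0, mul_comm]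
    rw [h1, circleIntegral.integral_sub_zpow_of_ne (by lia)]
    simp

theorem ne_zero_of_mem_sphere_zero {s : ℝ} (hs : 0 < s) {z : ℂ} (hz : z ∈ Metric.sphere (0 : ℂ) |s|) :
    z ≠ 0 := by
  rintro rfl
  simp [eq_comm] at hz
  exact hs.ne' hz

theorem one_sub_div_ne_zero {s α : ℝ} (hs : 0 < s) (hα : s < α) {z : ℂ}
    (hz : z ∈ Metric.closedBall (0 : ℂ) |s|) : 1 - z / α ≠ 0 := by
  intro h
  have hα0 : (α : ℂ) ≠ 0 := by exact_mod_cast (hs.trans hα).ne'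
  have hz' : z = α := by
    field_simp at h
    linear_combination -h
  subst hz'
  simp [abs_of_pos hs, abs_of_pos (hs.trans hα)] at hz
  linarith

theorem circleIntegrable_of_continuousOn {s : ℝ} {f : ℂ → ℂ}
    (hf : ContinuousOn f (Metric.sphere (0 : ℂ) |s|)) : CircleIntegrable f 0 s :=
  hf.circleIntegrable'

theorem circleAverage_pow_mul_geom {s α : ℝ} (hs : 0 < s) (hα : s < α) (n : ℕ) :
    circleAverage (fun w : ℂ => w ^ n * (1 - w / α)⁻¹) 0 s = 0 ^ n := by
  have hd : DiffContOnCl ℂ (fun w : ℂ => w ^ n * (1 - w / α)⁻¹) (Metric.ball 0 |s|) := by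
    apply DifferentiableOn.diffContOnCl
    intro z hz
    have hz' := one_sub_div_ne_zero hs hα (Metric.closure_ball_subset_closedBall hz)
    apply DifferentiableAt.differentiableWithinAt
    fun_prop (disch := assumption)
  rw [hd.circleAverage]
  simp

theorem circleAverage_inv_pow_mul_geom {s α : ℝ} (hs : 0 < s) (hα : s < α) (n : ℕ) :
    circleAverage (fun w : ℂ => w⁻¹ ^ n * (1 - w / α)⁻¹) 0 s = (α : ℂ)⁻¹ ^ n := by
  induction n with
  | zero => simpa using circleAverage_pow_mul_geom hs hα 0
  | succ n ih =>
    have hα0 : (α : ℂ) ≠ 0 := by exact_mod_cast (hs.trans hα).ne'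
    have h1 : circleAverage (fun w : ℂ => w⁻¹ ^ (n + 1) * (1 - w / α)⁻¹) 0 s =
        circleAverage (fun w : ℂ => w ^ (-(n + 1 : ℕ) : ℤ)
          + (α : ℂ)⁻¹ • (w⁻¹ ^ n * (1 - w / α)⁻¹)) 0 s := by
      apply circleAverage_congr_sphere
      intro z hz
      have hz0 := ne_zero_of_mem_sphere_zero hs hz
      have hz1 := one_sub_div_ne_zero hs hα (Metric.sphere_subset_closedBall hz)
      have hz2 : (α : ℂ) - z ≠ 0 := by
        intro h
        apply hz1
        rw [← sub_eq_zero.1 h, div_self hα0, sub_self]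
      simp only [zpow_neg, zpow_natCast, smul_eq_mul, inv_pow]
      field_simp
      ring
    rw [h1, circleAverage_fun_add, circleAverage_zpow hs, circleAverage_fun_smul, ih, if_neg (by lia)]
    · simp [pow_succ, mul_comm]
    · apply circleIntegrable_of_continuousOn
      intro z hz
      have hz0 := ne_zero_of_mem_sphere_zero hs hz
      exact (continuousAt_zpow₀ _ _ (Or.inl hz0)).continuousWithinAt
    · apply circleIntegrable_of_continuousOn
      intro z hz
      have hz0 := ne_zero_of_mem_sphere_zero hs hz
      have hz1 := one_sub_div_ne_zero hs hα (Metric.sphere_subset_closedBall hz)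
      apply ContinuousAt.continuousWithinAt
      fun_prop (disch := assumption)

theorem circleAverage_monomial_mul_geom {s α : ℝ} (hs : 0 < s) (hα : s < α) (i j : ℕ) :
    circleAverage (fun w : ℂ => w ^ j * w⁻¹ ^ i * (1 - w / α)⁻¹) 0 s =
      if j ≤ i then (α : ℂ)⁻¹ ^ (i - j) else 0 := by
  split_ifs with h
  · rw [← circleAverage_inv_pow_mul_geom hs hα]
    apply circleAverage_congr_sphere
    intro z hz
    have hz0 := ne_zero_of_mem_sphere_zero hs hz
    obtain ⟨n, rfl⟩ := Nat.exists_eq_add_of_le h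
    simp [pow_add, hz0]
  · obtain ⟨n, rfl⟩ := Nat.exists_eq_add_of_lt (not_le.1 h)
    have h0 := circleAverage_pow_mul_geom hs hα (n + 1)
    rw [zero_pow (by lia)] at h0
    refine (circleAverage_congr_sphere ?_).trans h0
    intro z hz
    have hz0 := ne_zero_of_mem_sphere_zero hs hz
    simp only [add_assoc, pow_add z i, inv_pow]
    field_simp

theorem circleAverage_monomial {s : ℝ} (hs : 0 < s) (i j : ℕ) :
    circleAverage (fun w : ℂ => w ^ j * w⁻¹ ^ i) 0 s = if j = i then 1 else 0 := by
  have h0 := circleAverage_zpow hs ((j : ℤ) - i)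
  simp only [sub_eq_zero, Nat.cast_inj] at h0
  rw [← h0]
  apply circleAverage_congr_sphere
  intro z hz
  have hz0 := ne_zero_of_mem_sphere_zero hs hz
  simp [zpow_sub₀ hz0, div_eq_mul_inv]

theorem iteratedDeriv_pow_at_one (n m : ℕ) :
    iteratedDeriv m (fun u : ℝ => u ^ n) 1 = m.factorial * n.choose m := by
  simp [iteratedDeriv_pow, Nat.descFactorial_eq_factorial_mul_choose]

theorem iteratedDeriv_geom_at_one (α : ℝ) (m : ℕ) :
    iteratedDeriv m (fun u : ℝ => α / (1 - α * (u - 1))) 1 = m.factorial * α ^ (m + 1) := by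
  have h : (fun u : ℝ => α / (1 - α * (u - 1))) = fun u => α * ((-α) * u + (1 + α))⁻¹ := by
    funext u
    rw [div_eq_mul_inv]
    congr 2
    ring
  rw [h, iteratedDeriv_const_mul_field, iteratedDeriv_eq_iterate, iter_deriv_inv_linear]
  simp [neg_pow α]
  ring_nf
  simp 

theorem iteratedDeriv_pow_mul_geom_at_one (α : ℝ) (k m : ℕ) :
    iteratedDeriv m (fun u : ℝ => u ^ k * (α / (1 - α * (u - 1)))) 1 =
      m.factorial * ∑ i ∈ Finset.range (m + 1), k.choose i * α ^ (m + 1 - i) := by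
  rw [iteratedDeriv_fun_mul (by fun_prop)]
  · rw [Finset.mul_sum]
    apply Finset.sum_congr rfl
    intro i hi
    have hi' : i ≤ m := by simpa [Nat.lt_succ_iff] using hi
    rw [iteratedDeriv_pow_at_one, iteratedDeriv_geom_at_one,
      ← Nat.choose_mul_factorial_mul_factorial hi', Nat.sub_add_comm hi']
    push_cast
    ring
  · have : (1 - α * ((1:ℝ) - 1)) ≠ 0 := by simp
    fun_prop (disch := assumption)

theorem integral_zero_two_pi_comp_cos (f : ℝ → ℝ) (hf : Continuous fun θ => f (cos θ)) :
    ∫ θ in (0)..2 * π, f (cos θ) = 2 * ∫ θ in (0)..π, f (cos θ) := by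
  have h : ∫ θ in π..2 * π, f (cos θ) = ∫ θ in (0)..π, f (cos θ) := by
    have h1 := intervalIntegral.integral_comp_sub_left (a := 0) (b := π)
      (fun θ => f (cos θ)) (2 * π)
    simp only [cos_two_pi_sub] at h1
    rw [h1]
    congr 1 <;> ring
  rw [← intervalIntegral.integral_add_adjacent_intervals (hf.intervalIntegrable 0 π)
    (hf.intervalIntegrable π (2 * π)), h]
  ring

/-- The substitution `t = c + 2 s cos θ` for integrals against the arcsine density. -/
theorem integral_arcsine_eq (c : ℝ) {s : ℝ} (hs : 0 < s) (g : ℝ → ℝ) :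
    ∫ t in (c - 2 * s)..(c + 2 * s),
        g t * (1 / (2 * π * √((c + 2 * s - t) * (t - c + 2 * s)))) =
      (2 * π)⁻¹ * ∫ θ in (0)..π, g (c + 2 * s * cos θ) := by
  have himg : (fun θ => c + 2 * s * cos θ) '' Set.Ioo 0 π = Set.Ioo (c - 2 * s) (c + 2 * s) := by
    ext t
    constructor
    · rintro ⟨θ, ⟨h0, h1⟩, rfl⟩
      have h2 : cos θ < cos 0 := cos_lt_cos_of_nonneg_of_le_pi le_rfl h1.le h0
      have h3 : cos π < cos θ := cos_lt_cos_of_nonneg_of_le_pi h0.le le_rfl h1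
      rw [cos_zero] at h2
      rw [cos_pi] at h3
      constructor <;> simp only <;> nlinarith
    · rintro ⟨h0, h1⟩
      have h2 : -1 < (t - c) / (2 * s) := by rw [lt_div_iff₀ (by positivity)]; linarith
      have h3 : (t - c) / (2 * s) < 1 := by rw [div_lt_iff₀ (by positivity)]; linarith
      refine ⟨arccos ((t - c) / (2 * s)), ⟨arccos_pos.2 h3, ?_⟩, ?_⟩
      · refine lt_of_le_of_ne (arccos_le_pi _) fun h => ?_
        exact absurd (arccos_eq_pi.1 h) (not_le.2 h2)
      · simp only
        rw [cos_arccos h2.le h3.le]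
        field_simp
        ring
  have hinj : Set.InjOn (fun θ => c + 2 * s * cos θ) (Set.Ioo 0 π) := by
    intro x hx y hy hxy
    refine injOn_cos (Set.Ioo_subset_Icc_self hx) (Set.Ioo_subset_Icc_self hy) ?_
    simpa [hs.ne'] using hxy
  have hder : ∀ x ∈ Set.Ioo 0 π, HasDerivWithinAt (fun θ => c + 2 * s * cos θ)
      (2 * s * -sin x) (Set.Ioo 0 π) x := fun x _ =>
    (((hasDerivAt_cos x).const_mul (2 * s)).const_add c).hasDerivWithinAt
  rw [intervalIntegral.integral_of_le (by linarith), intervalIntegral.integral_of_le pi_pos.le,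
    MeasureTheory.integral_Ioc_eq_integral_Ioo, MeasureTheory.integral_Ioc_eq_integral_Ioo, ← himg,
    MeasureTheory.integral_image_eq_integral_abs_deriv_smul measurableSet_Ioo hder hinj,
    ← MeasureTheory.integral_const_mul]
  refine MeasureTheory.setIntegral_congr_fun measurableSet_Ioo fun θ hθ => ?_
  have hsin : 0 < sin θ := sin_pos_of_mem_Ioo hθ
  have h1 : (c + 2 * s - (c + 2 * s * cos θ)) * (c + 2 * s * cos θ - c + 2 * s) =
      (2 * s * sin θ) ^ 2 := by
    rw [mul_pow, sin_sq]
    ring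
  have h2 : |2 * s * -sin θ| = 2 * s * sin θ := by
    rw [mul_neg, abs_neg, abs_of_pos (by positivity)]
  simp only [h1, h2, sqrt_sq (by positivity : 0 ≤ 2 * s * sin θ), smul_eq_mul]
  field_simp

/-- On the circle `|w| = √γ`, with `t = (1 + w⁻¹) (γ + w)`, the real part of this function is `t ^ k`
times the density of the correction measure relative to the arcsine density. -/
noncomputable def momentKernel (γ α : ℝ) (k : ℕ) (w : ℂ) : ℂ :=
  -2 * ((1 + w⁻¹) ^ k * (γ + w) ^ k * (1 - w / α)⁻¹)
    - (γ + w) ^ k * (1 + w⁻¹) ^ (k - 1) * w⁻¹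

theorem momentKernel_re {k : ℕ} (hk : 0 < k) {γ α s : ℝ} (hs : 1 < s) (hsγ : γ = s ^ 2)
    (hα : s < α) (θ : ℝ) :
    (momentKernel γ α k (circleMap 0 s θ)).re =
      (γ + 1 + 2 * s * cos θ) ^ k *
        (α * ((γ + 1 + 2 * s * cos θ) - 2 * α - γ - 1) /
            (γ + α ^ 2 + α * γ + α - α * (γ + 1 + 2 * s * cos θ))
          - ((γ + 1 + 2 * s * cos θ) + 1 - γ) / (2 * (γ + 1 + 2 * s * cos θ))) := by
  have hcs := sin_sq_add_cos_sq θ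
  have hcsC : (sin θ : ℂ) ^ 2 + (cos θ : ℂ) ^ 2 = 1 := by exact_mod_cast hcs
  set c := cos θ with hc
  set d := sin θ with hd
  have hc1 : -1 ≤ c := neg_one_le_cos θ
  have hc2 : c ≤ 1 := cos_le_one θ
  have hα0 : 0 < α := by linarith
  have hw : circleMap 0 s θ = (s : ℂ) * (c + d * Complex.I) := by
    simp [circleMap, Complex.exp_mul_I, hc, hd]
  set w := circleMap 0 s θ with hwdef
  have hw0 : w ≠ 0 := circleMap_ne_center (by positivity)
  have hinv : w⁻¹ = (s : ℂ)⁻¹ * (c - d * Complex.I) := by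
    have hsC : (s : ℂ) ≠ 0 := by exact_mod_cast (by positivity : s ≠ 0)
    apply inv_eq_of_mul_eq_one_right
    rw [hw]
    field_simp
    linear_combination hcsC - (d : ℂ) ^ 2 * Complex.I_sq
  have hT : (1 + w⁻¹) * (γ + w) = ((γ + 1 + 2 * s * c : ℝ) : ℂ) := by
    have hsC : (s : ℂ) ≠ 0 := by exact_mod_cast (by positivity : s ≠ 0)
    have : (1 + w⁻¹) * (γ + w) = 1 + γ + w + γ * w⁻¹ := by
      field_simp
      ring
    rw [this, hinv, hw, hsγ]
    push_cast
    field_simp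
    ring
  have hTpos : 0 < γ + 1 + 2 * s * c := by
    rw [hsγ]
    nlinarith [mul_nonneg (by linarith : 0 ≤ s) (by linarith : 0 ≤ 1 + c), sq_pos_of_pos (sub_pos.2 hs)]
  have hB : (γ + w) * w⁻¹ = 1 + (s : ℂ) * (c - d * Complex.I) := by
    have hsC : (s : ℂ) ≠ 0 := by exact_mod_cast (by positivity : s ≠ 0)
    rw [add_mul, mul_inv_cancel₀ hw0, hinv, hsγ]
    push_cast
    field_simp
    ring
  have hDpos : 0 < (α - s * c) ^ 2 + (s * d) ^ 2 := by
    have : (α - s * c) ^ 2 + (s * d) ^ 2 = (α - s) ^ 2 + 2 * α * s * (1 - c) := by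
      linear_combination s ^ 2 * hcs
    rw [this]
    have h1 : 0 < α - s := by linarith
    have h2 : 0 ≤ 1 - c := by linarith
    positivity
  have hA : (1 - w / α)⁻¹ =
      ((α / ((α - s * c) ^ 2 + (s * d) ^ 2) : ℝ) : ℂ) * (α - s * c + s * d * Complex.I) := by
    have hαC : (α : ℂ) ≠ 0 := by exact_mod_cast hα0.ne'
    have hDC : ((α : ℂ) - s * c) ^ 2 + (s * d) ^ 2 ≠ 0 := by exact_mod_cast hDpos.ne'
    apply inv_eq_of_mul_eq_one_right
    rw [hw]
    push_cast
    rw [div_mul_eq_mul_div, mul_div_assoc', div_eq_one_iff_eq hDC]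
    field_simp
    linear_combination -(s * d : ℂ) ^ 2 * Complex.I_sq
  obtain ⟨n, rfl⟩ : ∃ n, k = n + 1 := ⟨k - 1, by lia⟩
  have hK : momentKernel γ α (n + 1) w =
      ((γ + 1 + 2 * s * c : ℝ) : ℂ) ^ (n + 1) * (-2 * (1 - w / α)⁻¹)
        - ((γ + 1 + 2 * s * c : ℝ) : ℂ) ^ n * ((γ + w) * w⁻¹) := by
    rw [← hT, momentKernel, mul_pow, mul_pow, Nat.add_sub_cancel]
    ring
  rw [hK, hB, hA]
  set T := γ + 1 + 2 * s * c with hTdef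
  rw [← Complex.ofReal_pow, ← Complex.ofReal_pow, Complex.sub_re, Complex.re_ofReal_mul,
    Complex.re_ofReal_mul]
  simp only [Complex.mul_re, Complex.mul_im, Complex.neg_re, Complex.neg_im, Complex.re_ofNat,
    Complex.im_ofNat, Complex.add_re, Complex.add_im, Complex.sub_re, Complex.sub_im,
    Complex.ofReal_re, Complex.ofReal_im, Complex.one_re, Complex.I_re, Complex.I_im]
  have hden : γ + α ^ 2 + α * γ + α - α * T = (α - s * c) ^ 2 + (s * d) ^ 2 := by
    rw [hTdef, hsγ]
    linear_combination -s ^ 2 * hcs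
  rw [hden]
  have h1 : T - 2 * α - γ - 1 = -2 * (α - s * c) := by rw [hTdef]; ring
  have h2 : T + 1 - γ = 2 * (1 + s * c) := by rw [hTdef]; ring
  rw [h1, h2]
  field_simp
  ring

theorem circleIntegrable_monomial {s : ℝ} (hs : 0 < s) (i j : ℕ) :
    CircleIntegrable (fun w : ℂ => w ^ j * w⁻¹ ^ i) 0 s := by
  apply circleIntegrable_of_continuousOn
  intro z hz
  have hz0 := ne_zero_of_mem_sphere_zero hs hz
  apply ContinuousAt.continuousWithinAt
  fun_prop (disch := assumption)

theorem circleIntegrable_monomial_mul_geom {s α : ℝ} (hs : 0 < s) (hα : s < α) (i j : ℕ) :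
    CircleIntegrable (fun w : ℂ => w ^ j * w⁻¹ ^ i * (1 - w / α)⁻¹) 0 s := by
  apply circleIntegrable_of_continuousOn
  intro z hz
  have hz0 := ne_zero_of_mem_sphere_zero hs hz
  have hz1 := one_sub_div_ne_zero hs hα (Metric.sphere_subset_closedBall hz)
  apply ContinuousAt.continuousWithinAt
  fun_prop (disch := assumption)

theorem momentKernel_expand {k : ℕ} (hk : 0 < k) (γ α : ℝ) (w : ℂ) :
    momentKernel γ α k w =
      (∑ j ∈ Finset.range (k + 1), ∑ i ∈ Finset.range (k + 1),
        (-2 * k.choose j * k.choose i * γ ^ (k - j) : ℂ) • (w ^ j * w⁻¹ ^ i * (1 - w / α)⁻¹)) +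
      ∑ j ∈ Finset.range (k + 1), ∑ m ∈ Finset.range k,
        (-(k.choose j * (k - 1).choose m * γ ^ (k - j)) : ℂ) • (w ^ j * w⁻¹ ^ (m + 1)) := by
  obtain ⟨n, rfl⟩ : ∃ n, k = n + 1 := ⟨k - 1, by lia⟩
  have h1 : ∀ n, (1 + w⁻¹) ^ n = ∑ i ∈ Finset.range (n + 1), w⁻¹ ^ i * n.choose i := by
    intro n
    rw [add_comm, add_pow]
    simp
  have h2 : (γ + w) ^ (n + 1) = ∑ j ∈ Finset.range (n + 1 + 1),
      w ^ j * (γ : ℂ) ^ (n + 1 - j) * (n + 1).choose j := by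
    rw [add_comm, add_pow]
  rw [momentKernel, Nat.add_sub_cancel, h2, mul_comm ((1 + w⁻¹) ^ (n + 1)), h1, h1,
    Finset.sum_mul_sum, Finset.sum_mul_sum, sub_eq_add_neg]
  congr 1
  · simp only [Finset.sum_mul, Finset.mul_sum]
    refine Finset.sum_congr rfl fun j _ => Finset.sum_congr rfl fun i _ => ?_
    rw [smul_eq_mul]
    ring
  · simp only [Finset.sum_mul, ← Finset.sum_neg_distrib]
    refine Finset.sum_congr rfl fun j _ => Finset.sum_congr rfl fun i _ => ?_
    rw [smul_eq_mul]
    ring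

theorem circleIntegrable_momentKernel {k : ℕ} {γ α s : ℝ} (hs : 0 < s) (hα : s < α) :
    CircleIntegrable (momentKernel γ α k) 0 s := by
  apply circleIntegrable_of_continuousOn
  intro z hz
  have hz0 := ne_zero_of_mem_sphere_zero hs hz
  have hz1 := one_sub_div_ne_zero hs hα (Metric.sphere_subset_closedBall hz)
  apply ContinuousAt.continuousWithinAt
  unfold momentKernel
  fun_prop (disch := assumption)

theorem circleAverage_momentKernel {k : ℕ} (hk : 0 < k) {γ α s : ℝ} (hs : 0 < s) (hα : s < α) :
    circleAverage (momentKernel γ α k) 0 s =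
      ((-2 * (∑ j ∈ Finset.range (k + 1), ∑ i ∈ Finset.range (k + 1),
        k.choose j * k.choose i * γ ^ (k - j) * if j ≤ i then α⁻¹ ^ (i - j) else 0)
      - ∑ m ∈ Finset.range k, k.choose (m + 1) * (k - 1).choose m * γ ^ (k - m - 1) : ℝ) : ℂ) := by
  rw [funext (momentKernel_expand hk γ α)]
  have hi1 (j i : ℕ) := (circleIntegrable_monomial_mul_geom hs hα i j).const_fun_smul
    (a := (-2 * k.choose j * k.choose i * γ ^ (k - j) : ℂ))
  have hi2 (j m : ℕ) := (circleIntegrable_monomial hs (m + 1) j).const_fun_smul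
    (a := (-(k.choose j * (k - 1).choose m * γ ^ (k - j)) : ℂ))
  rw [circleAverage_fun_add
    (CircleIntegrable.fun_sum _ fun j _ => CircleIntegrable.fun_sum _ fun i _ => hi1 j i)
    (CircleIntegrable.fun_sum _ fun j _ => CircleIntegrable.fun_sum _ fun m _ => hi2 j m),
    circleAverage_fun_sum fun j _ => CircleIntegrable.fun_sum _ fun i _ => hi1 j i,
    circleAverage_fun_sum fun j _ => CircleIntegrable.fun_sum _ fun m _ => hi2 j m]
  simp_rw [circleAverage_fun_sum fun i (_ : i ∈ Finset.range (k + 1)) => hi1 _ i,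
    circleAverage_fun_sum fun i (_ : i ∈ Finset.range k) => hi2 _ i, circleAverage_fun_smul,
    circleAverage_monomial hs, circleAverage_monomial_mul_geom hs hα]
  rw [Complex.ofReal_sub, sub_eq_add_neg]
  congr 1
  · push_cast
    simp only [Finset.mul_sum]
    refine Finset.sum_congr rfl fun j _ => Finset.sum_congr rfl fun i _ => ?_
    rw [smul_eq_mul]
    split_ifs <;> (simp; try ring)
  · rw [Finset.sum_comm]
    push_cast
    rw [← Finset.sum_neg_distrib]
    refine Finset.sum_congr rfl fun m hm => ?_
    rw [Finset.sum_eq_single (m + 1)]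
    · simp [Nat.sub_sub]
    · intro j _ hj
      simp [hj]
    · intro h
      exact absurd (Finset.mem_range.2 (by simpa using hm)) h

theorem outlier_pow_eq {γ α : ℝ} (hα : α ≠ 0) (k : ℕ) :
    (α + 1 + γ + γ / α) ^ k = ∑ j ∈ Finset.range (k + 1), ∑ i ∈ Finset.range (k + 1),
      k.choose j * k.choose i * γ ^ (k - j) * (α ^ j * α⁻¹ ^ i) := by
  have h : α + 1 + γ + γ / α = (α + γ) * (α⁻¹ + 1) := by
    field_simp
    ring
  rw [h, mul_pow, add_pow, add_pow, Finset.sum_mul_sum]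
  refine Finset.sum_congr rfl fun j _ => Finset.sum_congr rfl fun i _ => ?_
  rw [one_pow]
  ring

theorem outlier_pow_sub {γ α : ℝ} (hα : α ≠ 0) (k : ℕ) :
    (α + 1 + γ + γ / α) ^ k - (∑ j ∈ Finset.range (k + 1), ∑ i ∈ Finset.range (k + 1),
        k.choose j * k.choose i * γ ^ (k - j) * if j ≤ i then α⁻¹ ^ (i - j) else 0) =
      ∑ m ∈ Finset.range k, k.choose (m + 1) * γ ^ (k - m - 1) *
        ∑ i ∈ Finset.range (m + 1), k.choose i * α ^ (m + 1 - i) := by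
  have h (j i : ℕ) : α ^ j * α⁻¹ ^ i - (if j ≤ i then α⁻¹ ^ (i - j) else 0) =
      if i < j then α ^ (j - i) else 0 := by
    rcases lt_or_ge i j with hij | hij
    · rw [if_neg (not_le.2 hij), if_pos hij, sub_zero, pow_sub₀ _ hα hij.le, inv_pow]
    · rw [if_pos hij, if_neg (not_lt.2 hij), pow_sub₀ _ (inv_ne_zero hα) hij]
      simp
      ring
  rw [outlier_pow_eq hα, ← Finset.sum_sub_distrib]
  simp_rw [← Finset.sum_sub_distrib, ← mul_sub, h]
  rw [Finset.sum_range_succ']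
  simp only [not_lt_zero, if_false, mul_zero, Finset.sum_const_zero, add_zero]
  refine Finset.sum_congr rfl fun m hm => ?_
  have hm' : m < k := Finset.mem_range.1 hm
  rw [Finset.mul_sum]
  symm
  apply Finset.sum_subset_zero_on_sdiff (Finset.range_subset_range.2 (by lia))
  · intro i hi
    have : ¬ i < m + 1 := by simpa using (Finset.mem_sdiff.1 hi).2
    simp [this]
  · intro i hi
    rw [if_pos (Finset.mem_range.1 hi), Nat.sub_sub]
    ring

theorem factorial_ratio_mul_factorial {k m : ℕ} (hm : m < k) :
    (k.factorial : ℝ) / (m.factorial * (m + 1).factorial * (k - m - 1).factorial) * m.factorial =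
      k.choose (m + 1) := by
  rw [Nat.cast_choose ℝ (Nat.succ_le_of_lt hm), Nat.succ_eq_add_one, Nat.sub_sub]
  have := Nat.factorial_ne_zero m
  field_simp

/-- Discrete BBP phase transition (outlier regime `α > √γ`): the `k`-th moment of the
correction measure (a unit point mass at `α+1+γ+γ/α` plus an explicit density on
`[(√γ-1)², (√γ+1)²]`) equals the general Schur-generating-function correction formula
with `Ψ(u) = γ(u-1)` and `Φ(u) = -log(1-α(u-1))`. -/
theorem stmt18 (k : ℕ) (hk : 0 < k) (γ α : ℝ) (hγ : 1 < γ) (hα : Real.sqrt γ < α) :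
    (α + 1 + γ + γ / α) ^ k
      + (∫ t in ((Real.sqrt γ - 1) ^ 2)..((Real.sqrt γ + 1) ^ 2),
          t ^ k *
            ((α * (t - 2 * α - γ - 1) / (γ + α ^ 2 + α * γ + α - α * t)
                - (t + 1 - γ) / (2 * t)) *
              (1 / (2 * Real.pi *
                Real.sqrt ((γ + 1 + 2 * Real.sqrt γ - t) * (t - γ - 1 + 2 * Real.sqrt γ))))))
    = ∑ m ∈ Finset.range k,
        ((Nat.factorial k : ℝ) /
            ((Nat.factorial m : ℝ) * (Nat.factorial (m + 1) : ℝ) *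
              (Nat.factorial (k - m - 1) : ℝ))) *
          (iteratedDeriv m (fun u : ℝ => u ^ k * (α / (1 - α * (u - 1))) * γ ^ (k - m - 1)) 1
            - (1 / 2) * iteratedDeriv m (fun u : ℝ => u ^ (k - 1) * γ ^ (k - m - 1)) 1) := by
  have hsγ : γ = √γ ^ 2 := (sq_sqrt (by linarith)).symm
  have hs : 1 < √γ := by rwa [lt_sqrt zero_le_one, one_pow]
  have hs0 : 0 < √γ := by linarith
  have hint : (∫ t in ((√γ - 1) ^ 2)..((√γ + 1) ^ 2),
      t ^ k * ((α * (t - 2 * α - γ - 1) / (γ + α ^ 2 + α * γ + α - α * t)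
          - (t + 1 - γ) / (2 * t)) *
        (1 / (2 * π * √((γ + 1 + 2 * √γ - t) * (t - γ - 1 + 2 * √γ)))))) =
      (circleAverage (momentKernel γ α k) 0 √γ).re / 2 := by
    have ha : (√γ - 1) ^ 2 = γ + 1 - 2 * √γ := by linear_combination -hsγ
    have hb : (√γ + 1) ^ 2 = γ + 1 + 2 * √γ := by linear_combination -hsγ
    have hre := momentKernel_re hk hs hsγ hα
    have hcont : Continuous fun θ : ℝ => (momentKernel γ α k (circleMap 0 √γ θ)).re := by
      refine Complex.continuous_re.comp (continuous_iff_continuousAt.2 fun θ => ?_)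
      have hz : circleMap 0 √γ θ ∈ Metric.sphere (0 : ℂ) |√γ| := circleMap_mem_sphere' 0 _ θ
      have hz0 := ne_zero_of_mem_sphere_zero hs0 hz
      have hz1 := one_sub_div_ne_zero hs0 hα (Metric.sphere_subset_closedBall hz)
      have hcm : Continuous (circleMap 0 √γ) := continuous_circleMap 0 √γ
      have hm : ContinuousAt (momentKernel γ α k) (circleMap 0 √γ θ) := by
        unfold momentKernel
        fun_prop (disch := assumption)
      exact hm.comp (f := circleMap 0 √γ) hcm.continuousAt
    have hG := integral_arcsine_eq (γ + 1) hs0 fun t =>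
      t ^ k * (α * (t - 2 * α - γ - 1) / (γ + α ^ 2 + α * γ + α - α * t)
          - (t + 1 - γ) / (2 * t))
    have hsymm := integral_zero_two_pi_comp_cos (fun x => (γ + 1 + 2 * √γ * x) ^ k *
        (α * ((γ + 1 + 2 * √γ * x) - 2 * α - γ - 1) /
            (γ + α ^ 2 + α * γ + α - α * (γ + 1 + 2 * √γ * x))
          - ((γ + 1 + 2 * √γ * x) + 1 - γ) / (2 * (γ + 1 + 2 * √γ * x))))
      (by simpa only [hre] using hcont)
    have hL := Complex.reCLM.circleAverage_comp_comm
      (circleIntegrable_momentKernel (γ := γ) (k := k) hs0 hα)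
    rw [Complex.reCLM_apply] at hL
    rw [← hL, circleAverage]
    simp only [Function.comp_apply, Complex.reCLM_apply, hre]
    rw [hsymm, ha, hb, smul_eq_mul]
    simp only [← mul_assoc, ← sub_sub] at hG ⊢
    rw [hG]
    ring
  rw [hint, circleAverage_momentKernel hk hs0 hα, Complex.ofReal_re]
  have hsum := outlier_pow_sub (γ := γ) (hs0.trans hα).ne' k
  have hR : ∀ m ∈ Finset.range k, ((Nat.factorial k : ℝ) /
            ((Nat.factorial m : ℝ) * (Nat.factorial (m + 1) : ℝ) *
              (Nat.factorial (k - m - 1) : ℝ))) *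
          (iteratedDeriv m (fun u : ℝ => u ^ k * (α / (1 - α * (u - 1))) * γ ^ (k - m - 1)) 1
            - (1 / 2) * iteratedDeriv m (fun u : ℝ => u ^ (k - 1) * γ ^ (k - m - 1)) 1) =
      k.choose (m + 1) * γ ^ (k - m - 1) *
        (∑ i ∈ Finset.range (m + 1), k.choose i * α ^ (m + 1 - i)) -
      1 / 2 * (k.choose (m + 1) * (k - 1).choose m * γ ^ (k - m - 1)) := by
    intro m hm
    rw [iteratedDeriv_mul_const_field, iteratedDeriv_mul_const_field,
      iteratedDeriv_pow_mul_geom_at_one, iteratedDeriv_pow_at_one,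
      ← factorial_ratio_mul_factorial (Finset.mem_range.1 hm)]
    ring
  rw [Finset.sum_congr rfl hR, Finset.sum_sub_distrib, ← hsum, ← Finset.mul_sum]
  ring
end
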